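/- arXiv:2202.13977 — 5 statements merged into one kernel-verified Lean document; each statement's English description precedes it below -/
import Mathlib

section
/- For every ordered graph H and every ε>0, there exists δ>0 such that for every H-free ordered graph G there exists X⊆V(G) with |X|≥δ|G| such that one of the graphs G[X] and the complement of G restricted to X has maximum degree less than εδ|G|. -/
/-- Containment of ordered graphs (graphs on `Fin m` with the natural numbering):
an induced subgraph with the induced numbering is isomorphic to `H` as an ordered graph. -/
def OContains {n m : ℕ} (G : SimpleGraph (Fin n)) (H : SimpleGraph (Fin m)) : Prop :=
  ∃ f : Fin m → Fin n, StrictMono f ∧ ∀ u v, H.Adj u v ↔ G.Adj (f u) (f v)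
/-- The degree of `v` inside the induced subgraph `G[X]`. -/
noncomputable def degIn {n : ℕ} (G : SimpleGraph (Fin n)) (X : Finset (Fin n))
    (v : Fin n) : ℕ :=
  Nat.card {u : Fin n | u ∈ X ∧ G.Adj v u}

open Classical in
/-- Number of adjacent pairs between `X` and `Y`, as a real number. -/
noncomputable def eeR {V : Type} (G : SimpleGraph V) (X Y : Finset V) : ℝ :=
  ∑ x ∈ X, ∑ y ∈ Y, if G.Adj x y then (1 : ℝ) else 0

lemma eeR_comm {V : Type} (G : SimpleGraph V) (X Y : Finset V) : eeR G X Y = eeR G Y X := by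
  unfold eeR
  rw [Finset.sum_comm]
  exact Finset.sum_congr rfl fun x _ => Finset.sum_congr rfl fun y _ =>
    by classical exact if_congr (G.adj_comm _ _) rfl rfl

lemma eeR_nonneg {V : Type} (G : SimpleGraph V) (X Y : Finset V) : 0 ≤ eeR G X Y := by
  unfold eeR
  refine Finset.sum_nonneg fun x _ => Finset.sum_nonneg fun y _ => ?_
  split_ifs <;> norm_num

lemma eeR_le {V : Type} (G : SimpleGraph V) (X Y : Finset V) :
    eeR G X Y ≤ X.card * Y.card := by
  unfold eeR
  calc _ ≤ ∑ x ∈ X, ∑ y ∈ Y, (1 : ℝ) := by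
        refine Finset.sum_le_sum fun x _ => Finset.sum_le_sum fun y _ => ?_
        split_ifs <;> norm_num
    _ = _ := by simp

lemma eeR_union {V : Type} [DecidableEq V] (G : SimpleGraph V) (X Y : Finset V)
    (h : Disjoint X Y) :
    eeR G (X ∪ Y) (X ∪ Y) = eeR G X X + eeR G Y Y + 2 * eeR G Y X := by
  have h1 := eeR_comm G X Y
  unfold eeR at *
  rw [Finset.sum_union h]
  simp only [Finset.sum_union h, Finset.sum_add_distrib]
  linarith

lemma eeR_sum {V : Type} (G : SimpleGraph V) (X Y : Finset V) :
    eeR G X Y = ∑ x ∈ X, eeR G {x} Y := by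
  simp [eeR]

lemma eeR_mono_right {V : Type} (G : SimpleGraph V) (X : Finset V) {Y Z : Finset V}
    (h : Y ⊆ Z) : eeR G X Y ≤ eeR G X Z := by
  unfold eeR
  refine Finset.sum_le_sum fun x _ => Finset.sum_le_sum_of_subset_of_nonneg h fun y _ _ => ?_
  split_ifs <;> norm_num

lemma eeR_singleton {V : Type} (G : SimpleGraph V) (x : V) (Y : Finset V)
    [DecidablePred fun y => G.Adj x y] :
    eeR G {x} Y = (Y.filter (fun y => G.Adj x y)).card := by
  unfold eeR
  rw [Finset.card_filter]
  push_cast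
  rw [Finset.sum_singleton]
  refine Finset.sum_congr rfl fun y _ => ?_
  split_ifs <;> rfl

/-- Markov: the vertices of `X` of degree at most `t` to `Y`. -/
lemma eeR_markov {V : Type} (G : SimpleGraph V) (X Y : Finset V) (t : ℝ) :
    ∃ Z ⊆ X, (∀ z ∈ Z, eeR G {z} Y ≤ t) ∧ ((X.card : ℝ) - Z.card) * t ≤ eeR G X Y := by
  classical
  refine ⟨X.filter (fun z => eeR G {z} Y ≤ t), Finset.filter_subset _ _,
    fun z hz => (Finset.mem_filter.1 hz).2, ?_⟩
  have hc := Finset.card_filter_add_card_filter_not (s := X) (fun z => eeR G {z} Y ≤ t)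
  have hc' : (X.card : ℝ) - (X.filter (fun z => eeR G {z} Y ≤ t)).card
      = (X.filter (fun z => ¬ eeR G {z} Y ≤ t)).card := by
    rw [← hc]; push_cast; ring
  rw [hc', eeR_sum]
  calc _ = ∑ x ∈ X.filter (fun z => ¬ eeR G {z} Y ≤ t), t := by simp
    _ ≤ ∑ x ∈ X.filter (fun z => ¬ eeR G {z} Y ≤ t), eeR G {x} Y := by
        refine Finset.sum_le_sum fun x hx => ?_
        exact (not_le.1 (Finset.mem_filter.1 hx).2).le
    _ ≤ _ := Finset.sum_le_sum_of_subset_of_nonneg (Finset.filter_subset _ _)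
        fun x _ _ => eeR_nonneg _ _ _

/-- The dichotomy: a sparse set of size `k` or a dense set of size `l`. -/
def DD {V : Type} (G : SimpleGraph V) (a b : ℝ) (W : Finset V) (k l : ℕ) : Prop :=
  (∃ X ⊆ W, X.card = k ∧ eeR G X X ≤ a * k ^ 2) ∨
  (∃ Y ⊆ W, Y.card = l ∧ eeR Gᶜ Y Y ≤ b * l ^ 2)

lemma DD_swap {V : Type} {G : SimpleGraph V} {a b : ℝ} {W : Finset V} {k l : ℕ}
    (h : DD Gᶜ b a W l k) : DD G a b W k l := by
  unfold DD at *
  rw [compl_compl] at h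
  exact h.symm

lemma DD_mono {V : Type} {G : SimpleGraph V} {a b : ℝ} {W W' : Finset V} {k l : ℕ}
    (hW : W ⊆ W') (h : DD G a b W k l) : DD G a b W' k l := by
  rcases h with ⟨X, h1, h2⟩ | ⟨X, h1, h2⟩
  · exact Or.inl ⟨X, h1.trans hW, h2⟩
  · exact Or.inr ⟨X, h1.trans hW, h2⟩

lemma DD_triv {V : Type} {G : SimpleGraph V} {a b : ℝ} (ha : 1 ≤ a) {W : Finset V} {k l : ℕ}
    (hk : k ≤ W.card) : DD G a b W k l := by
  obtain ⟨X, hX, hc⟩ := Finset.exists_subset_card_eq hk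
  refine Or.inl ⟨X, hX, hc, ?_⟩
  have := eeR_le G X X
  rw [hc] at this
  nlinarith [sq_nonneg (k : ℝ)]

lemma DD_small {V : Type} {G : SimpleGraph V} {a b : ℝ} (ha : 0 < a) {W : Finset V} {k l : ℕ}
    (hk : k ≤ W.card) (hk1 : k ≤ 1) : DD G a b W k l := by
  obtain ⟨X, hX, hc⟩ := Finset.exists_subset_card_eq hk
  refine Or.inl ⟨X, hX, hc, ?_⟩
  have : eeR G X X = 0 := by
    unfold eeR
    refine Finset.sum_eq_zero fun x hx => Finset.sum_eq_zero fun y hy => ?_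
    have : x = y := Finset.card_le_one.1 (hc ▸ hk1) x hx y hy
    simp [this]
  rw [this]
  positivity

lemma DD_combine {V : Type} (G : SimpleGraph V) (a b δ : ℝ) (ha : 0 < a)
    (A B : Finset V) (hAB : Disjoint A B) (W : Finset V) (hAW : A ⊆ W) (hBW : B ⊆ W)
    (hs : ∀ v ∈ A, eeR G {v} B ≤ a / 32 * B.card) (k l : ℕ) (hk2 : 2 ≤ k) (hδ : 0 < δ)
    (hkA : (k : ℝ) ≤ δ * A.card) (hlA : (l : ℝ) ≤ δ * A.card)
    (hkB : (k : ℝ) ≤ δ * (B.card / 2)) (hlB : (l : ℝ) ≤ δ * (B.card / 2))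
    (hD : ∀ W' : Finset V, ∀ k' l' : ℕ, (k' : ℝ) ≤ δ * W'.card → (l' : ℝ) ≤ δ * W'.card →
      DD G (3 / 2 * a) b W' k' l') : DD G a b W k l := by
  classical
  obtain ⟨k1, k2, hk12, hk1, hk21, hk12'⟩ :
      ∃ k1 k2 : ℕ, k1 + k2 = k ∧ 1 ≤ k1 ∧ k2 ≤ k1 ∧ k1 ≤ k2 + 1 :=
    ⟨k - k / 2, k / 2, by omega, by omega, by omega, by omega⟩
  have hk1k : (k1 : ℝ) ≤ k := by exact_mod_cast (by omega : k1 ≤ k)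
  have hk2k : (k2 : ℝ) ≤ k := by exact_mod_cast (by omega : k2 ≤ k)
  rcases hD A k1 l (hk1k.trans hkA) hlA with ⟨A', hA', hcA', heA'⟩ | ⟨Y, hY, h⟩
  swap
  · exact Or.inr ⟨Y, hY.trans hAW, h⟩
  obtain ⟨B'', hB'', hdeg, hcard⟩ := eeR_markov G B A' (a / 16 * k1)
  have hk1pos : (1 : ℝ) ≤ k1 := by exact_mod_cast hk1
  have he : eeR G B A' ≤ k1 * (a / 32 * B.card) := by
    rw [eeR_comm, eeR_sum]
    calc _ ≤ ∑ x ∈ A', a / 32 * (B.card : ℝ) := Finset.sum_le_sum fun x hx => hs x (hA' hx)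
      _ = _ := by simp [hcA']
  have hBhalf : (B.card : ℝ) / 2 ≤ B''.card := by
    have h1 : ((B.card : ℝ) / 2 - B''.card) * (a / 16 * k1) ≤ 0 := by nlinarith
    have h2 : 0 < a / 16 * k1 := by positivity
    by_contra hcon
    push Not at hcon
    have : 0 < ((B.card : ℝ) / 2 - B''.card) * (a / 16 * k1) := mul_pos (by linarith) h2
    linarith
  have hm : δ * ((B.card : ℝ) / 2) ≤ δ * B''.card := by gcongr
  rcases hD B'' k2 l ((hk2k.trans hkB).trans hm) (hlB.trans hm) with
    ⟨B', hB', hcB', heB'⟩ | ⟨Y, hY, h⟩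
  swap
  · exact Or.inr ⟨Y, (hY.trans hB'').trans hBW, h⟩
  have hdis : Disjoint A' B' := Finset.disjoint_of_subset_left hA'
    (Finset.disjoint_of_subset_right (hB'.trans hB'') hAB)
  refine Or.inl ⟨A' ∪ B', Finset.union_subset (hA'.trans hAW) ((hB'.trans hB'').trans hBW), ?_, ?_⟩
  · rw [Finset.card_union_of_disjoint hdis, hcA', hcB', hk12]
  rw [eeR_union G A' B' hdis]
  have hcross : eeR G B' A' ≤ k2 * (a / 16 * k1) := by
    rw [eeR_sum]
    calc _ ≤ ∑ x ∈ B', a / 16 * (k1 : ℝ) := Finset.sum_le_sum fun x hx => hdeg x (hB' hx)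
      _ = _ := by simp [hcB']
  have hkk : (k : ℝ) = k1 + k2 := by exact_mod_cast hk12.symm
  have h5 : (k1 : ℝ) ^ 2 + k2 ^ 2 ≤ 5 / 8 * (k : ℝ) ^ 2 := by
    have e1 : (k2 : ℝ) ≤ k1 := by exact_mod_cast hk21
    have e2 : (k1 : ℝ) ≤ k2 + 1 := by exact_mod_cast hk12'
    have e3 : (2 : ℝ) ≤ k1 + k2 := by rw [← hkk]; exact_mod_cast hk2
    rw [hkk]
    nlinarith
  have h6 : (k1 : ℝ) * k2 ≤ (k : ℝ) ^ 2 / 4 := by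
    rw [hkk]; nlinarith [sq_nonneg ((k1 : ℝ) - k2)]
  have h5a := mul_le_mul_of_nonneg_left h5 ha.le
  have h6a := mul_le_mul_of_nonneg_left h6 ha.le
  have h7 : 0 ≤ a * (k : ℝ) ^ 2 := by positivity
  nlinarith

/-- Greedy embedding. -/
lemma greedy (c : ℝ) (hc : 0 < c) (m : ℕ) :
    ∃ η : ℝ, 0 < η ∧ ∀ (V : Type) (G : SimpleGraph V) (H : SimpleGraph (Fin m)) (s : ℝ)
      (U : Fin m → Finset V), 0 < s → (∀ i, s ≤ (U i).card) →
      (∃ f : Fin m → V, (∀ i, f i ∈ U i) ∧ ∀ i j, i < j → (H.Adj i j ↔ G.Adj (f i) (f j))) ∨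
      (∃ i j, i < j ∧ ∃ A ⊆ U i, ∃ B ⊆ U j, η * s ≤ A.card ∧ η * s ≤ B.card ∧
        ((∀ v ∈ A, eeR G {v} B ≤ c * B.card) ∨ (∀ v ∈ A, eeR Gᶜ {v} B ≤ c * B.card))) := by
  classical
  induction m with
  | zero => exact ⟨1, one_pos, fun V G H s U _ _ => Or.inl ⟨Fin.elim0, fun i => i.elim0,
      fun i => i.elim0⟩⟩
  | succ m ih =>
    obtain ⟨η, hη, ih⟩ := ih
    have hm1 : (0 : ℝ) < 1 / (m + 1) := by positivity
    refine ⟨min (η * c) (1 / (m + 1)), lt_min (by positivity) hm1, ?_⟩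
    intro V G H s U hs hU
    have hle1 : min (η * c) (1 / ((m : ℝ) + 1)) * s ≤ η * (c * s) := by
      have := min_le_left (η * c) (1 / ((m : ℝ) + 1))
      nlinarith
    have hle2 : min (η * c) (1 / ((m : ℝ) + 1)) * s ≤ 1 / ((m : ℝ) + 1) * s := by
      have := min_le_right (η * c) (1 / ((m : ℝ) + 1))
      nlinarith
    have hle3 : 1 / ((m : ℝ) + 1) * s ≤ s := by
      have : 1 / ((m : ℝ) + 1) ≤ 1 := by
        rw [div_le_one (by positivity)]; linarith [(Nat.cast_nonneg m : (0 : ℝ) ≤ m)]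
      nlinarith
    let K : Fin m → SimpleGraph V := fun j => if H.Adj 0 j.succ then G else Gᶜ
    by_cases hgood : ∃ v ∈ U 0, ∀ j : Fin m, c * (U j.succ).card ≤ eeR (K j) {v} (U j.succ)
    · obtain ⟨v, hv, hgv⟩ := hgood
      rcases ih V G (H.comap Fin.succ) (c * s)
        (fun j => (U j.succ).filter (fun y => (K j).Adj v y)) (by positivity) (fun j => by
          have h1 := hgv j
          rw [eeR_singleton] at h1
          have h2 := hU j.succ
          nlinarith) with ⟨f, hf, hadj⟩ | ⟨i, j, hij, A, hA, B, hB, hcA, hcB, h⟩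
      · left
        refine ⟨Fin.cons v f, fun i => ?_, fun i j hij => ?_⟩
        · refine Fin.cases ?_ (fun i => ?_) i
          · simpa using hv
          · simpa using (Finset.mem_filter.1 (hf i)).1
        · induction j using Fin.cases with
          | zero => exact absurd hij (Fin.not_lt_zero i)
          | succ j =>
            induction i using Fin.cases with
            | zero =>
              have h := (Finset.mem_filter.1 (hf j)).2
              simp only [Fin.cons_zero, Fin.cons_succ]
              by_cases hH : H.Adj 0 j.succ
              · simp only [K, if_pos hH] at h
                exact iff_of_true hH h
              · simp only [K, if_neg hH] at h
                exact iff_of_false hH ((SimpleGraph.compl_adj _ _ _).1 h).2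
            | succ i =>
              simpa using hadj i j (Fin.succ_lt_succ_iff.1 hij)
      · right
        exact ⟨i.succ, j.succ, Fin.succ_lt_succ_iff.2 hij, A, hA.trans (Finset.filter_subset _ _),
          B, hB.trans (Finset.filter_subset _ _), hle1.trans hcA, hle1.trans hcB, h⟩
    · right
      push Not at hgood
      let Bad : Fin m → Finset V := fun j =>
        (U 0).filter (fun v => eeR (K j) {v} (U j.succ) < c * (U j.succ).card)
      have hcov : U 0 ⊆ Finset.univ.biUnion Bad := by
        intro v hv
        obtain ⟨j, hj⟩ := hgood v hv
        exact Finset.mem_biUnion.2 ⟨j, Finset.mem_univ _, Finset.mem_filter.2 ⟨hv, hj⟩⟩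
      have hsum : ((U 0).card : ℝ) ≤ ∑ j, ((Bad j).card : ℝ) := by
        exact_mod_cast (Finset.card_le_card hcov).trans Finset.card_biUnion_le
      have hex : ∃ j, 1 / ((m : ℝ) + 1) * s ≤ (Bad j).card := by
        by_contra hcon
        push Not at hcon
        have h1 : ∑ j, ((Bad j).card : ℝ) ≤ ∑ j : Fin m, 1 / ((m : ℝ) + 1) * s :=
          Finset.sum_le_sum fun j _ => (hcon j).le
        have h2 : ∑ j : Fin m, 1 / ((m : ℝ) + 1) * s = m / ((m : ℝ) + 1) * s := by
          simp; ring
        have h3 : (m : ℝ) / (m + 1) * s < s := by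
          have : (m : ℝ) / (m + 1) < 1 := by
            rw [div_lt_one (by positivity)]; linarith
          nlinarith
        linarith [hU 0]
      obtain ⟨j, hj⟩ := hex
      refine ⟨0, j.succ, Fin.succ_pos j, Bad j, Finset.filter_subset _ _, U j.succ,
        Finset.Subset.refl _, hle2.trans hj, (hle2.trans hle3).trans (hU _), ?_⟩
      by_cases hH : H.Adj 0 j.succ
      · left
        intro v hv
        have h := (Finset.mem_filter.1 hv).2
        simp only [K, if_pos hH] at h
        exact h.le
      · right
        intro v hv
        have h := (Finset.mem_filter.1 hv).2
        simp only [K, if_neg hH] at h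
        exact h.le

/-- Pair lemma. -/
lemma pair_lemma {m : ℕ} (H : SimpleGraph (Fin m)) (c : ℝ) (hc : 0 < c) :
    ∃ η : ℝ, 0 < η ∧ ∀ (n : ℕ) (G : SimpleGraph (Fin n)), ¬ OContains G H →
      ∀ W : Finset (Fin n), m ≤ W.card → ∃ A ⊆ W, ∃ B ⊆ W, Disjoint A B ∧
        η * W.card ≤ A.card ∧ η * W.card ≤ B.card ∧
        ((∀ v ∈ A, eeR G {v} B ≤ c * B.card) ∨ (∀ v ∈ A, eeR Gᶜ {v} B ≤ c * B.card)) := by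
  classical
  obtain ⟨η, hη, hg⟩ := greedy c hc m
  rcases Nat.eq_zero_or_pos m with rfl | hm
  · exact ⟨1, one_pos, fun n G hG => absurd ⟨Fin.elim0, fun i => i.elim0, fun i => i.elim0⟩ hG⟩
  have hmR : (0 : ℝ) < m := by exact_mod_cast hm
  refine ⟨η * (1 / (2 * m)), by positivity, ?_⟩
  intro n G hG W hW
  let e := W.orderEmbOfFin rfl
  let s := W.card / m
  have hs : 1 ≤ s := (Nat.one_le_div_iff hm).2 hW
  have hsm : s * m ≤ W.card := Nat.div_mul_le_self _ _
  have hlt : W.card < (s + 1) * m := by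
    have := Nat.lt_div_mul_add (a := W.card) hm
    have e : (s + 1) * m = W.card / m * m + m := by simp only [s]; ring
    omega
  have hsR : (W.card : ℝ) * (1 / (2 * m)) ≤ s := by
    rw [mul_one_div, div_le_iff₀ (by positivity)]
    have h1 : (W.card : ℝ) ≤ (s + 1) * m := by exact_mod_cast hlt.le
    have h2 : (1 : ℝ) ≤ s := by exact_mod_cast hs
    nlinarith
  let U : Fin m → Finset (Fin n) := fun i =>
    (Finset.univ : Finset (Fin s)).image (fun x : Fin s => e ⟨i * s + x, by
      have : (i.1 + 1) * s ≤ m * s := Nat.mul_le_mul_right s i.2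
      have h2 := x.2
      nlinarith⟩)
  have hUc : ∀ i, (U i).card = s := by
    intro i
    rw [Finset.card_image_of_injective]
    · simp
    · intro x y hxy
      have := e.injective hxy
      simp only [Fin.mk.injEq, Nat.add_left_cancel_iff] at this
      exact Fin.ext this
  have hUW : ∀ i, U i ⊆ W := by
    intro i v hv
    obtain ⟨x, _, rfl⟩ := Finset.mem_image.1 hv
    exact Finset.orderEmbOfFin_mem _ _ _
  have hUlt : ∀ i j, i < j → ∀ u ∈ U i, ∀ v ∈ U j, u < v := by
    intro i j hij u hu v hv
    obtain ⟨x, _, rfl⟩ := Finset.mem_image.1 hu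
    obtain ⟨y, _, rfl⟩ := Finset.mem_image.1 hv
    apply e.strictMono
    rw [Fin.mk_lt_mk]
    have : (i.1 + 1) * s ≤ j.1 * s := Nat.mul_le_mul_right s hij
    have h2 := x.2
    nlinarith
  have hηs : η * (1 / (2 * m)) * W.card ≤ η * s := by
    rw [mul_assoc]
    apply mul_le_mul_of_nonneg_left _ hη.le
    linarith
  rcases hg (Fin n) G H s U (by exact_mod_cast hs) (fun i => by rw [hUc]) with
    ⟨f, hf, hadj⟩ | ⟨i, j, hij, A, hA, B, hB, hcA, hcB, h⟩
  · exfalso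
    apply hG
    refine ⟨f, fun i j hij => hUlt i j hij _ (hf i) _ (hf j), fun i j => ?_⟩
    rcases lt_trichotomy i j with h | h | h
    · exact hadj i j h
    · subst h; simp
    · rw [H.adj_comm, G.adj_comm]; exact hadj j i h
  · refine ⟨A, hA.trans (hUW i), B, hB.trans (hUW j), ?_, hηs.trans hcA, hηs.trans hcB, h⟩
    rw [Finset.disjoint_left]
    intro v hv hv'
    exact lt_irrefl _ (hUlt i j hij v (hA hv) v (hB hv'))

/-- The uniform dichotomy property. -/
def PP {m : ℕ} (H : SimpleGraph (Fin m)) (a b : ℝ) : Prop :=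
  ∃ δ : ℝ, 0 < δ ∧ ∀ (n : ℕ) (G : SimpleGraph (Fin n)), ¬ OContains G H →
    ∀ (W : Finset (Fin n)) (k l : ℕ), (k : ℝ) ≤ δ * W.card → (l : ℝ) ≤ δ * W.card →
      DD G a b W k l

lemma PP_step {m : ℕ} (H : SimpleGraph (Fin m)) (a b : ℝ) (ha : 0 < a) (hb : 0 < b)
    (h1 : PP H (3 / 2 * a) b) (h2 : PP H a (3 / 2 * b)) : PP H a b := by
  obtain ⟨δ1, hδ1, h1⟩ := h1
  obtain ⟨δ2, hδ2, h2⟩ := h2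
  obtain ⟨η, hη, hp⟩ := pair_lemma H (min (a / 32) (b / 32)) (lt_min (by positivity) (by positivity))
  have hmpos : (0 : ℝ) < 1 / (m + 1) := by positivity
  obtain ⟨δ, hδ, hd1, hd2, hd3, hd4⟩ : ∃ δ : ℝ, 0 < δ ∧ δ ≤ δ1 * (η / 2) ∧ δ ≤ δ2 * (η / 2) ∧
      δ ≤ 1 ∧ δ ≤ 1 / ((m : ℝ) + 1) := by
    refine ⟨min (min (δ1 * (η / 2)) (δ2 * (η / 2))) (min 1 (1 / ((m : ℝ) + 1))), ?_, ?_, ?_, ?_, ?_⟩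
    · exact lt_min (lt_min (by positivity) (by positivity)) (lt_min one_pos hmpos)
    · exact (min_le_left _ _).trans (min_le_left _ _)
    · exact (min_le_left _ _).trans (min_le_right _ _)
    · exact (min_le_right _ _).trans (min_le_left _ _)
    · exact (min_le_right _ _).trans (min_le_right _ _)
  refine ⟨δ, hδ, ?_⟩
  intro n G hG W k l hk hl
  have hW0 : (0 : ℝ) ≤ W.card := Nat.cast_nonneg _
  have hkW : k ≤ W.card := by
    have : (k : ℝ) ≤ W.card := by nlinarith
    exact_mod_cast this
  have hlW : l ≤ W.card := by
    have : (l : ℝ) ≤ W.card := by nlinarith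
    exact_mod_cast this
  by_cases hk1 : k ≤ 1
  · exact DD_small ha hkW hk1
  by_cases hl1 : l ≤ 1
  · exact DD_swap (DD_small hb hlW hl1)
  have hmW : m ≤ W.card := by
    have h3 : (1 : ℝ) ≤ k := by exact_mod_cast (by omega : 1 ≤ k)
    have h4 : (1 : ℝ) ≤ 1 / ((m : ℝ) + 1) * W.card := by nlinarith
    rw [one_div_mul_eq_div, le_div_iff₀ (by positivity)] at h4
    have : (m : ℝ) ≤ W.card := by linarith
    exact_mod_cast this
  obtain ⟨A, hA, B, hB, hAB, hcA, hcB, hs⟩ := hp n G hG W hmW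
  have key : ∀ δ' : ℝ, 0 < δ' → δ ≤ δ' * (η / 2) → δ * W.card ≤ δ' * A.card ∧
      δ * W.card ≤ δ' * (B.card / 2) := by
    intro δ' hδ' hd
    have e1 : δ * W.card ≤ δ' * (η / 2) * W.card := mul_le_mul_of_nonneg_right hd hW0
    have e2 := mul_le_mul_of_nonneg_left hcA hδ'.le
    have e3 := mul_le_mul_of_nonneg_left hcB hδ'.le
    have e4 : 0 ≤ δ' * (η * W.card) := by positivity
    constructor <;> nlinarith
  obtain ⟨k1A, k1B⟩ := key δ1 hδ1 hd1
  obtain ⟨k2A, k2B⟩ := key δ2 hδ2 hd2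
  rcases hs with hs | hs
  · refine DD_combine G a b δ1 ha A B hAB W hA hB (fun v hv => (hs v hv).trans ?_) k l (by omega)
      hδ1 (hk.trans k1A) (hl.trans k1A) (hk.trans k1B) (hl.trans k1B) (fun W' k' l' => h1 n G hG W' k' l')
    exact mul_le_mul_of_nonneg_right (min_le_left _ _) (Nat.cast_nonneg _)
  · apply DD_swap
    refine DD_combine Gᶜ b a δ2 hb A B hAB W hA hB (fun v hv => (hs v hv).trans ?_) l k (by omega)
      hδ2 (hl.trans k2A) (hk.trans k2A) (hl.trans k2B) (hk.trans k2B)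
      (fun W' k' l' hk' hl' => DD_swap ?_)
    · exact mul_le_mul_of_nonneg_right (min_le_right _ _) (Nat.cast_nonneg _)
    · rw [compl_compl]
      exact h2 n G hG W' l' k' hl' hk'

lemma PP_all {m : ℕ} (H : SimpleGraph (Fin m)) (i j : ℕ) :
    PP H ((2 / 3 : ℝ) ^ i) ((2 / 3 : ℝ) ^ j) := by
  induction i generalizing j with
  | zero =>
    refine ⟨1, one_pos, fun n G _ W k l hk _ => DD_triv (by simp) ?_⟩
    rw [one_mul] at hk
    exact_mod_cast hk
  | succ i ihi =>
    induction j with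
    | zero =>
      refine ⟨1, one_pos, fun n G _ W k l _ hl => DD_swap (DD_triv (by simp) ?_)⟩
      rw [one_mul] at hl
      exact_mod_cast hl
    | succ j ihj =>
      apply PP_step H _ _ (by positivity) (by positivity)
      · convert ihi (j + 1) using 1
        ring
      · convert ihj using 1
        ring

lemma degIn_eq {n : ℕ} (G : SimpleGraph (Fin n)) (X : Finset (Fin n)) (v : Fin n) :
    (degIn G X v : ℝ) = eeR G {v} X := by
  classical
  rw [eeR_singleton, degIn]
  congr 1
  rw [← Nat.card_eq_finsetCard]
  refine Nat.card_congr (Equiv.subtypeEquivRight fun u => ?_)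
  simp

lemma finish {n : ℕ} (G : SimpleGraph (Fin n)) (a ε δ : ℝ) (ha : 0 < a) (hae : 8 * a < ε)
    (X : Finset (Fin n)) (t : ℕ) (ht : 1 ≤ t) (hX : X.card = 2 * t)
    (he : eeR G X X ≤ a * ((2 * t : ℕ) : ℝ) ^ 2) (h1 : δ * n ≤ t) (h2 : (t : ℝ) ≤ 2 * (δ * n)) :
    ∃ Z : Finset (Fin n), δ * n ≤ Z.card ∧ ∀ v ∈ Z, (degIn G Z v : ℝ) < ε * δ * n := by
  obtain ⟨Z, hZ, hdeg, hc⟩ := eeR_markov G X X (4 * a * t)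
  have ht' : (1 : ℝ) ≤ t := by exact_mod_cast ht
  refine ⟨Z, h1.trans ?_, fun v hv => ?_⟩
  · rw [hX] at hc
    push_cast at hc he
    by_contra hcon
    push Not at hcon
    have : 0 < ((t : ℝ) - Z.card) * (4 * a * t) := mul_pos (by linarith) (by positivity)
    nlinarith
  · rw [degIn_eq]
    have h3 := (eeR_mono_right G {v} hZ).trans (hdeg v hv)
    have h4 : 4 * a * t ≤ 4 * a * (2 * (δ * n)) := by gcongr
    have h5 : 0 < δ * n := by linarith
    nlinarith

/-- The ordered analogue of Rödl's theorem: for every ordered graph `H` and `ε > 0` there is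
`δ > 0` such that every `H`-free ordered graph `G` has a set `X` of at least `δ|G|` vertices
such that one of `G[X]`, `Gᶜ[X]` has maximum degree less than `εδ|G|`. -/
theorem ordered_rodl {m : ℕ} (H : SimpleGraph (Fin m)) (ε : ℝ) (hε : 0 < ε) :
    ∃ δ : ℝ, 0 < δ ∧ ∀ (n : ℕ) (G : SimpleGraph (Fin n)), ¬ OContains G H →
      ∃ X : Finset (Fin n), δ * n ≤ X.card ∧
        ((∀ v ∈ X, (degIn G X v : ℝ) < ε * δ * n) ∨
         (∀ v ∈ X, (degIn Gᶜ X v : ℝ) < ε * δ * n)) := by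
  obtain ⟨i, hi⟩ := exists_pow_lt_of_lt_one (show 0 < ε / 8 by positivity)
    (show (2 / 3 : ℝ) < 1 by norm_num)
  obtain ⟨δ', hδ', hP⟩ := PP_all H i i
  have hapos : (0 : ℝ) < (2 / 3 : ℝ) ^ i := by positivity
  refine ⟨δ' / 4, by positivity, fun n G hG => ?_⟩
  rcases Nat.eq_zero_or_pos n with rfl | hn
  · exact ⟨∅, by simp, by simp⟩
  have hnR : (0 : ℝ) < n := by exact_mod_cast hn
  by_cases hsmall : δ' / 4 * n ≤ 1
  · refine ⟨{⟨0, hn⟩}, by simpa using hsmall, Or.inl fun v hv => ?_⟩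
    rw [degIn_eq, Finset.mem_singleton.1 hv]
    simp only [eeR, Finset.sum_singleton, SimpleGraph.irrefl, if_false]
    positivity
  push Not at hsmall
  have ht1 : δ' / 4 * n ≤ ⌈δ' / 4 * n⌉₊ := Nat.le_ceil _
  have ht2 : (⌈δ' / 4 * n⌉₊ : ℝ) < δ' / 4 * n + 1 := Nat.ceil_lt_add_one (by positivity)
  have ht0 : 1 ≤ ⌈δ' / 4 * n⌉₊ := Nat.one_le_ceil_iff.2 (by positivity)
  generalize ⌈δ' / 4 * n⌉₊ = t at ht1 ht2 ht0
  have hk : ((2 * t : ℕ) : ℝ) ≤ δ' * (Finset.univ : Finset (Fin n)).card := by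
    simp only [Finset.card_univ, Fintype.card_fin]
    push_cast
    nlinarith
  rcases hP n G hG Finset.univ (2 * t) (2 * t) hk hk with ⟨X, _, hc, he⟩ | ⟨X, _, hc, he⟩
  · obtain ⟨Z, h1, h2⟩ := finish G _ ε (δ' / 4) hapos (by linarith) X t ht0 hc he ht1 (by linarith)
    exact ⟨Z, h1, Or.inl h2⟩
  · obtain ⟨Z, h1, h2⟩ := finish Gᶜ _ ε (δ' / 4) hapos (by linarith) X t ht0 hc he ht1 (by linarith)
    exact ⟨Z, h1, Or.inr h2⟩
end

section
/- Let 𝒜 be a set of ordered graphs, and let 𝒜' be the set of complements of the members of 𝒜. If 𝒜 has the sparse rainbow strong EH-property, then 𝒜∪𝒜' has the rainbow strong EH-property. -/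
/-- A blockade: a family of pairwise disjoint nonempty blocks. -/
def IsBlockade {n k : ℕ} (B : Fin k → Finset (Fin n)) : Prop :=
  (∀ i, (B i).Nonempty) ∧ ∀ i j : Fin k, i ≠ j → Disjoint (B i) (B j)

/-- The width of a blockade: the minimum cardinality of a block. -/
noncomputable def blockadeWidth {n k : ℕ} (B : Fin k → Finset (Fin n)) : ℕ :=
  ⨅ i, (B i).card
/-- A pure pair of order at least `t` in a graph. -/
def GHasPurePair {n : ℕ} (G : SimpleGraph (Fin n)) (t : ℝ) : Prop :=
  ∃ A B : Finset (Fin n), Disjoint A B ∧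
    ((∀ a ∈ A, ∀ b ∈ B, ¬ G.Adj a b) ∨ (∀ a ∈ A, ∀ b ∈ B, G.Adj a b)) ∧
    t ≤ A.card ∧ t ≤ B.card
/-- A blockade respects the numbering: blocks occur consecutively in order. -/
def Respectful {n k : ℕ} (B : Fin k → Finset (Fin n)) : Prop :=
  ∀ i j : Fin k, i < j → ∀ u ∈ B i, ∀ v ∈ B j, u < v

/-- A rainbow copy of the ordered graph `H` in the ordered graph `G`
with respect to the blockade `B`. -/
def ORainbow {n m k : ℕ} (G : SimpleGraph (Fin n)) (H : SimpleGraph (Fin m))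
    (B : Fin k → Finset (Fin n)) : Prop :=
  ∃ f : Fin m → Fin n, StrictMono f ∧ (∀ u v, H.Adj u v ↔ G.Adj (f u) (f v)) ∧
    ∃ β : Fin m → Fin k, Function.Injective β ∧ ∀ u, f u ∈ B (β u)

/-- The degree of a vertex in a graph. -/
noncomputable def gdeg {n : ℕ} (G : SimpleGraph (Fin n)) (v : Fin n) : ℕ :=
  Nat.card {u : Fin n | G.Adj v u}

/-- An anticomplete pair of order at least `t` in a graph. -/
def HasAnticompletePair {n : ℕ} (G : SimpleGraph (Fin n)) (t : ℝ) : Prop :=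
  ∃ A B : Finset (Fin n), Disjoint A B ∧ (∀ a ∈ A, ∀ b ∈ B, ¬ G.Adj a b) ∧
    t ≤ A.card ∧ t ≤ B.card

/-- An ordered graph: a graph on `Fin m`, carrying the natural numbering. -/
abbrev OGraph := Σ m : ℕ, SimpleGraph (Fin m)

/-- The sparse rainbow strong EH-property for a set of ordered graphs. -/
def SRSEH (𝒜 : Set OGraph) : Prop :=
  ∃ c : ℝ, 0 < c ∧ c < 1 ∧
    ∀ (n k : ℕ) (G : SimpleGraph (Fin n)) (B : Fin k → Finset (Fin n)),
      IsBlockade B → Respectful B → 1 / c ≤ (k : ℝ) →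
      (∀ H ∈ 𝒜, ¬ ORainbow G H.2 B) →
      (∀ v, (gdeg G v : ℝ) < c * blockadeWidth B) →
      HasAnticompletePair G (c * blockadeWidth B)
/-- The rainbow strong EH-property for a set of ordered graphs. -/
def RSEHset (𝒜 : Set OGraph) : Prop :=
  ∃ c : ℝ, 0 < c ∧ c < 1 ∧
    ∀ (n k : ℕ) (G : SimpleGraph (Fin n)) (B : Fin k → Finset (Fin n)),
      IsBlockade B → Respectful B → 1 / c ≤ (k : ℝ) →
      (∀ H ∈ 𝒜, ¬ ORainbow G H.2 B) →
      GHasPurePair G (c * blockadeWidth B)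
open Finset in
/-- Expansion property of the polarity graph over `ZMod p`. -/
lemma polar_bound (p : ℕ) [Fact p.Prime] (A B : Finset (ZMod p × ZMod p))
    (h : ∀ x ∈ A, ∀ y ∈ B, ¬ (x.1 * y.1 = x.2 + y.2)) :
    (A.card : ℝ) * B.card ≤ (p : ℝ) ^ 3 := by
  classical
  have hp : 0 < p := (Fact.out : p.Prime).pos
  have hpR : (0:ℝ) < p := by exact_mod_cast hp
  let N : ZMod p × ZMod p → ℝ := fun y => ∑ x ∈ A, if x.1 * y.1 = x.2 + y.2 then (1:ℝ) else 0
  have one : ∀ x : ZMod p × ZMod p,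
      ∑ y : ZMod p × ZMod p, (if x.1 * y.1 = x.2 + y.2 then (1:ℝ) else 0) = p := by
    intro x
    rw [Fintype.sum_prod_type]
    have : ∀ c : ZMod p, ∑ d : ZMod p, (if x.1 * c = x.2 + d then (1:ℝ) else 0) = 1 := by
      intro c
      rw [Finset.sum_eq_single (x.1 * c - x.2)]
      · simp
      · intro d _ hd
        rw [if_neg]
        intro h'
        apply hd
        rw [h']; ring
      · simp
    simp [this, ZMod.card]
  have two : ∀ x x' : ZMod p × ZMod p,
      ∑ y : ZMod p × ZMod p, ((if x.1 * y.1 = x.2 + y.2 then (1:ℝ) else 0) *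
        (if x'.1 * y.1 = x'.2 + y.2 then (1:ℝ) else 0)) ≤ 1 + if x = x' then (p:ℝ) else 0 := by
    intro x x'
    by_cases hx : x = x'
    · subst hx
      have := one x
      simp only [if_true]
      have h2 : ∀ y : ZMod p × ZMod p, ((if x.1 * y.1 = x.2 + y.2 then (1:ℝ) else 0) *
        (if x.1 * y.1 = x.2 + y.2 then (1:ℝ) else 0)) = (if x.1 * y.1 = x.2 + y.2 then (1:ℝ) else 0) := by
        intro y; split_ifs <;> simp
      simp only [h2, this]; linarith
    · simp only [if_neg hx, add_zero]
      have h2 : ∀ y : ZMod p × ZMod p, ((if x.1 * y.1 = x.2 + y.2 then (1:ℝ) else 0) *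
        (if x'.1 * y.1 = x'.2 + y.2 then (1:ℝ) else 0)) =
          if (x.1 * y.1 = x.2 + y.2 ∧ x'.1 * y.1 = x'.2 + y.2) then (1:ℝ) else 0 := by
        intro y; split_ifs <;> simp_all
      simp only [h2]
      rw [Finset.sum_boole]
      norm_cast
      rw [Finset.card_le_one]
      intro y hy z hz
      simp only [mem_filter, mem_univ, true_and] at hy hz
      obtain ⟨hy1, hy2⟩ := hy
      obtain ⟨hz1, hz2⟩ := hz
      have e1 : (x.1 - x'.1) * (y.1 - z.1) = 0 := by linear_combination hy1 - hy2 - hz1 + hz2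
      rcases mul_eq_zero.1 e1 with e | e
      · exfalso
        apply hx
        have e' : x.1 = x'.1 := sub_eq_zero.1 e
        refine Prod.ext e' ?_
        rw [e'] at hy1
        linear_combination hy2 - hy1
      · have e' : y.1 = z.1 := sub_eq_zero.1 e
        refine Prod.ext e' ?_
        rw [e'] at hy1
        linear_combination hz1 - hy1
  have S1 : ∑ y, N y = p * A.card := by
    simp only [N]
    rw [Finset.sum_comm]
    simp [one, mul_comm]
  have S2 : ∑ y, N y ^ 2 ≤ A.card ^ 2 + p * A.card := by
    have : ∀ y, N y ^ 2 = ∑ x ∈ A, ∑ x' ∈ A, ((if x.1 * y.1 = x.2 + y.2 then (1:ℝ) else 0) *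
        (if x'.1 * y.1 = x'.2 + y.2 then (1:ℝ) else 0)) := by
      intro y
      simp only [N]
      rw [sq, Finset.sum_mul_sum]
    simp only [this]
    rw [Finset.sum_comm]
    calc _ = ∑ x ∈ A, ∑ x' ∈ A, ∑ y : ZMod p × ZMod p, ((if x.1 * y.1 = x.2 + y.2 then (1:ℝ) else 0) *
        (if x'.1 * y.1 = x'.2 + y.2 then (1:ℝ) else 0)) := by
          refine Finset.sum_congr rfl fun x _ => ?_
          rw [Finset.sum_comm]
      _ ≤ ∑ x ∈ A, ∑ x' ∈ A, (1 + if x = x' then (p:ℝ) else 0) :=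
          Finset.sum_le_sum fun x _ => Finset.sum_le_sum fun x' _ => two x x'
      _ = _ := by
          simp only [Finset.sum_add_distrib, Finset.sum_ite_eq, Finset.sum_const, nsmul_eq_mul, mul_one]
          rw [Finset.sum_ite_mem]
          simp; ring
  have S3 : ∑ y, (N y - A.card / p) ^ 2 ≤ p * A.card := by
    have : ∑ y, (N y - A.card / p) ^ 2 =
        ∑ y, N y ^ 2 - 2 * (A.card / p) * ∑ y, N y + p ^ 2 * (A.card / p) ^ 2 := by
      simp only [sub_sq, Finset.sum_add_distrib, Finset.sum_sub_distrib, Finset.sum_const,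
        Finset.mul_sum]
      simp [Fintype.card_prod, ZMod.card]
      congr 1
      · congr 1
        exact Finset.sum_congr rfl fun _ _ => by ring
      · ring
    rw [this, S1]
    have e : 2 * ((A.card:ℝ) / p) * (p * A.card) = 2 * A.card ^ 2 := by field_simp
    have e2 : (p:ℝ) ^ 2 * (A.card / p) ^ 2 = A.card ^ 2 := by field_simp
    rw [e, e2]; linarith
  have S4 : (B.card : ℝ) * (A.card / p) ^ 2 ≤ p * A.card := by
    refine le_trans ?_ S3
    calc (B.card : ℝ) * (A.card / p) ^ 2 = ∑ y ∈ B, (N y - A.card / p) ^ 2 := by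
          rw [← nsmul_eq_mul, ← Finset.sum_const]
          refine Finset.sum_congr rfl fun y hy => ?_
          have : N y = 0 := Finset.sum_eq_zero fun x hx => if_neg (h x hx y hy)
          rw [this]; ring
      _ ≤ _ := Finset.sum_le_sum_of_subset_of_nonneg (Finset.subset_univ _)
          fun _ _ _ => sq_nonneg _
  rcases Nat.eq_zero_or_pos A.card with h0 | h0
  · rw [h0]; simp
  · have h0' : (0:ℝ) < A.card := by exact_mod_cast h0
    rw [div_pow, mul_div_assoc', div_le_iff₀ (by positivity)] at S4
    have : (A.card : ℝ) * (A.card * B.card) ≤ A.card * p ^ 3 := by linarith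
    exact le_of_mul_le_mul_left this h0'

open Finset in
lemma polar_degree (p : ℕ) [Fact p.Prime] (x : ZMod p × ZMod p)
    (S : Finset (ZMod p × ZMod p)) (h : ∀ y ∈ S, x.1 * y.1 = x.2 + y.2) : S.card ≤ p := by
  classical
  have : Set.InjOn Prod.fst (S : Set (ZMod p × ZMod p)) := by
    intro y hy z hz e
    refine Prod.ext e ?_
    have h1 := h y hy
    have h2 := h z hz
    rw [e] at h1
    linear_combination h2 - h1
  rw [← Finset.card_image_of_injOn this]
  calc _ ≤ (univ : Finset (ZMod p)).card := Finset.card_le_univ _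
    _ = p := by simp [ZMod.card]

open Classical in
/-- Sub-finset selected by a predicate. -/
noncomputable def sel {α : Type} (S : Finset α) (P : α → Prop) : Finset α := S.filter P

lemma mem_sel {α : Type} (S : Finset α) (P : α → Prop) (x : α) : x ∈ sel S P ↔ x ∈ S ∧ P x := by
  simp [sel]

lemma sel_subset {α : Type} (S : Finset α) (P : α → Prop) : sel S P ⊆ S := by
  intro x hx; exact ((mem_sel _ _ _).1 hx).1

lemma sel_card_add {α : Type} (S : Finset α) (P : α → Prop) :
    (sel S P).card + (sel S (fun x => ¬ P x)).card = S.card := by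
  classical
  unfold sel
  rw [← Finset.card_filter_add_card_filter_not (s := S) P]
  congr!

open Finset in
/-- Cleaning by double counting. -/
lemma clean {α : Type} (r : α → α → Prop) (X Y : Finset α) (a t : ℝ)
    (h : ∀ x ∈ X, ((sel Y (fun y => r x y)).card : ℝ) ≤ a) :
    ((sel Y (fun y => t < ((sel X (fun x => r x y)).card : ℝ))).card : ℝ) * t ≤ X.card * a := by
  classical
  have key := Finset.sum_card_bipartiteAbove_eq_sum_card_bipartiteBelow (s := X) (t := Y) r
  have e1 : ∀ x, sel Y (fun y => r x y) = (bipartiteAbove r Y x) := by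
    intro x; ext y; simp [mem_sel]
  have e2 : ∀ y, sel X (fun x => r x y) = (bipartiteBelow r X y) := by
    intro x; ext y; simp [mem_sel]
  simp only [← e1, ← e2] at key
  have key' : ∑ x ∈ X, ((sel Y (fun y => r x y)).card : ℝ)
      = ∑ y ∈ Y, ((sel X (fun x => r x y)).card : ℝ) := by exact_mod_cast key
  set Z := sel Y (fun y => t < ((sel X (fun x => r x y)).card : ℝ)) with hZ
  calc (Z.card : ℝ) * t = ∑ y ∈ Z, t := by simp
    _ ≤ ∑ y ∈ Z, ((sel X (fun x => r x y)).card : ℝ) :=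
        Finset.sum_le_sum fun y hy => ((mem_sel _ _ _).1 hy).2.le
    _ ≤ ∑ y ∈ Y, ((sel X (fun x => r x y)).card : ℝ) :=
        Finset.sum_le_sum_of_subset_of_nonneg (sel_subset _ _) fun _ _ _ => by positivity
    _ = ∑ x ∈ X, ((sel Y (fun y => r x y)).card : ℝ) := key'.symm
    _ ≤ ∑ x ∈ X, a := Finset.sum_le_sum h
    _ = X.card * a := by simp

open Finset in
lemma lemA (ε : ℝ) (hε : 0 < ε) (R : ℕ) : ∀ m : ℕ, ∃ (N : ℕ) (δ : ℝ), 0 < δ ∧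
    ∀ (n K : ℕ) (G : SimpleGraph (Fin n)) (Q : Fin m → Fin m → Prop) (I : Fin m → Finset (Fin K))
      (C : Fin K → Finset (Fin n)) (W : ℝ) (w : ℕ),
      (∀ h h', h < h' → ∀ i ∈ I h, ∀ j ∈ I h', i < j) → (∀ h, N ≤ (I h).card) →
      (∀ h, ∀ j ∈ I h, W ≤ (C j).card) → 0 < w → (w : ℝ) ≤ δ * W →
      (∃ (f : Fin m → Fin n) (β : Fin m → Fin K), (∀ h, f h ∈ C (β h)) ∧ (∀ h, β h ∈ I h) ∧
        ∀ h h', h < h' → (Q h h' ↔ G.Adj (f h) (f h'))) ∨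
      ∃ (b : Prop) (h0 : Fin m) (i : Fin K) (h1 : Fin m) (J : Finset (Fin K)) (X : Finset (Fin n))
        (D : Fin K → Finset (Fin n)), i ∈ I h0 ∧ J ⊆ I h1 ∧ R ≤ J.card ∧ (∀ j ∈ J, i < j) ∧
        X ⊆ C i ∧ X.card = w ∧ ∀ j ∈ J, D j ⊆ C j ∧ δ * W ≤ (D j).card ∧
          ∀ y ∈ D j, ((sel X (fun x => (G.Adj x y ↔ b))).card : ℝ) ≤ 2 * ε * w := by
  classical
  intro m
  induction m with
  | zero =>
    refine ⟨0, 1, one_pos, ?_⟩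
    intro n K G Q I C W w _ _ _ _ _
    left
    exact ⟨fun h => h.elim0, fun h => h.elim0, fun h => h.elim0, fun h => h.elim0, fun h => h.elim0⟩
  | succ m ih =>
    obtain ⟨N', δ', hδ', ih⟩ := ih
    set N := N' + R + 1 with hN
    set L : ℝ := (m * 2 ^ N : ℕ) + 2 with hL
    have hLpos : 0 < L := by positivity
    refine ⟨N, min (min (δ' * ε) (1 / L)) (1/2), by positivity, ?_⟩
    intro n K G Q I0 C W w hord0 hcard0 hW0 hw hwδ
    set δ := min (min (δ' * ε) (1 / L)) (1/2) with hδ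
    have hδ1 : δ ≤ δ' * ε := (min_le_left _ _).trans (min_le_left _ _)
    have hδ2 : δ ≤ 1 / L := (min_le_left _ _).trans (min_le_right _ _)
    have hδ3 : δ ≤ 1/2 := min_le_right _ _
    have hδpos : 0 < δ := by positivity
    have hwR : (0:ℝ) < w := by exact_mod_cast hw
    have hWpos : 0 < W := by
      by_contra hh
      have : δ * W ≤ 0 := mul_nonpos_of_nonneg_of_nonpos hδpos.le (not_lt.1 hh)
      linarith
    have : ∀ h, ∃ I' ⊆ I0 h, I'.card = N := fun h => Finset.exists_subset_card_eq (hcard0 h)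
    choose I hIsub hIcard using this
    have hord : ∀ h h', h < h' → ∀ i ∈ I h, ∀ j ∈ I h', i < j :=
      fun h h' hh i hi j hj => hord0 h h' hh i (hIsub _ hi) j (hIsub _ hj)
    have hW : ∀ h, ∀ j ∈ I h, W ≤ (C j).card := fun h j hj => hW0 h j (hIsub _ hj)
    obtain ⟨i, hi⟩ : (I 0).Nonempty := by
      rw [← Finset.card_pos, hIcard]; omega
    let nb : Fin n → Fin m → Fin K → Finset (Fin n) :=
      fun v h j => sel (C j) (fun y => (G.Adj v y ↔ Q 0 h.succ))
    let good : Fin n → Fin m → Finset (Fin K) :=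
      fun v h => sel (I h.succ) (fun j => ε * (C j).card ≤ (nb v h j).card)
    let bad : Fin n → Fin m → Finset (Fin K) :=
      fun v h => sel (I h.succ) (fun j => ¬ ε * (C j).card ≤ (nb v h j).card)
    have hgb : ∀ v h, (good v h).card + (bad v h).card = N := by
      intro v h; rw [← hIcard h.succ]; exact sel_card_add _ _
    by_cases hv : ∃ v ∈ C i, ∀ h, N' ≤ (good v h).card
    · obtain ⟨v, hvC, hvg⟩ := hv
      let C' : Fin K → Finset (Fin n) := fun j =>
        sel (C j) (fun y => ∀ h : Fin m, j ∈ I h.succ → (G.Adj v y ↔ Q 0 h.succ))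
      have huniq : ∀ (h h' : Fin m) j, j ∈ I h.succ → j ∈ I h'.succ → h = h' := by
        intro h h' j h1 h2
        rcases lt_trichotomy h h' with hl | hl | hl
        · exact absurd (hord _ _ (Fin.succ_lt_succ_iff.2 hl) j h1 j h2) (lt_irrefl _)
        · exact hl
        · exact absurd (hord _ _ (Fin.succ_lt_succ_iff.2 hl) j h2 j h1) (lt_irrefl _)
      have hC' : ∀ h : Fin m, ∀ j ∈ I h.succ, C' j = nb v h j := by
        intro h j hj
        ext y
        simp only [C', nb, mem_sel]
        refine and_congr_right fun _ => ⟨fun hh => hh h hj, fun hh h' hj' => ?_⟩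
        rw [huniq h' h j hj' hj]; exact hh
      have g1 : ∀ h h' : Fin m, h < h' → ∀ i ∈ good v h, ∀ j ∈ good v h', i < j := by
        intro h h' hh i hi j hj
        exact hord _ _ (Fin.succ_lt_succ_iff.2 hh) i (sel_subset _ _ hi) j (sel_subset _ _ hj)
      have g2 : ∀ h, ∀ j ∈ good v h, ε * W ≤ (C' j).card := by
        intro h j hj
        obtain ⟨hj1, hj2⟩ := (mem_sel _ _ _).1 hj
        rw [hC' h j hj1]
        refine le_trans ?_ hj2
        have := hW _ j hj1
        gcongr
      have g3 : (w:ℝ) ≤ δ' * (ε * W) := by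
        calc (w:ℝ) ≤ δ * W := hwδ
          _ ≤ (δ' * ε) * W := by gcongr
          _ = _ := by ring
      rcases ih n K G (fun h h' => Q h.succ h'.succ) (fun h => good v h) C' (ε * W) w g1 hvg g2 hw g3
        with hA | hA
      · left
        obtain ⟨f, β, hf, hβ, hadj⟩ := hA
        refine ⟨Fin.cons v f, Fin.cons i β, ?_, ?_, ?_⟩
        · intro h
          refine Fin.cases ?_ (fun h => ?_) h
          · simpa using hvC
          · simpa using sel_subset _ _ (hf h)
        · intro h
          refine Fin.cases ?_ (fun h => ?_) h
          · simpa using hIsub _ hi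
          · simpa using hIsub _ (sel_subset _ _ (hβ h))
        · intro h h'
          refine Fin.cases ?_ (fun h' => ?_) h'
          · intro hh; exact absurd hh (Fin.not_lt_zero _)
          · refine Fin.cases ?_ (fun h => ?_) h
            · intro _
              have hjI := sel_subset _ _ (hβ h')
              have h1 := hf h'
              rw [hC' h' _ hjI] at h1
              simpa using ((mem_sel _ _ _).1 h1).2.symm
            · intro hh
              simpa using hadj h h' (Fin.succ_lt_succ_iff.1 hh)
      · right
        obtain ⟨b, h0, i', h1, J, X, D, hi', hJ, hR, hlt, hX, hXw, hD⟩ := hA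
        refine ⟨b, h0.succ, i', h1.succ, J, X, D, hIsub _ (sel_subset _ _ hi'),
          fun j hj => hIsub _ (sel_subset _ _ (hJ hj)), hR, hlt, hX.trans (sel_subset _ _), hXw, ?_⟩
        intro j hj
        obtain ⟨a1, a2, a3⟩ := hD j hj
        refine ⟨a1.trans (sel_subset _ _), le_trans ?_ a2, a3⟩
        calc δ * W ≤ (δ' * ε) * W := by gcongr
          _ = _ := by ring
    · right
      push Not at hv
      have hCi := hW 0 i hi
      have hne : (C i).Nonempty := by
        rw [← Finset.card_pos]
        have : (0:ℝ) < (C i).card := by linarith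
        exact_mod_cast this
      have : Nonempty (Fin m) := by
        obtain ⟨v, hv'⟩ := hne
        exact ⟨(hv v hv').choose⟩
      choose! hh hhlt using hv
      let t : Finset (Sigma fun _ : Fin m => Finset (Fin K)) :=
        (univ : Finset (Fin m)).sigma (fun h => (I h.succ).powerset)
      have htc : t.card = m * 2 ^ N := by
        simp [t, hIcard]
      let F : Fin n → (Sigma fun _ : Fin m => Finset (Fin K)) := fun v => ⟨hh v, bad v (hh v)⟩
      have hF : ∀ v ∈ C i, F v ∈ t := by
        intro v hv
        simp only [t, F, Finset.mem_sigma, mem_univ, true_and, Finset.mem_powerset]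
        exact sel_subset _ _
      have htne : t.Nonempty := by
        obtain ⟨v, hv⟩ := hne
        exact ⟨_, hF v hv⟩
      have hmul : t.card * w ≤ (C i).card := by
        rw [htc]
        have : (w:ℝ) ≤ 1 / L * W := hwδ.trans (by gcongr)
        rw [one_div, inv_mul_eq_div, le_div_iff₀ hLpos] at this
        have h2 : ((m * 2 ^ N * w : ℕ) : ℝ) ≤ (C i).card := by
          refine le_trans ?_ hCi
          refine le_trans ?_ this
          rw [hL]; push_cast; nlinarith
        exact_mod_cast h2
      obtain ⟨⟨h, J⟩, hJt, hfib⟩ := Finset.exists_le_card_fiber_of_mul_le_card_of_maps_to hF htne hmul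
      obtain ⟨X, hXsub, hXw⟩ := Finset.exists_subset_card_eq hfib
      have hXC : X ⊆ C i := hXsub.trans (Finset.filter_subset _ _)
      have hXF : ∀ x ∈ X, hh x = h ∧ bad x h = J := by
        intro x hx
        have := (Finset.mem_filter.1 (hXsub hx)).2
        simp only [F, Sigma.mk.injEq, heq_eq_eq] at this
        obtain ⟨e1, e2⟩ := this
        exact ⟨e1, by rw [← e1]; exact e2⟩
      obtain ⟨x0, hx0⟩ : X.Nonempty := by rw [← Finset.card_pos, hXw]; exact hw
      have hJI : J ⊆ I h.succ := by rw [← (hXF x0 hx0).2]; exact sel_subset _ _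
      let D : Fin K → Finset (Fin n) := fun j =>
        sel (C j) (fun y => ¬ (2 * ε * w < ((sel X (fun x => (G.Adj x y ↔ Q 0 h.succ))).card : ℝ)))
      refine ⟨Q 0 h.succ, 0, i, h.succ, J, X, D, hIsub _ hi, hJI.trans (hIsub _), ?_, ?_, hXC, hXw, ?_⟩
      · have h1 := hgb x0 h
        have h2 := hhlt x0 (hXC hx0)
        rw [(hXF x0 hx0).1] at h2
        rw [(hXF x0 hx0).2] at h1
        omega
      · intro j hj
        exact hord 0 h.succ (Fin.succ_pos _) i hi j (hJI hj)
      · intro j hj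
        refine ⟨sel_subset _ _, ?_, ?_⟩
        · have hcl := clean (fun x y => (G.Adj x y ↔ Q 0 h.succ)) X (C j) (ε * (C j).card) (2 * ε * w)
            (by
              intro x hx
              have : j ∈ bad x h := by rw [(hXF x hx).2]; exact hj
              have := ((mem_sel _ _ _).1 this).2
              exact (not_le.1 this).le)
          have hadd := sel_card_add (C j)
            (fun y => 2 * ε * w < ((sel X (fun x => (G.Adj x y ↔ Q 0 h.succ))).card : ℝ))
          rw [hXw] at hcl
          have hadd' : ((sel (C j)
            (fun y => 2 * ε * w < ((sel X (fun x => (G.Adj x y ↔ Q 0 h.succ))).card : ℝ))).card : ℝ)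
              + (D j).card = (C j).card := by exact_mod_cast hadd
          set z : ℝ := ((sel (C j)
            (fun y => 2 * ε * w < ((sel X (fun x => (G.Adj x y ↔ Q 0 h.succ))).card : ℝ))).card : ℝ)
          have hz : z * 2 ≤ (C j).card := by
            have hew : 0 < ε * w := by positivity
            have : (ε * w) * (z * 2) ≤ (ε * w) * (C j).card := by linarith
            exact le_of_mul_le_mul_left this hew
          have hWj := hW _ j (hJI hj)
          have : δ * W ≤ 1/2 * W := by gcongr
          linarith
        · intro y hy
          exact not_lt.1 ((mem_sel _ _ _).1 hy).2
lemma split_groups {K : ℕ} (m N : ℕ) (I : Finset (Fin K)) (h : m * N ≤ I.card) :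
    ∃ g : Fin m → Finset (Fin K), (∀ h, g h ⊆ I ∧ (g h).card = N) ∧
      ∀ h h', h < h' → ∀ i ∈ g h, ∀ j ∈ g h', i < j := by
  classical
  let e := I.orderEmbOfFin rfl
  have hb : ∀ (h : Fin m) (t : Fin N), h.1 * N + t.1 < I.card := by
    intro a t
    have h1 : (a.1 + 1) * N ≤ m * N := Nat.mul_le_mul_right _ a.2
    have h2 := t.2
    rw [Nat.add_mul] at h1
    omega
  refine ⟨fun a => Finset.univ.image (fun t : Fin N => e ⟨a.1 * N + t.1, hb a t⟩), ?_, ?_⟩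
  · intro a
    constructor
    · intro x hx
      obtain ⟨t, _, rfl⟩ := Finset.mem_image.1 hx
      exact Finset.orderEmbOfFin_mem _ _ _
    · rw [Finset.card_image_of_injective]
      · simp
      · intro t t' ht
        have := e.injective ht
        simp only [Fin.mk.injEq] at this
        exact Fin.ext (by omega)
  · intro a a' haa i hi j hj
    obtain ⟨t, _, rfl⟩ := Finset.mem_image.1 hi
    obtain ⟨t', _, rfl⟩ := Finset.mem_image.1 hj
    apply e.strictMono
    rw [Fin.mk_lt_mk]
    have h1 : (a.1 + 1) * N ≤ a'.1 * N := Nat.mul_le_mul_right _ haa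
    have h2 := t.2
    rw [Nat.add_mul] at h1
    omega

open Finset in
lemma lemB (ε : ℝ) (hε : 0 < ε) (m : ℕ) : ∀ T : ℕ, ∃ (N : ℕ) (δ : ℝ), 0 < δ ∧
    ∀ (n K : ℕ) (G : SimpleGraph (Fin n)) (Q : Fin m → Fin m → Prop) (I : Finset (Fin K))
      (C : Fin K → Finset (Fin n)) (W : ℝ) (w : ℕ), N ≤ I.card →
      (∀ j ∈ I, W ≤ (C j).card) → 0 < w → (w : ℝ) ≤ δ * W →
      (¬ ∃ (f : Fin m → Fin n) (β : Fin m → Fin K), (∀ h, f h ∈ C (β h)) ∧ (∀ h, β h ∈ I) ∧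
        StrictMono β ∧ ∀ h h', h < h' → (Q h h' ↔ G.Adj (f h) (f h'))) →
      ∃ (J : Finset (Fin K)) (σ : Fin K → Prop) (X : Fin K → Finset (Fin n)), J ⊆ I ∧ J.card = T ∧
        (∀ i ∈ J, X i ⊆ C i ∧ (X i).card = w) ∧
        ∀ i ∈ J, ∀ j ∈ J, i < j → ∀ y ∈ X j,
          ((sel (X i) (fun x => (G.Adj x y ↔ σ i))).card : ℝ) ≤ 2 * ε * w := by
  classical
  intro T
  induction T with
  | zero =>
    refine ⟨0, 1, one_pos, ?_⟩
    intro n K G Q I C W w _ _ _ _ _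
    exact ⟨∅, fun _ => True, fun _ => ∅, by simp, by simp, by simp, by simp⟩
  | succ T ih =>
    obtain ⟨N', δ', hδ', ih⟩ := ih
    obtain ⟨NA, δA, hδA, hA⟩ := lemA ε hε N' m
    refine ⟨m * NA, min δA (δ' * δA), by positivity, ?_⟩
    intro n K G Q I C W w hI hW hw hwδ hno
    obtain ⟨g, hg, hgord⟩ := split_groups m NA I hI
    have hwR : (0:ℝ) < w := by exact_mod_cast hw
    have hWpos : 0 < W := by
      by_contra hh
      have : min δA (δ' * δA) * W ≤ 0 :=
        mul_nonpos_of_nonneg_of_nonpos (by positivity) (not_lt.1 hh)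
      linarith
    have hw1 : (w:ℝ) ≤ δA * W := hwδ.trans (by gcongr; exact min_le_left _ _)
    have hw2 : (w:ℝ) ≤ δ' * (δA * W) := by
      rw [← mul_assoc]
      exact hwδ.trans (by gcongr; exact min_le_right _ _)
    rcases hA n K G Q g C W w hgord (fun h => (hg h).2.ge) (fun h j hj => hW j ((hg h).1 hj)) hw hw1
      with h1 | h1
    · exfalso
      apply hno
      obtain ⟨f, β, hf, hβ, hadj⟩ := h1
      exact ⟨f, β, hf, fun h => (hg h).1 (hβ h),
        fun a b hab => hgord a b hab _ (hβ a) _ (hβ b), hadj⟩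
    · obtain ⟨b, h0, i, h1, J, X, D, hi, hJ, hR, hlt, hX, hXw, hD⟩ := h1
      have hJI : J ⊆ I := hJ.trans (hg h1).1
      obtain ⟨J', σ, X', hJ', hJT, hX', hfin⟩ := ih n K G Q J D (δA * W) w hR
        (fun j hj => (hD j hj).2.1) hw hw2 (by
          rintro ⟨f, β, hf, hβ, hβm, hadj⟩
          exact hno ⟨f, β, fun h => (hD _ (hβ h)).1 (hf h), fun h => hJI (hβ h), hβm, hadj⟩)
      have hiJ : ∀ j ∈ J', i < j := fun j hj => hlt j (hJ' hj)
      have hiJ' : i ∉ J' := fun hh => lt_irrefl _ (hiJ i hh)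
      refine ⟨insert i J', Function.update σ i b, Function.update X' i X, ?_, ?_, ?_, ?_⟩
      · exact Finset.insert_subset ((hg h0).1 hi) (hJ'.trans hJI)
      · rw [Finset.card_insert_of_notMem hiJ', hJT]
      · intro j hj
        rcases Finset.mem_insert.1 hj with rfl | hj
        · simp [hX, hXw]
        · have : j ≠ i := (hiJ j hj).ne'
          rw [Function.update_of_ne this]
          exact ⟨(hX' j hj).1.trans (hD j (hJ' hj)).1, (hX' j hj).2⟩
      · intro a ha c hc hac y hy
        rcases Finset.mem_insert.1 hc with rfl | hc'
        · exfalso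
          rcases Finset.mem_insert.1 ha with rfl | ha
          · exact lt_irrefl _ hac
          · exact lt_asymm hac (hiJ a ha)
        · have hci : c ≠ i := (hiJ c hc').ne'
          rw [Function.update_of_ne hci] at hy
          rcases Finset.mem_insert.1 ha with rfl | ha
          · simp only [Function.update_self]
            exact (hD c (hJ' hc')).2.2 y ((hX' c hc').1 hy)
          · have hai : a ≠ i := (hiJ a ha).ne'
            rw [Function.update_of_ne hai, Function.update_of_ne hai]
            exact hfin a ha c hc' hac y hy
lemma card_le_of_injOn_polar {n p : ℕ} [Fact p.Prime] (S : Finset (Fin n))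
    (θ : Fin n → ZMod p × ZMod p) (hθ : Set.InjOn θ S) (x : ZMod p × ZMod p)
    (h : ∀ y ∈ S, x.1 * (θ y).1 = x.2 + (θ y).2) : S.card ≤ p := by
  classical
  rw [← Finset.card_image_of_injOn hθ]
  apply polar_degree p x
  intro y hy
  obtain ⟨z, hz, rfl⟩ := Finset.mem_image.1 hy
  exact h z hz

lemma polar_bound_injOn {n p : ℕ} [Fact p.Prime] (A B : Finset (Fin n))
    (θ : Fin n → ZMod p × ZMod p) (hA : Set.InjOn θ A) (hB : Set.InjOn θ B)
    (h : ∀ x ∈ A, ∀ y ∈ B, ¬ ((θ x).1 * (θ y).1 = (θ x).2 + (θ y).2)) :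
    (A.card : ℝ) * B.card ≤ (p : ℝ) ^ 3 := by
  classical
  rw [← Finset.card_image_of_injOn hA, ← Finset.card_image_of_injOn hB]
  apply polar_bound
  intro x hx y hy
  obtain ⟨x', hx', rfl⟩ := Finset.mem_image.1 hx
  obtain ⟨y', hy', rfl⟩ := Finset.mem_image.1 hy
  exact h x' hx' y' hy'

lemma exists_theta {n p : ℕ} [Fact p.Prime] (S : Finset (Fin n)) (hS : S.card = p ^ 2) :
    ∃ θ : Fin n → ZMod p × ZMod p, Set.InjOn θ S := by
  classical
  have : Fintype.card S = Fintype.card (ZMod p × ZMod p) := by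
    simp [hS, ZMod.card, sq]
  let φ := Fintype.equivOfCardEq this
  refine ⟨fun x => if h : x ∈ S then φ ⟨x, h⟩ else 0, ?_⟩
  intro x hx y hy hxy
  have hx' : x ∈ S := hx
  have hy' : y ∈ S := hy
  simp only [hx', hy', dif_pos] at hxy
  have := φ.injective hxy
  simpa using this

lemma pigeon_blk {N k : ℕ} (hk : 0 < k) (A : Finset (Fin N)) (blk : Fin N → Fin k) (t : ℝ)
    (h : t ≤ A.card) : ∃ i, t / k ≤ (sel A (fun u => blk u = i)).card := by
  classical
  by_contra hh
  push Not at hh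
  have hkR : (0:ℝ) < k := by exact_mod_cast hk
  have h1 : A.card = ∑ i, (sel A (fun u => blk u = i)).card := by
    rw [Finset.card_eq_sum_card_fiberwise (f := blk) (t := Finset.univ) (by intro _ _; simp)]
    refine Finset.sum_congr rfl fun i _ => ?_
    congr 1
    ext u; simp [mem_sel]
  have h2 : (A.card : ℝ) = ∑ i, ((sel A (fun u => blk u = i)).card : ℝ) := by exact_mod_cast h1
  have h3 : ∑ i, ((sel A (fun u => blk u = i)).card : ℝ) < ∑ i : Fin k, t / k := by
    apply Finset.sum_lt_sum_of_nonempty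
    · exact ⟨⟨0, hk⟩, Finset.mem_univ _⟩
    · intro i _; exact hh i
  simp only [Finset.sum_const, Finset.card_univ, Fintype.card_fin, nsmul_eq_mul] at h3
  rw [mul_div_cancel₀ _ hkR.ne'] at h3
  linarith

open Finset in
lemma core (𝒜 : Set OGraph) (c : ℝ) (hc0 : 0 < c)
    (hS : ∀ (n k : ℕ) (G : SimpleGraph (Fin n)) (B : Fin k → Finset (Fin n)),
      IsBlockade B → Respectful B → 1 / c ≤ (k : ℝ) →
      (∀ H ∈ 𝒜, ¬ ORainbow G H.2 B) →
      (∀ v, (gdeg G v : ℝ) < c * blockadeWidth B) →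
      HasAnticompletePair G (c * blockadeWidth B))
    (k : ℕ) (hk : 1 / c ≤ (k : ℝ)) (p : ℕ) [Fact p.Prime] (η : ℝ) (hη0 : 0 ≤ η)
    (hη : k * (η * p ^ 2) + p < c * (p:ℝ) ^ 2) (hp : (k:ℝ) ^ 2 < c ^ 2 * p)
    (n : ℕ) (G : SimpleGraph (Fin n)) (Y : Fin k → Finset (Fin n))
    (hYc : ∀ i, (Y i).card = p ^ 2) (hresp : Respectful Y)
    (hdeg : ∀ i j, i ≠ j → ∀ x ∈ Y i, ((sel (Y j) (fun y => G.Adj x y)).card : ℝ) ≤ η * p ^ 2)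
    (hno : ∀ H ∈ 𝒜, ¬ ORainbow G H.2 Y) :
    ∃ i j, i ≠ j ∧ ∃ A ⊆ Y i, ∃ B ⊆ Y j, (∀ a ∈ A, ∀ b ∈ B, ¬ G.Adj a b) ∧
      c * (p:ℝ) ^ 2 / k ≤ A.card ∧ c * (p:ℝ) ^ 2 / k ≤ B.card := by
  classical
  have hp0 : 0 < p := (Fact.out : p.Prime).pos
  have hpR : (0:ℝ) < p := by exact_mod_cast hp0
  have hkR : (0:ℝ) < k := lt_of_lt_of_le (by positivity) hk
  have hk0 : 0 < k := by exact_mod_cast hkR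
  set U := (univ : Finset (Fin k)).biUnion Y with hU
  set N := U.card with hN
  let e : Fin N ↪o Fin n := U.orderEmbOfFin rfl
  have heU : ∀ u, e u ∈ U := fun u => Finset.orderEmbOfFin_mem _ _ _
  have heS : ∀ x ∈ U, ∃ u, e u = x := by
    intro x hx
    have : x ∈ Set.range (U.orderEmbOfFin rfl) := by rw [Finset.range_orderEmbOfFin]; exact hx
    exact this
  have hblk : ∀ u, ∃ i, e u ∈ Y i := by
    intro u; have := heU u; rw [hU, mem_biUnion] at this
    obtain ⟨i, _, hi⟩ := this; exact ⟨i, hi⟩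
  choose blk hblk using hblk
  have huniq : ∀ i j x, x ∈ Y i → x ∈ Y j → i = j := by
    intro i j x hi hj
    rcases lt_trichotomy i j with h | h | h
    · exact absurd (hresp i j h x hi x hj) (lt_irrefl _)
    · exact h
    · exact absurd (hresp j i h x hj x hi) (lt_irrefl _)
  have hblk' : ∀ u i, e u ∈ Y i → blk u = i := fun u i hi => huniq _ _ _ (hblk u) hi
  have := fun i => exists_theta (p := p) (Y i) (hYc i)
  choose θ hθ using this
  let G' : SimpleGraph (Fin N) :=
    { Adj := fun u v => u ≠ v ∧ ((blk u = blk v ∧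
        (θ (blk u) (e u)).1 * (θ (blk u) (e v)).1 = (θ (blk u) (e u)).2 + (θ (blk u) (e v)).2) ∨
        (blk u ≠ blk v ∧ G.Adj (e u) (e v)))
      symm := ⟨by
        rintro u v ⟨h1, h2⟩
        refine ⟨h1.symm, ?_⟩
        rcases h2 with ⟨h2, h3⟩ | ⟨h2, h3⟩
        · left
          refine ⟨h2.symm, ?_⟩
          rw [← h2, mul_comm, h3, add_comm]
        · right; exact ⟨h2.symm, h3.symm⟩⟩
      loopless := ⟨fun u h => h.1 rfl⟩ }
  let B : Fin k → Finset (Fin N) := fun i => sel univ (fun u => blk u = i)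
  have hmB : ∀ u i, u ∈ B i ↔ blk u = i := by intro u i; simp [B, mem_sel]
  have hBY : ∀ i, (B i).map e.toEmbedding = Y i := by
    intro i; ext x
    simp only [mem_map, hmB]
    constructor
    · rintro ⟨u, rfl, rfl⟩; exact hblk u
    · intro hx
      obtain ⟨u, rfl⟩ := heS x (mem_biUnion.2 ⟨i, mem_univ _, hx⟩)
      exact ⟨u, hblk' u i hx, rfl⟩
  have hBc : ∀ i, (B i).card = p ^ 2 := by
    intro i; rw [← hYc i, ← hBY i, card_map]
  have hwidth : blockadeWidth B = p ^ 2 := by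
    unfold blockadeWidth
    simp only [hBc]
    have : Nonempty (Fin k) := ⟨⟨0, hk0⟩⟩
    exact ciInf_const
  have hBres : Respectful B := by
    intro i j hij u hu v hv
    rw [hmB] at hu hv
    rw [← e.lt_iff_lt]
    exact hresp i j hij _ (hu ▸ hblk u) _ (hv ▸ hblk v)
  have hBblk : IsBlockade B := by
    refine ⟨fun i => ?_, fun i j hij => ?_⟩
    · rw [← card_pos, hBc]; positivity
    · rw [Finset.disjoint_left]
      intro u hu hv
      rw [hmB] at hu hv
      exact hij (hu.symm.trans hv)
  have hBno : ∀ H ∈ 𝒜, ¬ ORainbow G' H.2 B := by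
    rintro H hH ⟨f, hf, hadj, β, hβ, hfβ⟩
    refine hno H hH ⟨fun u => e (f u), fun a b hab => e.strictMono (hf hab), ?_, β, hβ, ?_⟩
    · intro u v
      by_cases huv : u = v
      · subst huv; simp
      · rw [hadj]
        have hu := (hmB _ _).1 (hfβ u)
        have hv := (hmB _ _).1 (hfβ v)
        have hne : blk (f u) ≠ blk (f v) := by rw [hu, hv]; exact fun h => huv (hβ h)
        have hne' : f u ≠ f v := fun h => huv (hf.injective h)
        simp [G', hne, hne']
    · intro u
      have hu := (hmB _ _).1 (hfβ u)
      rw [← hu]; exact hblk _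
  have hBdeg : ∀ v, (gdeg G' v : ℝ) < c * blockadeWidth B := by
    intro v
    rw [hwidth]
    push_cast
    refine lt_of_le_of_lt ?_ hη
    have h1 : gdeg G' v = (sel univ (fun u => G'.Adj v u)).card := by
      unfold gdeg
      rw [Nat.card_coe_set_eq, ← Set.ncard_coe_finset]
      congr 1
      ext u; simp [mem_sel]
    have h2 : sel univ (fun u => G'.Adj v u) ⊆
        univ.biUnion (fun j => sel (B j) (fun u => G'.Adj v u)) := by
      intro u hu
      rw [mem_biUnion]
      exact ⟨blk u, mem_univ _, (mem_sel _ _ _).2 ⟨(hmB _ _).2 rfl, ((mem_sel _ _ _).1 hu).2⟩⟩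
    have h3 : gdeg G' v ≤ ∑ j, (sel (B j) (fun u => G'.Adj v u)).card := by
      rw [h1]; exact (card_le_card h2).trans card_biUnion_le
    have h4 : ∀ j, ((sel (B j) (fun u => G'.Adj v u)).card : ℝ) ≤
        η * p ^ 2 + if j = blk v then (p:ℝ) else 0 := by
      intro j
      rw [← card_map e.toEmbedding]
      by_cases hj : j = blk v
      · rw [if_pos hj]
        have : ((sel (B j) (fun u => G'.Adj v u)).map e.toEmbedding).card ≤ p := by
          apply card_le_of_injOn_polar _ (θ j) _ (θ j (e v))
          · intro y hy
            obtain ⟨u, hu, rfl⟩ := mem_map.1 hy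
            obtain ⟨hu1, hu2⟩ := (mem_sel _ _ _).1 hu
            rw [hmB] at hu1
            rcases hu2.2 with h | h
            · rw [hj]; exact h.2
            · exact absurd (hj.symm.trans hu1.symm) h.1
          · refine (hθ j).mono ?_
            rw [← hBY j]
            exact_mod_cast map_subset_map.2 (sel_subset _ _)
        have h5 : (((sel (B j) (fun u => G'.Adj v u)).map e.toEmbedding).card : ℝ) ≤ p := by
          exact_mod_cast this
        have : 0 ≤ η * (p:ℝ) ^ 2 := by positivity
        linarith
      · rw [if_neg hj, add_zero]
        refine le_trans ?_ (hdeg (blk v) j (Ne.symm hj) (e v) (hblk v))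
        norm_cast
        apply card_le_card
        intro y hy
        obtain ⟨u, hu, rfl⟩ := mem_map.1 hy
        obtain ⟨hu1, hu2⟩ := (mem_sel _ _ _).1 hu
        rw [hmB] at hu1
        refine (mem_sel _ _ _).2 ⟨hu1 ▸ hblk u, ?_⟩
        rcases hu2.2 with h | h
        · exact absurd (hu1.symm.trans h.1.symm) hj
        · exact h.2
    calc (gdeg G' v : ℝ) ≤ ∑ j, ((sel (B j) (fun u => G'.Adj v u)).card : ℝ) := by exact_mod_cast h3
      _ ≤ ∑ j, (η * p ^ 2 + if j = blk v then (p:ℝ) else 0) := Finset.sum_le_sum fun j _ => h4 j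
      _ = _ := by simp [Finset.sum_add_distrib]
  obtain ⟨A, A', hdisj, hanti, hA, hA'⟩ := hS N k G' B hBblk hBres hk hBno hBdeg
  rw [hwidth] at hA hA'
  push_cast at hA hA'
  obtain ⟨i, hi⟩ := pigeon_blk hk0 A blk _ hA
  obtain ⟨j, hj⟩ := pigeon_blk hk0 A' blk _ hA'
  have hsub : ∀ (A : Finset (Fin N)) i, (sel A (fun u => blk u = i)).map e.toEmbedding ⊆ Y i := by
    intro A i y hy
    obtain ⟨u, hu, rfl⟩ := mem_map.1 hy
    have := ((mem_sel _ _ _).1 hu).2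
    exact this ▸ hblk u
  by_cases hij : i = j
  · exfalso
    subst hij
    have := polar_bound_injOn (p := p) ((sel A (fun u => blk u = i)).map e.toEmbedding)
      ((sel A' (fun u => blk u = i)).map e.toEmbedding) (θ i)
      ((hθ i).mono (by exact_mod_cast hsub A i)) ((hθ i).mono (by exact_mod_cast hsub A' i)) (by
        intro x hx y hy hxy
        obtain ⟨u, hu, rfl⟩ := mem_map.1 hx
        obtain ⟨v, hv, rfl⟩ := mem_map.1 hy
        obtain ⟨hu1, hu2⟩ := (mem_sel _ _ _).1 hu
        obtain ⟨hv1, hv2⟩ := (mem_sel _ _ _).1 hv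
        refine hanti u hu1 v hv1 ⟨?_, Or.inl ⟨hu2.trans hv2.symm, ?_⟩⟩
        · rintro rfl; exact Finset.disjoint_left.1 hdisj hu1 hv1
        · rw [hu2]; exact hxy)
    rw [card_map, card_map] at this
    have h2 : (c * (p:ℝ) ^ 2 / k) * (c * (p:ℝ) ^ 2 / k) ≤ (p:ℝ) ^ 3 :=
      le_trans (mul_le_mul hi hj (by positivity) (by positivity)) this
    have h3 : (c * (p:ℝ) ^ 2 / k) * (c * (p:ℝ) ^ 2 / k) = (c ^ 2 * p) * p ^ 3 / k ^ 2 := by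
      field_simp
    rw [h3, div_le_iff₀ (by positivity), mul_comm] at h2
    exact absurd (le_of_mul_le_mul_left h2 (by positivity)) (not_le.2 hp)
  · refine ⟨i, j, hij, _, hsub A i, _, hsub A' j, ?_, ?_, ?_⟩
    · intro x hx y hy hxy
      obtain ⟨u, hu, rfl⟩ := mem_map.1 hx
      obtain ⟨v, hv, rfl⟩ := mem_map.1 hy
      obtain ⟨hu1, hu2⟩ := (mem_sel _ _ _).1 hu
      obtain ⟨hv1, hv2⟩ := (mem_sel _ _ _).1 hv
      refine hanti u hu1 v hv1 ⟨?_, Or.inr ⟨by rw [hu2, hv2]; exact hij, hxy⟩⟩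
      rintro rfl; exact Finset.disjoint_left.1 hdisj hu1 hv1
    · rw [card_map]; exact hi
    · rw [card_map]; exact hj
/-- The sparse property with a given constant. -/
def SRSEHc (𝒜 : Set OGraph) (c : ℝ) : Prop :=
  ∀ (n k : ℕ) (G : SimpleGraph (Fin n)) (B : Fin k → Finset (Fin n)),
      IsBlockade B → Respectful B → 1 / c ≤ (k : ℝ) →
      (∀ H ∈ 𝒜, ¬ ORainbow G H.2 B) →
      (∀ v, (gdeg G v : ℝ) < c * blockadeWidth B) →
      HasAnticompletePair G (c * blockadeWidth B)

open Finset in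
lemma empty_false (c : ℝ) (hc0 : 0 < c) (hS : SRSEHc ∅ c) : False := by
  classical
  set k := ⌈1 / c⌉₊ with hkdef
  have hk : 1 / c ≤ (k:ℝ) := Nat.le_ceil _
  have hkR : (0:ℝ) < k := lt_of_lt_of_le (by positivity) hk
  obtain ⟨p, hpP, hpp⟩ := Nat.exists_infinite_primes (⌈((k:ℝ) + 1) / c⌉₊ + ⌈(k:ℝ) ^ 2 / c ^ 2⌉₊ + 1)
  have : Fact p.Prime := ⟨hpp⟩
  have hpR : (0:ℝ) < p := by exact_mod_cast hpp.pos
  have hpP' : ((⌈((k:ℝ) + 1) / c⌉₊ : ℝ) + ⌈(k:ℝ) ^ 2 / c ^ 2⌉₊ + 1) ≤ p := by exact_mod_cast hpP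
  have b1 := Nat.le_ceil (((k:ℝ) + 1) / c)
  have b2 := Nat.le_ceil ((k:ℝ) ^ 2 / c ^ 2)
  have b3 : (0:ℝ) ≤ ⌈((k:ℝ) + 1) / c⌉₊ := by positivity
  have b4 : (0:ℝ) ≤ ⌈(k:ℝ) ^ 2 / c ^ 2⌉₊ := by positivity
  have c1 : ((k:ℝ) + 1) / c < p := by linarith
  have c2 : (k:ℝ) ^ 2 / c ^ 2 < p := by linarith
  rw [div_lt_iff₀ hc0] at c1
  rw [div_lt_iff₀ (by positivity)] at c2
  obtain ⟨θ, hθ⟩ := exists_theta (p := p) (univ : Finset (Fin (p ^ 2))) (by simp)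
  let π : Fin (k * p ^ 2) → ZMod p × ZMod p := fun u => θ (finProdFinEquiv.symm u).2
  let G : SimpleGraph (Fin (k * p ^ 2)) :=
    { Adj := fun u v => u ≠ v ∧ (π u).1 * (π v).1 = (π u).2 + (π v).2
      symm := ⟨by
        rintro u v ⟨h1, h2⟩
        exact ⟨h1.symm, by rw [mul_comm, h2, add_comm]⟩⟩
      loopless := ⟨fun u h => h.1 rfl⟩ }
  let Y : Fin k → Finset (Fin (k * p ^ 2)) :=
    fun i => univ.image (fun t : Fin (p ^ 2) => finProdFinEquiv (i, t))
  have hYc : ∀ i, (Y i).card = p ^ 2 := by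
    intro i
    rw [Finset.card_image_of_injective]
    · simp
    · intro t t' h
      have := finProdFinEquiv.injective h
      simpa using this
  have hπ : ∀ i, Set.InjOn π (Y i) := by
    intro i x hx y hy hxy
    obtain ⟨t, _, rfl⟩ := mem_image.1 (mem_coe.1 hx)
    obtain ⟨t', _, rfl⟩ := mem_image.1 (mem_coe.1 hy)
    simp only [π, Equiv.symm_apply_apply] at hxy
    rw [hθ (by simp) (by simp) hxy]
  have hresp : Respectful Y := by
    intro i j hij x hx y hy
    obtain ⟨t, _, rfl⟩ := mem_image.1 hx
    obtain ⟨t', _, rfl⟩ := mem_image.1 hy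
    rw [Fin.lt_def]
    simp only [finProdFinEquiv_apply_val]
    have h1 : p ^ 2 * (i.1 + 1) ≤ p ^ 2 * j.1 := Nat.mul_le_mul_left _ hij
    have := t.2
    rw [Nat.mul_add] at h1
    omega
  obtain ⟨i, j, hij, A, hA, B, hB, hanti, hAc, hBc⟩ := core ∅ c hc0 hS k hk p (1 / p) (by positivity)
    (by
      have : (1 / (p:ℝ)) * p ^ 2 = p := by field_simp
      rw [this]; nlinarith) (by linarith) _ G Y hYc hresp (by
      intro i j _ x hx
      have e : (1 / (p:ℝ)) * p ^ 2 = p := by field_simp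
      rw [e]
      have : (sel (Y j) (fun y => G.Adj x y)).card ≤ p := by
        apply card_le_of_injOn_polar _ π ((hπ j).mono (by exact_mod_cast sel_subset _ _)) (π x)
        intro y hy
        exact ((mem_sel _ _ _).1 hy).2.2
      exact_mod_cast this) (by intro H hH; exact absurd hH (Set.notMem_empty _))
  have := polar_bound_injOn (p := p) A B π ((hπ i).mono (by exact_mod_cast hA))
    ((hπ j).mono (by exact_mod_cast hB)) (by
      intro x hx y hy hxy
      refine hanti x hx y hy ⟨?_, hxy⟩
      rcases lt_or_gt_of_ne hij with h | h
      · exact (hresp i j h x (hA hx) y (hB hy)).ne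
      · exact (hresp j i h y (hB hy) x (hA hx)).ne')
  have h2 : (c * (p:ℝ) ^ 2 / k) * (c * (p:ℝ) ^ 2 / k) ≤ (p:ℝ) ^ 3 :=
    le_trans (mul_le_mul hAc hBc (by positivity) (by positivity)) this
  have h3 : (c * (p:ℝ) ^ 2 / k) * (c * (p:ℝ) ^ 2 / k) = (c ^ 2 * p) * p ^ 3 / k ^ 2 := by
    field_simp
  rw [h3, div_le_iff₀ (by positivity), mul_comm] at h2
  have := le_of_mul_le_mul_left h2 (by positivity)
  linarith

open Finset in
lemma two_sided {n k p : ℕ} (hk : 0 < k) (hp : 0 < p) (η : ℝ) (hη : 0 < η)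
    (G : SimpleGraph (Fin n)) (X : Fin k → Finset (Fin n)) (hX : ∀ i, (X i).card = 2 * p ^ 2)
    (h : ∀ i j, i < j → ∀ y ∈ X j,
      ((sel (X i) (fun x => G.Adj y x)).card : ℝ) ≤ η / (2 * k) * p ^ 2) :
    ∃ Y : Fin k → Finset (Fin n), (∀ i, Y i ⊆ X i ∧ (Y i).card = p ^ 2) ∧
      ∀ i j, i ≠ j → ∀ x ∈ Y i, ((sel (Y j) (fun y => G.Adj x y)).card : ℝ) ≤ η * p ^ 2 := by
  classical
  have hkR : (0:ℝ) < k := by exact_mod_cast hk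
  have hk1 : (1:ℝ) ≤ k := by exact_mod_cast hk
  have hpR : (0:ℝ) < p := by exact_mod_cast hp
  let bad : Fin k → Fin k → Finset (Fin n) := fun i j =>
    sel (X i) (fun x => i < j ∧ η * p ^ 2 < ((sel (X j) (fun y => G.Adj y x)).card : ℝ))
  have hbad : ∀ i j, ((bad i j).card : ℝ) ≤ p ^ 2 / k := by
    intro i j
    by_cases hij : i < j
    · have := clean (fun y x => G.Adj y x) (X j) (X i) (η / (2 * k) * p ^ 2) (η * p ^ 2) (h i j hij)
      have e : bad i j = sel (X i) (fun x => η * p ^ 2 < ((sel (X j) (fun y => G.Adj y x)).card : ℝ)) := by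
        simp only [bad, hij, true_and]
      rw [← e, hX j] at this
      push_cast at this
      have h2 : (η * p ^ 2) * ((bad i j).card : ℝ) ≤ (η * p ^ 2) * (p ^ 2 / k) := by
        calc _ = ((bad i j).card : ℝ) * (η * p ^ 2) := by ring
          _ ≤ _ := this
          _ = _ := by field_simp
      exact le_of_mul_le_mul_left h2 (by positivity)
    · have e : bad i j = ∅ := by
        ext x; simp [bad, mem_sel, hij]
      rw [e]; simp; positivity
  have hgood : ∀ i, ∃ Y ⊆ X i \ univ.biUnion (bad i), Y.card = p ^ 2 := by
    intro i
    apply Finset.exists_subset_card_eq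
    have h1 : (univ.biUnion (bad i)).card ≤ p ^ 2 := by
      have h2 : ((univ.biUnion (bad i)).card : ℝ) ≤ ∑ j, ((bad i j).card : ℝ) := by
        exact_mod_cast card_biUnion_le
      have h3 : ∑ j, ((bad i j).card : ℝ) ≤ ∑ j : Fin k, (p:ℝ) ^ 2 / k :=
        Finset.sum_le_sum fun j _ => hbad i j
      simp only [Finset.sum_const, Finset.card_univ, Fintype.card_fin, nsmul_eq_mul] at h3
      rw [mul_div_cancel₀ _ hkR.ne'] at h3
      exact_mod_cast h2.trans h3
    have h2 := Finset.le_card_sdiff (univ.biUnion (bad i)) (X i)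
    rw [hX i] at h2
    omega
  choose Y hY hYc using hgood
  have hYX : ∀ i, Y i ⊆ X i := fun i => (hY i).trans Finset.sdiff_subset
  refine ⟨Y, fun i => ⟨hYX i, hYc i⟩, ?_⟩
  intro i j hij x hx
  have hmono : ∀ P : Fin n → Prop, ((sel (Y j) P).card : ℝ) ≤ (sel (X j) P).card := by
    intro P
    norm_cast
    apply card_le_card
    intro y hy
    rw [mem_sel] at hy ⊢
    exact ⟨hYX j hy.1, hy.2⟩
  refine (hmono _).trans ?_
  rcases lt_or_gt_of_ne hij with hl | hl
  · have := (Finset.mem_sdiff.1 (hY i hx)).2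
    by_contra hcon
    apply this
    rw [mem_biUnion]
    refine ⟨j, mem_univ _, (mem_sel _ _ _).2 ⟨hYX i hx, hl, ?_⟩⟩
    have e : (sel (X j) (fun y => G.Adj y x)) = (sel (X j) (fun y => G.Adj x y)) := by
      ext y; simp [mem_sel, G.adj_comm]
    rw [e]; exact not_le.1 hcon
  · refine (h j i hl x (hYX i hx)).trans ?_
    have : η / (2 * k) ≤ η := div_le_self hη.le (by linarith)
    gcongr

open Finset in
lemma main_step (𝒜 : Set OGraph) (c : ℝ) (hc0 : 0 < c) (hS : SRSEHc 𝒜 c) (H : OGraph) (hH : H ∈ 𝒜)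
    (k : ℕ) (hk : 1 / c ≤ (k:ℝ)) :
    ∃ (N : ℕ) (δ : ℝ), 0 < δ ∧ ∀ (p : ℕ), p.Prime → 2 < c * p → (k:ℝ) ^ 2 < c ^ 2 * p →
    ∀ (n K : ℕ) (G : SimpleGraph (Fin n)) (B : Fin K → Finset (Fin n)) (W : ℝ),
      Respectful B → N ≤ K → (∀ j, W ≤ (B j).card) → ((2 * p ^ 2 : ℕ) : ℝ) ≤ δ * W →
      (∀ H ∈ 𝒜 ∪ (fun H : OGraph => (⟨H.1, H.2ᶜ⟩ : OGraph)) '' 𝒜, ¬ ORainbow G H.2 B) →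
      GHasPurePair G (c * p ^ 2 / k) := by
  classical
  have hkR : (0:ℝ) < k := lt_of_lt_of_le (by positivity) hk
  have hk0 : 0 < k := by exact_mod_cast hkR
  obtain ⟨η, hη⟩ : ∃ η, η = c / (2 * k) := ⟨_, rfl⟩
  have hη0 : 0 < η := by rw [hη]; positivity
  obtain ⟨N, δ, hδ, hB⟩ := lemB (η / (8 * k)) (by positivity) H.1 (2 * k)
  refine ⟨N, δ, hδ, ?_⟩
  intro p hpp hp1 hp2 n K G B W hresp hNK hW hw hno
  have : Fact p.Prime := ⟨hpp⟩
  have hpR : (0:ℝ) < p := by exact_mod_cast hpp.pos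
  obtain ⟨J, σ, X, -, hJc, hX, hXX⟩ := hB n K G H.2.Adj univ B W (2 * p ^ 2) (by simpa using hNK)
    (fun j _ => hW j) (by have := hpp.pos; positivity) hw (by
      rintro ⟨f, β, hf, -, hβ, hadj⟩
      apply hno H (Or.inl hH)
      refine ⟨f, fun a b hab => hresp _ _ (hβ hab) _ (hf a) _ (hf b), ?_, β, hβ.injective, hf⟩
      intro u v
      rcases lt_trichotomy u v with h | h | h
      · exact hadj u v h
      · subst h; simp
      · rw [H.2.adj_comm, G.adj_comm]; exact hadj v u h)
  have hτ : ∃ τ : Prop, ∃ J' ⊆ J, J'.card = k ∧ ∀ i ∈ J', (σ i ↔ τ) := by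
    have hs := sel_card_add J σ
    rcases le_or_gt k (sel J σ).card with h | h
    · obtain ⟨J', h1, h2⟩ := Finset.exists_subset_card_eq h
      exact ⟨True, J', h1.trans (sel_subset _ _), h2, fun i hi => by
        simpa using ((mem_sel _ _ _).1 (h1 hi)).2⟩
    · have h' : k ≤ (sel J (fun x => ¬ σ x)).card := by omega
      obtain ⟨J', h1, h2⟩ := Finset.exists_subset_card_eq h'
      exact ⟨False, J', h1.trans (sel_subset _ _), h2, fun i hi => by
        simpa using ((mem_sel _ _ _).1 (h1 hi)).2⟩
  obtain ⟨τ, J', hJ', hJ'c, hτ⟩ := hτ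
  let e : Fin k ↪o Fin K := J'.orderEmbOfFin hJ'c
  have heJ' : ∀ i, e i ∈ J' := fun i => Finset.orderEmbOfFin_mem _ _ _
  have heJ : ∀ i, e i ∈ J := fun i => hJ' (heJ' i)
  obtain ⟨G1, hG1⟩ : ∃ G1 : SimpleGraph (Fin n), ∀ x y, x ≠ y → (G1.Adj x y ↔ (G.Adj x y ↔ τ)) := by
    by_cases ht : τ
    · exact ⟨G, fun x y _ => by simp [ht]⟩
    · exact ⟨Gᶜ, fun x y hxy => by simp [ht, hxy]⟩
  obtain ⟨Y, hY, hYdeg⟩ := two_sided hk0 hpp.pos η hη0 G1 (fun i => X (e i))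
    (fun i => (hX _ (heJ i)).2) (by
      intro i j hij y hy
      have h1 := hXX (e i) (heJ i) (e j) (heJ j) (e.strictMono hij) y hy
      have h2 : (2 * (η / (8 * k)) * ((2 * p ^ 2 : ℕ) : ℝ)) = η / (2 * k) * p ^ 2 := by
        push_cast; field_simp; norm_num
      rw [h2] at h1
      refine le_trans ?_ h1
      norm_cast
      apply card_le_card
      intro x hx
      rw [mem_sel] at hx ⊢
      refine ⟨hx.1, ?_⟩
      have hxy : x ≠ y := hx.2.ne'
      rw [hτ _ (heJ' i), ← hG1 x y hxy]
      exact hx.2.symm)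
  have hYB : ∀ i, Y i ⊆ B (e i) := fun i => (hY i).1.trans (hX _ (heJ i)).1
  have hYres : Respectful Y := fun i j hij u hu v hv =>
    hresp _ _ (e.strictMono hij) u (hYB i hu) v (hYB j hv)
  obtain ⟨i, j, hij, A, hA, A', hA', hanti, hc1, hc2⟩ := core 𝒜 c hc0 hS k hk p η hη0.le (by
      have : (k:ℝ) * (η * p ^ 2) = c * p ^ 2 / 2 := by rw [hη]; field_simp
      rw [this]; nlinarith) hp2 n G1 Y (fun i => (hY i).2) hYres hYdeg (by
      rintro H' hH' ⟨f, hf, hadj, β, hβ, hfβ⟩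
      by_cases ht : τ
      · apply hno H' (Or.inl hH')
        refine ⟨f, hf, ?_, fun u => e (β u), e.injective.comp hβ, fun u => hYB _ (hfβ u)⟩
        intro u v
        by_cases huv : u = v
        · subst huv; simp
        · rw [hadj, hG1 _ _ (fun h => huv (hf.injective h))]
          simp [ht]
      · apply hno (⟨H'.1, H'.2ᶜ⟩ : OGraph) (Or.inr ⟨H', hH', rfl⟩)
        refine ⟨f, hf, ?_, fun u => e (β u), e.injective.comp hβ, fun u => hYB _ (hfβ u)⟩
        intro u v
        by_cases huv : u = v
        · subst huv; simp
        · rw [SimpleGraph.compl_adj, hadj, hG1 _ _ (fun h => huv (hf.injective h))]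
          simp [ht, huv])
  have hlt : ∀ a ∈ A, ∀ b ∈ A', a ≠ b := by
    intro x hx y hy
    rcases lt_or_gt_of_ne hij with h | h
    · exact (hYres i j h x (hA hx) y (hA' hy)).ne
    · exact (hYres j i h y (hA' hy) x (hA hx)).ne'
  refine ⟨A, A', ?_, ?_, hc1, hc2⟩
  · rw [Finset.disjoint_left]
    intro x hx hx'
    exact hlt x hx x hx' rfl
  · by_cases ht : τ
    · left
      intro a ha b hb hab
      exact hanti a ha b hb ((hG1 _ _ (hlt a ha b hb)).2 (by simp [ht, hab]))
    · right
      intro a ha b hb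
      by_contra hab
      exact hanti a ha b hb ((hG1 _ _ (hlt a ha b hb)).2 (by simp [ht, hab]))

/-- If a set `𝒜` of ordered graphs has the sparse rainbow strong EH-property, then `𝒜`
together with the set of complements of its members has the rainbow strong EH-property. -/
theorem RSEH_of_SRSEH (𝒜 : Set OGraph) (h : SRSEH 𝒜) :
    RSEHset (𝒜 ∪ (fun H : OGraph => (⟨H.1, H.2ᶜ⟩ : OGraph)) '' 𝒜) := by
  classical
  obtain ⟨c, hc0, hc1, hS⟩ := h
  have hS : SRSEHc 𝒜 c := hS
  rcases Set.eq_empty_or_nonempty 𝒜 with rfl | ⟨H, hH⟩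
  · exact (empty_false c hc0 hS).elim
  set k := ⌈1 / c⌉₊ with hkdef
  have hk : 1 / c ≤ (k:ℝ) := Nat.le_ceil _
  have hkR : (0:ℝ) < k := lt_of_lt_of_le (by positivity) hk
  obtain ⟨N, δ, hδ, hmain⟩ := main_step 𝒜 c hc0 hS H hH k hk
  obtain ⟨P, hP⟩ : ∃ P : ℕ, P = ⌈2 / c⌉₊ + ⌈(k:ℝ) ^ 2 / c ^ 2⌉₊ + 1 := ⟨_, rfl⟩
  have hPpos : 0 < P := by omega
  have hPR : (0:ℝ) < P := by exact_mod_cast hPpos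
  set c' : ℝ := min (1 / ((N:ℝ) + 2)) (min (c * δ / (32 * k)) (δ / (8 * P ^ 2))) with hc'
  have hc'0 : 0 < c' := by positivity
  have hc'1 : c' ≤ 1 / ((N:ℝ) + 2) := min_le_left _ _
  have hc'2 : c' ≤ c * δ / (32 * k) := (min_le_right _ _).trans (min_le_left _ _)
  have hc'3 : c' ≤ δ / (8 * P ^ 2) := (min_le_right _ _).trans (min_le_right _ _)
  have hNR : (0:ℝ) ≤ N := by positivity
  refine ⟨c', hc'0, lt_of_le_of_lt hc'1 ?_, ?_⟩
  · rw [div_lt_one (by positivity)]; linarith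
  intro n K G B hB hresp hK hno
  have hKN : N + 2 ≤ K := by
    have h1 : (N:ℝ) + 2 ≤ 1 / c' := by
      rw [le_div_iff₀ hc'0]
      rw [le_div_iff₀ (by positivity)] at hc'1
      linarith
    have := h1.trans hK
    exact_mod_cast this
  set W := blockadeWidth B with hWdef
  have hW : ∀ j, (W:ℝ) ≤ (B j).card := by
    intro j
    have : W ≤ (B j).card := ciInf_le (OrderBot.bddBelow _) j
    exact_mod_cast this
  have hW0 : (0:ℝ) ≤ W := by positivity
  set s := Nat.sqrt ⌊δ * W / 8⌋₊ with hs
  have hs1 : (s:ℝ) ^ 2 ≤ δ * W / 8 := by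
    have h1 : s ^ 2 ≤ ⌊δ * W / 8⌋₊ := Nat.sqrt_le' _
    have h2 := Nat.floor_le (show 0 ≤ δ * W / 8 by positivity)
    have h3 : ((s ^ 2 : ℕ) : ℝ) ≤ ⌊δ * W / 8⌋₊ := by exact_mod_cast h1
    push_cast at h3
    linarith
  have hs2 : δ * W / 8 ≤ ((s:ℝ) + 1) ^ 2 := by
    have h1 : ⌊δ * W / 8⌋₊ + 1 ≤ (s + 1) ^ 2 := Nat.lt_succ_sqrt' _
    have h2 := (Nat.lt_floor_add_one (δ * W / 8)).le
    have h3 : ((⌊δ * W / 8⌋₊ : ℝ) + 1) ≤ ((s:ℝ) + 1) ^ 2 := by exact_mod_cast h1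
    linarith
  rcases lt_or_ge s P with hsP | hsP
  · have h1 : ((s:ℝ) + 1) ≤ P := by exact_mod_cast hsP
    have h2 : ((s:ℝ) + 1) ^ 2 ≤ P ^ 2 := by gcongr
    have h3 : c' * W ≤ 1 := by
      calc c' * W ≤ δ / (8 * P ^ 2) * W := by gcongr
        _ = (δ * W / 8) / P ^ 2 := by field_simp
        _ ≤ 1 := by
          rw [div_le_one (by positivity)]; linarith
    obtain ⟨a, ha⟩ := hB.1 ⟨0, by omega⟩
    obtain ⟨b, hb⟩ := hB.1 ⟨1, by omega⟩
    have hab : a < b := hresp _ _ (by simp [Fin.lt_def]) a ha b hb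
    refine ⟨{a}, {b}, by simpa using hab.ne, ?_, by simpa using h3, by simpa using h3⟩
    by_cases h : G.Adj a b
    · right; simpa using h
    · left; simpa using h
  · obtain ⟨p, hpp, hp1, hp2⟩ := Nat.exists_prime_lt_and_le_two_mul s (by omega)
    have hp1R : (s:ℝ) ≤ p := by exact_mod_cast hp1.le
    have hp2R : (p:ℝ) ≤ 2 * s := by exact_mod_cast hp2
    have hs1' : (1:ℝ) ≤ s := by exact_mod_cast (by omega : 1 ≤ s)
    have hPp : (P:ℝ) ≤ p := by exact_mod_cast (hsP.trans hp1.le)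
    have hPe : (P:ℝ) = (⌈2 / c⌉₊ : ℝ) + ⌈(k:ℝ) ^ 2 / c ^ 2⌉₊ + 1 := by rw [hP]; push_cast; ring
    have b1 := Nat.le_ceil (2 / c)
    have b2 := Nat.le_ceil ((k:ℝ) ^ 2 / c ^ 2)
    have b3 : (0:ℝ) ≤ ⌈2 / c⌉₊ := by positivity
    have b4 : (0:ℝ) ≤ ⌈(k:ℝ) ^ 2 / c ^ 2⌉₊ := by positivity
    have c1 : 2 / c < p := by linarith
    have c2 : (k:ℝ) ^ 2 / c ^ 2 < p := by linarith
    rw [div_lt_iff₀ hc0] at c1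
    rw [div_lt_iff₀ (by positivity)] at c2
    have hpp0 : (0:ℝ) ≤ p := by positivity
    obtain ⟨A, A', h1, h2, h3, h4⟩ := hmain p hpp (by linarith) (by linarith) n K G B W hresp
      (by omega) hW (by push_cast; nlinarith) hno
    have hfin : c' * W ≤ c * p ^ 2 / k := by
      have e1 : ((s:ℝ) + 1) ^ 2 ≤ 4 * p ^ 2 := by nlinarith
      calc c' * W ≤ c * δ / (32 * k) * W := by gcongr
        _ = (c / k) * ((δ * W / 8) / 4) := by field_simp; ring
        _ ≤ (c / k) * p ^ 2 := by gcongr; linarith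
        _ = _ := by ring
    exact ⟨A, A', h1, h2, hfin.trans h3, hfin.trans h4⟩
end

section
/- Let 𝒜 be a set of ordered graphs and let H∈𝒜. Suppose V(H)=V_1∪V_2 with V_1∩V_2=∅ and there are no edges of H between V_1 and V_2. For i=1,2, let H_i be the ordered subgraph of H induced on V_i (with the induced numbering), and let 𝒜_i={H_i}∪(𝒜∖{H}). If both 𝒜_1 and 𝒜_2 have the sparse rainbow strong EH-property, then so does 𝒜. -/
/-- The ordered subgraph of `G` induced on the set `S`, with the induced numbering. -/
noncomputable def inducedOrdered {m : ℕ} (G : SimpleGraph (Fin m)) (S : Finset (Fin m)) :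
    SimpleGraph (Fin S.card) :=
  SimpleGraph.comap (fun i => ((S.orderIsoOfFin rfl) i : Fin m)) G
/-- Finite hypergraph Ramsey theorem (asymmetric two-colour form). -/
theorem hyper_ramsey (r : ℕ) : ∀ a b : ℕ, ∃ K : ℕ, ∀ (k : ℕ) (X : Finset (Fin k)), K ≤ X.card →
    ∀ P : Finset (Fin k) → Prop,
      (∃ Y ⊆ X, Y.card = a ∧ ∀ S ⊆ Y, S.card = r → P S) ∨
      (∃ Y ⊆ X, Y.card = b ∧ ∀ S ⊆ Y, S.card = r → ¬ P S) := by
  classical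
  induction r with
  | zero =>
    intro a b
    refine ⟨max a b, fun k X hX P => ?_⟩
    by_cases hP : P ∅
    · left
      obtain ⟨Y, hY, hc⟩ := Finset.exists_subset_card_eq (le_trans (le_max_left a b) hX)
      exact ⟨Y, hY, hc, fun S _ h => by rw [Finset.card_eq_zero.1 h]; exact hP⟩
    · right
      obtain ⟨Y, hY, hc⟩ := Finset.exists_subset_card_eq (le_trans (le_max_right a b) hX)
      exact ⟨Y, hY, hc, fun S _ h => by rw [Finset.card_eq_zero.1 h]; exact hP⟩
  | succ r ih =>
    suffices h : ∀ s a b : ℕ, a + b = s → ∃ K : ℕ, ∀ (k : ℕ) (X : Finset (Fin k)), K ≤ X.card →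
        ∀ P : Finset (Fin k) → Prop,
        (∃ Y ⊆ X, Y.card = a ∧ ∀ S ⊆ Y, S.card = r + 1 → P S) ∨
        (∃ Y ⊆ X, Y.card = b ∧ ∀ S ⊆ Y, S.card = r + 1 → ¬ P S) from
      fun a b => h _ a b rfl
    intro s
    induction s with
    | zero =>
      intro a b hab
      refine ⟨0, fun k X _ P => Or.inl ⟨∅, by simp, by simp; omega, fun S hS hc => ?_⟩⟩
      rw [Finset.subset_empty.1 hS] at hc
      simp at hc
    | succ s ihs =>
      intro a b hab
      rcases Nat.eq_zero_or_pos a with ha | ha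
      · refine ⟨0, fun k X _ P => Or.inl ⟨∅, by simp, by simp [ha], fun S hS hc => ?_⟩⟩
        rw [Finset.subset_empty.1 hS] at hc
        simp at hc
      rcases Nat.eq_zero_or_pos b with hb | hb
      · refine ⟨0, fun k X _ P => Or.inr ⟨∅, by simp, by simp [hb], fun S hS hc => ?_⟩⟩
        rw [Finset.subset_empty.1 hS] at hc
        simp at hc
      obtain ⟨K1, hK1⟩ := ihs (a - 1) b (by omega)
      obtain ⟨K2, hK2⟩ := ihs a (b - 1) (by omega)
      obtain ⟨K, hK⟩ := ih K1 K2
      refine ⟨K + 1, fun k X hX P => ?_⟩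
      obtain ⟨x, hx⟩ : X.Nonempty := Finset.card_pos.1 (by omega)
      have key : ∀ (Q : Finset (Fin k) → Prop) (Z Y : Finset (Fin k)), Z ⊆ X.erase x → Y ⊆ Z →
          (∀ S ⊆ Z, S.card = r → Q (insert x S)) → (∀ S ⊆ Y, S.card = r + 1 → Q S) →
          insert x Y ⊆ X ∧ (insert x Y).card = Y.card + 1 ∧
            ∀ S ⊆ insert x Y, S.card = r + 1 → Q S := by
        intro Q Z Y hZ hYZ h1 h2
        have hxY : x ∉ Y := fun h => by simpa using hZ (hYZ h)
        refine ⟨?_, Finset.card_insert_of_notMem hxY, ?_⟩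
        · intro y hy
          rcases Finset.mem_insert.1 hy with rfl | hy
          · exact hx
          · exact Finset.mem_of_mem_erase (hZ (hYZ hy))
        · intro S hS hc
          by_cases hxS : x ∈ S
          · rw [← Finset.insert_erase hxS]
            refine h1 _ ?_ (by rw [Finset.card_erase_of_mem hxS]; omega)
            exact (Finset.subset_insert_iff.1 hS).trans hYZ
          · exact h2 S ((Finset.subset_insert_iff_of_notMem hxS).1 hS) hc
      rcases hK k (X.erase x) (by rw [Finset.card_erase_of_mem hx]; omega)
        (fun S => P (insert x S)) with ⟨Z, hZ, hZc, hZP⟩ | ⟨Z, hZ, hZc, hZP⟩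
      · rcases hK1 k Z hZc.ge P with ⟨Y, hY, hYc, hYP⟩ | ⟨Y, hY, hYc, hYP⟩
        · obtain ⟨q1, q2, q3⟩ := key P Z Y hZ hY hZP hYP
          exact Or.inl ⟨_, q1, by omega, q3⟩
        · exact Or.inr ⟨Y, hY.trans (hZ.trans (Finset.erase_subset _ _)), hYc, hYP⟩
      · rcases hK2 k Z hZc.ge P with ⟨Y, hY, hYc, hYP⟩ | ⟨Y, hY, hYc, hYP⟩
        · exact Or.inl ⟨Y, hY.trans (hZ.trans (Finset.erase_subset _ _)), hYc, hYP⟩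
        · obtain ⟨q1, q2, q3⟩ := key (fun S => ¬ P S) Z Y hZ hY hZP hYP
          exact Or.inr ⟨_, q1, by omega, q3⟩

/-- The set `T` of block indices robustly carries copies of `H`: every set `F` of at most `t`
vertices is avoided by some copy of `H` that is rainbow in the blocks indexed by `T`. -/
def RobustOn {n m k : ℕ} (G : SimpleGraph (Fin n)) (H : SimpleGraph (Fin m))
    (B : Fin k → Finset (Fin n)) (t : ℝ) (T : Finset (Fin k)) : Prop :=
  ∀ β : Fin m → Fin k, StrictMono β → Finset.image β Finset.univ = T →
    ∀ F : Finset (Fin n), (F.card : ℝ) ≤ t →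
      ∃ f : Fin m → Fin n, StrictMono f ∧ (∀ u v, H.Adj u v ↔ G.Adj (f u) (f v)) ∧
        (∀ u, f u ∈ B (β u)) ∧ ∀ u, f u ∉ F

theorem width_le {n k : ℕ} (B : Fin k → Finset (Fin n)) (i : Fin k) :
    blockadeWidth B ≤ (B i).card :=
  ciInf_le (OrderBot.bddBelow _) i

/-- Removing few vertices from few blocks leaves a rainbow copy. -/
theorem extract {m : ℕ} (H1 : SimpleGraph (Fin m)) (𝒜 : Set OGraph) (c1 : ℝ) (hc0 : 0 < c1)
    (hc1 : ∀ (n k : ℕ) (G : SimpleGraph (Fin n)) (B : Fin k → Finset (Fin n)),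
      IsBlockade B → Respectful B → 1 / c1 ≤ (k : ℝ) →
      (∀ H ∈ ({(⟨m, H1⟩ : OGraph)} ∪ 𝒜 : Set OGraph), ¬ ORainbow G H.2 B) →
      (∀ v, (gdeg G v : ℝ) < c1 * blockadeWidth B) →
      HasAnticompletePair G (c1 * blockadeWidth B))
    (n k : ℕ) (G : SimpleGraph (Fin n)) (B : Fin k → Finset (Fin n))
    (hB : IsBlockade B) (hR : Respectful B) (hA : ∀ H ∈ 𝒜, ¬ ORainbow G H.2 B)
    (c : ℝ) (hc : c ≤ c1 / 2) (hW : 1 ≤ blockadeWidth B)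
    (hdeg : ∀ v, (gdeg G v : ℝ) < c * blockadeWidth B)
    (hanti : ¬ HasAnticompletePair G (c * blockadeWidth B))
    (S : Finset (Fin k)) (hS : 1 / c1 ≤ (S.card : ℝ))
    (F : Finset (Fin n)) (hF : (F.card : ℝ) ≤ blockadeWidth B / 2) :
    ∃ β : Fin m → Fin k, StrictMono β ∧ (∀ u, β u ∈ S) ∧
      ∃ f : Fin m → Fin n, StrictMono f ∧ (∀ u v, H1.Adj u v ↔ G.Adj (f u) (f v)) ∧
        (∀ u, f u ∈ B (β u)) ∧ ∀ u, f u ∉ F := by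
  classical
  set e := S.orderEmbOfFin rfl with he
  let B' : Fin S.card → Finset (Fin n) := fun i => B (e i) \ F
  have hWR : (1 : ℝ) ≤ blockadeWidth B := by exact_mod_cast hW
  have hcard : ∀ i, (blockadeWidth B : ℝ) / 2 ≤ ((B' i).card : ℝ) := by
    intro i
    have h1 : (B (e i)).card ≤ F.card + (B' i).card := by
      have := Finset.le_card_sdiff F (B (e i))
      show _ ≤ F.card + (B (e i) \ F).card
      omega
    have h2 := width_le B (e i)
    have h3 : (blockadeWidth B : ℝ) ≤ F.card + (B' i).card := by exact_mod_cast h2.trans h1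
    linarith
  have hSpos : 0 < S.card := by
    have : (0 : ℝ) < S.card := lt_of_lt_of_le (by positivity) hS
    exact_mod_cast this
  have : Nonempty (Fin S.card) := ⟨⟨0, hSpos⟩⟩
  have hW' : (blockadeWidth B : ℝ) / 2 ≤ blockadeWidth B' := by
    obtain ⟨i, hi⟩ := exists_eq_ciInf_of_finite (f := fun i => (B' i).card)
    have : blockadeWidth B' = (B' i).card := hi.symm
    rw [this]; exact hcard i
  have hcw : c * blockadeWidth B ≤ c1 * blockadeWidth B' := by nlinarith
  have hmono : ∀ {m' : ℕ} (K : SimpleGraph (Fin m')), ORainbow G K B' → ORainbow G K B := by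
    rintro m' K ⟨f, hf, hadj, β, hβ, hm⟩
    exact ⟨f, hf, hadj, fun u => e (β u), e.injective.comp hβ,
      fun u => (Finset.mem_sdiff.1 (hm u)).1⟩
  have hR' : Respectful B' := fun i j hij u hu v hv =>
    hR _ _ (e.strictMono hij) u (Finset.mem_sdiff.1 hu).1 v (Finset.mem_sdiff.1 hv).1
  have hex : ORainbow G H1 B' := by
    by_contra hno
    apply hanti
    have hpair := hc1 n S.card G B' ?_ hR' hS ?_ ?_
    · obtain ⟨A, A', hd, hAA, h1, h2⟩ := hpair
      exact ⟨A, A', hd, hAA, hcw.trans h1, hcw.trans h2⟩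
    · refine ⟨fun i => Finset.card_pos.1 ?_, fun i j hij => ?_⟩
      · have := hcard i
        have : (0 : ℝ) < (B' i).card := by linarith
        exact_mod_cast this
      · exact Finset.disjoint_of_subset_left Finset.sdiff_subset
          (Finset.disjoint_of_subset_right Finset.sdiff_subset
            (hB.2 _ _ (fun h => hij (e.injective h))))
    · rintro K (hK | hK)
      · rw [Set.mem_singleton_iff] at hK
        subst hK
        exact hno
      · exact fun h => hA K hK (hmono _ h)
    · exact fun v => (hdeg v).trans_le hcw
  obtain ⟨f, hf, hadj, β, hβ, hm⟩ := hex
  refine ⟨fun u => e (β u), ?_, fun u => Finset.orderEmbOfFin_mem _ _ _, f, hf, hadj,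
    fun u => (Finset.mem_sdiff.1 (hm u)).1, fun u => (Finset.mem_sdiff.1 (hm u)).2⟩
  intro u v huv
  apply e.strictMono
  rcases lt_trichotomy (β u) (β v) with h | h | h
  · exact h
  · exact absurd (hβ h) huv.ne
  · exact absurd (hf huv) (hR' _ _ h _ (hm v) _ (hm u)).asymm

/-- Every large enough set of blocks contains an index set robustly carrying `H1`. -/
theorem exists_robust {m : ℕ} (H1 : SimpleGraph (Fin m)) (𝒜 : Set OGraph) (c1 : ℝ) (hc0 : 0 < c1)
    (hc1 : ∀ (n k : ℕ) (G : SimpleGraph (Fin n)) (B : Fin k → Finset (Fin n)),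
      IsBlockade B → Respectful B → 1 / c1 ≤ (k : ℝ) →
      (∀ H ∈ ({(⟨m, H1⟩ : OGraph)} ∪ 𝒜 : Set OGraph), ¬ ORainbow G H.2 B) →
      (∀ v, (gdeg G v : ℝ) < c1 * blockadeWidth B) →
      HasAnticompletePair G (c1 * blockadeWidth B))
    (n k : ℕ) (G : SimpleGraph (Fin n)) (B : Fin k → Finset (Fin n))
    (hB : IsBlockade B) (hR : Respectful B) (hA : ∀ H ∈ 𝒜, ¬ ORainbow G H.2 B)
    (c : ℝ) (hc : c ≤ c1 / 2) (hW : 1 ≤ blockadeWidth B)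
    (hdeg : ∀ v, (gdeg G v : ℝ) < c * blockadeWidth B)
    (hanti : ¬ HasAnticompletePair G (c * blockadeWidth B))
    (S : Finset (Fin k)) (hS : 1 / c1 ≤ (S.card : ℝ)) :
    ∃ T ⊆ S, T.card = m ∧
      RobustOn G H1 B (1 / (2 * 2 ^ S.card) * blockadeWidth B) T := by
  classical
  by_contra! hno
  have hno' : ∀ T : Finset (Fin k), ∃ F : Finset (Fin n),
      (F.card : ℝ) ≤ 1 / (2 * 2 ^ S.card) * blockadeWidth B ∧
      ∀ β : Fin m → Fin k, StrictMono β → Finset.image β Finset.univ = T → T ⊆ S →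
      ¬ ∃ f : Fin m → Fin n, StrictMono f ∧ (∀ u v, H1.Adj u v ↔ G.Adj (f u) (f v)) ∧
        (∀ u, f u ∈ B (β u)) ∧ ∀ u, f u ∉ F := by
    intro T
    by_cases hT : T ⊆ S ∧ T.card = m
    · have h := hno T hT.1 hT.2
      unfold RobustOn at h
      push Not at h
      obtain ⟨β, hβ, him, F, hF, h⟩ := h
      refine ⟨F, hF, fun β' hβ' him' _ => ?_⟩
      have : β' = β := by
        apply (StrictMono.range_inj hβ' hβ).1
        have := him'.trans him.symm
        have := congrArg (fun s : Finset (Fin k) => (s : Set (Fin k))) this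
        simpa using this
      subst this
      rintro ⟨f, q1, q2, q3, q4⟩
      obtain ⟨u, hu⟩ := h f q1 q2 q3
      exact q4 u hu
    · refine ⟨∅, by simp, fun β hβ him hTS => ?_⟩
      exact absurd ⟨hTS, by rw [← him, Finset.card_image_of_injective _ hβ.injective]; simp⟩ hT
  choose F hF hFno using hno'
  obtain ⟨β, hβ, hβS, f, q1, q2, q3, q4⟩ := extract H1 𝒜 c1 hc0 hc1 n k G B hB hR hA c hc hW hdeg
    hanti S hS (S.powerset.biUnion F) (by
      have h1 : ((S.powerset.biUnion F).card : ℝ) ≤ ∑ T ∈ S.powerset, ((F T).card : ℝ) := by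
        exact_mod_cast Finset.card_biUnion_le
      refine h1.trans ((Finset.sum_le_sum fun T _ => hF T).trans ?_)
      rw [Finset.sum_const, Finset.card_powerset, nsmul_eq_mul]
      push_cast
      apply le_of_eq
      field_simp)
  have hsub : Finset.image β Finset.univ ⊆ S := by
    intro x hx
    obtain ⟨u, _, rfl⟩ := Finset.mem_image.1 hx
    exact hβS u
  refine hFno _ β hβ rfl hsub ⟨f, q1, q2, q3, fun u hu => q4 u ?_⟩
  exact Finset.mem_biUnion.2 ⟨_, Finset.mem_powerset.2 hsub, hu⟩

/-- If `H ∈ 𝒜` splits into two anticomplete parts `V₁, V₂` with induced ordered subgraphs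
`H₁, H₂`, and both `{Hᵢ} ∪ (𝒜 \ {H})` have the sparse rainbow strong EH-property, then so
does `𝒜`. -/
theorem SRSEH_of_split (𝒜 : Set OGraph) (H : OGraph) (hH : H ∈ 𝒜)
    (V1 V2 : Finset (Fin H.1))
    (hunion : V1 ∪ V2 = Finset.univ) (hdisj : Disjoint V1 V2)
    (hnoedge : ∀ u ∈ V1, ∀ v ∈ V2, ¬ H.2.Adj u v)
    (h1 : SRSEH ({(⟨V1.card, inducedOrdered H.2 V1⟩ : OGraph)} ∪ (𝒜 \ {H})))
    (h2 : SRSEH ({(⟨V2.card, inducedOrdered H.2 V2⟩ : OGraph)} ∪ (𝒜 \ {H}))) :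
    SRSEH 𝒜 := by
  classical
  obtain ⟨c1, hc10, hc11, hc1⟩ := h1
  obtain ⟨c2, hc20, hc21, hc2⟩ := h2
  obtain ⟨N1, hN1⟩ := exists_nat_ge (1 / c1)
  obtain ⟨N2, hN2⟩ := exists_nat_ge (1 / c2)
  obtain ⟨K2, hK2⟩ := hyper_ramsey V2.card H.1 N2
  obtain ⟨K1, hK1⟩ := hyper_ramsey V1.card K2 N1
  set δ : ℝ := 1 / (2 * 2 ^ N2) with hδ
  have hδ0 : 0 < δ := by positivity
  set c : ℝ := min (min (c1 / 2) (c2 / 2)) (min (1 / (K1 + 1)) (δ / (V1.card + 1))) with hcdef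
  have hcc1 : c ≤ c1 / 2 := (min_le_left _ _).trans (min_le_left _ _)
  have hcc2 : c ≤ c2 / 2 := (min_le_left _ _).trans (min_le_right _ _)
  have hcK : c ≤ 1 / (K1 + 1) := (min_le_right _ _).trans (min_le_left _ _)
  have hcδ : c ≤ δ / (V1.card + 1) := (min_le_right _ _).trans (min_le_right _ _)
  have hc0 : 0 < c := by
    rw [hcdef]
    refine lt_min (lt_min (by positivity) (by positivity)) (lt_min (by positivity) (by positivity))
  refine ⟨c, hc0, by linarith, fun n k G B hB hR hk hA hdeg => ?_⟩
  by_contra hanti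
  have hkK : K1 + 1 ≤ k := by
    have h : ((K1 : ℝ) + 1) ≤ 1 / c := by
      rw [le_div_iff₀ hc0]
      rw [le_div_iff₀ (by positivity)] at hcK
      linarith
    exact_mod_cast h.trans hk
  have hW : 1 ≤ blockadeWidth B := by
    have : Nonempty (Fin k) := ⟨⟨0, by omega⟩⟩
    exact le_ciInf fun i => Finset.card_pos.2 (hB.1 i)
  have hWR : (1 : ℝ) ≤ blockadeWidth B := by exact_mod_cast hW
  have hA' : ∀ H' ∈ 𝒜 \ {H}, ¬ ORainbow G H'.2 B := fun H' h => hA H' h.1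
  obtain ⟨Y1, -, hY1c, hY1⟩ := (hK1 k Finset.univ (by simp; omega)
    (RobustOn G (inducedOrdered H.2 V1) B (1 / (2 * 2 ^ N1) * blockadeWidth B))).resolve_right (by
      rintro ⟨Y, -, hYc, hY⟩
      obtain ⟨T, hTY, hTc, hT⟩ := exists_robust _ _ c1 hc10 hc1 n k G B hB hR hA' c hcc1 hW hdeg
        hanti Y (by rw [hYc]; exact hN1)
      rw [hYc] at hT
      exact hY T hTY hTc hT)
  obtain ⟨Y, hYY1, hYc, hY2⟩ := (hK2 k Y1 hY1c.ge
    (RobustOn G (inducedOrdered H.2 V2) B (δ * blockadeWidth B))).resolve_right (by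
      rintro ⟨Y, -, hYc, hY⟩
      obtain ⟨T, hTY, hTc, hT⟩ := exists_robust _ _ c2 hc20 hc2 n k G B hB hR hA' c hcc2 hW hdeg
        hanti Y (by rw [hYc]; exact hN2)
      rw [hYc] at hT
      exact hY T hTY hTc hT)
  let g := Y.orderEmbOfFin hYc
  let e1 := V1.orderEmbOfFin rfl
  let e2 := V2.orderEmbOfFin rfl
  have himg : ∀ {p : ℕ} (e : Fin p ↪o Fin H.1),
      Finset.image (fun i => g (e i)) Finset.univ ⊆ Y ∧
      (Finset.image (fun i => g (e i)) Finset.univ).card = p := by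
    intro p e
    refine ⟨fun x hx => ?_, ?_⟩
    · obtain ⟨u, _, rfl⟩ := Finset.mem_image.1 hx
      exact Finset.orderEmbOfFin_mem _ _ _
    · exact (Finset.card_image_of_injective _ (g.injective.comp e.injective)).trans (by simp)
  obtain ⟨f1, hf1, hf1a, hf1B, -⟩ := hY1 _ ((himg e1).1.trans hYY1) (himg e1).2
    (fun i => g (e1 i)) (g.strictMono.comp e1.strictMono) rfl ∅ (by simp)
  let F : Finset (Fin n) := Finset.univ.biUnion fun u => Finset.univ.filter fun x => G.Adj (f1 u) x
  have hFc : (F.card : ℝ) ≤ δ * blockadeWidth B := by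
    have h1 : (F.card : ℝ) ≤
        ∑ u, ((Finset.univ.filter fun x => G.Adj (f1 u) x).card : ℝ) := by
      exact_mod_cast Finset.card_biUnion_le
    have h2 : ∀ u, ((Finset.univ.filter fun x => G.Adj (f1 u) x).card : ℝ)
        ≤ c * blockadeWidth B := by
      intro u
      have := (hdeg (f1 u)).le
      have h3 : gdeg G (f1 u) = (Finset.univ.filter fun x => G.Adj (f1 u) x).card := by
        unfold gdeg
        rw [Nat.card_eq_fintype_card, Fintype.card_subtype]
        rfl
      rwa [h3] at this
    refine h1.trans ((Finset.sum_le_sum fun u _ => h2 u).trans ?_)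
    rw [Finset.sum_const, Finset.card_univ, Fintype.card_fin, nsmul_eq_mul, ← mul_assoc]
    apply mul_le_mul_of_nonneg_right _ (by positivity)
    rw [le_div_iff₀ (by positivity)] at hcδ
    nlinarith
  obtain ⟨f2, hf2, hf2a, hf2B, hf2F⟩ := hY2 _ (himg e2).1 (himg e2).2
    (fun i => g (e2 i)) (g.strictMono.comp e2.strictMono) rfl F hFc
  have hna : ∀ u v, ¬ G.Adj (f1 u) (f2 v) := fun u v h =>
    hf2F v (Finset.mem_biUnion.2 ⟨u, Finset.mem_univ _, by simpa using h⟩)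
  have hcase : ∀ u : Fin H.1, (∃ i, e1 i = u) ∨ (∃ i, e2 i = u) := by
    intro u
    have hu : u ∈ V1 ∪ V2 := by rw [hunion]; exact Finset.mem_univ _
    rcases Finset.mem_union.1 hu with h | h
    · left
      have : u ∈ Set.range (V1.orderEmbOfFin rfl) := by
        rw [Finset.range_orderEmbOfFin]; exact h
      exact this
    · right
      have : u ∈ Set.range (V2.orderEmbOfFin rfl) := by
        rw [Finset.range_orderEmbOfFin]; exact h
      exact this
  have hex : ∀ u : Fin H.1, ∃ x, (∃ i, e1 i = u ∧ x = f1 i) ∨ (∃ i, e2 i = u ∧ x = f2 i) := by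
    intro u
    rcases hcase u with ⟨i, hi⟩ | ⟨i, hi⟩
    · exact ⟨f1 i, Or.inl ⟨i, hi, rfl⟩⟩
    · exact ⟨f2 i, Or.inr ⟨i, hi, rfl⟩⟩
  choose f hf using hex
  have hfB : ∀ u, f u ∈ B (g u) := by
    intro u
    rcases hf u with ⟨i, hi, hx⟩ | ⟨i, hi, hx⟩
    · rw [hx, ← hi]; exact hf1B i
    · rw [hx, ← hi]; exact hf2B i
  have hm1 : ∀ i, e1 i ∈ V1 := fun i => Finset.orderEmbOfFin_mem _ _ _
  have hm2 : ∀ i, e2 i ∈ V2 := fun i => Finset.orderEmbOfFin_mem _ _ _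
  refine hA H hH ⟨f, fun u v huv => hR _ _ (g.strictMono huv) _ (hfB u) _ (hfB v), ?_,
    g, g.injective, hfB⟩
  intro u v
  rcases hf u with ⟨i, hi, hx⟩ | ⟨i, hi, hx⟩ <;> rcases hf v with ⟨j, hj, hy⟩ | ⟨j, hj, hy⟩ <;>
    rw [hx, hy, ← hi, ← hj]
  · exact hf1a i j
  · exact iff_of_false (hnoedge _ (hm1 i) _ (hm2 j)) (hna i j)
  · exact iff_of_false (fun h => hnoedge _ (hm1 j) _ (hm2 i) h.symm) (fun h => hna j i h.symm)
  · exact hf2a i j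
end

section
/- Let 𝒜 be a finite set of ordered graphs. If every transversal of 𝒜 has the sparse rainbow strong EH-property, then 𝒜 has the sparse rainbow strong EH-property. -/
/-- `C` is (the ordered graph of) a connected component of the ordered graph `H`,
with the induced numbering. -/
def IsComponentOf (C H : OGraph) : Prop :=
  ∃ (c : H.2.ConnectedComponent) (S : Finset (Fin H.1)),
    (↑S : Set (Fin H.1)) = c.supp ∧ C = ⟨S.card, inducedOrdered H.2 S⟩

/-- `T` is a transversal of `𝒜`: a choice, for each member `H` of `𝒜`, of one connected
component of `H` with the induced numbering. -/
def IsTransversal (T 𝒜 : Set OGraph) : Prop :=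
  ∃ φ : OGraph → OGraph, T = φ '' 𝒜 ∧ ∀ H ∈ 𝒜, IsComponentOf (φ H) H

open Classical in
/-- Finite Ramsey theorem for `r`-subsets and two colours. -/
theorem ramsey_two (r : ℕ) : ∀ a b : ℕ, ∃ K : ℕ, ∀ (α : Type) (X : Finset α)
    (χ : Finset α → Prop), K ≤ X.card →
    (∃ S ⊆ X, a ≤ S.card ∧ ∀ s ⊆ S, s.card = r → χ s) ∨
    (∃ S ⊆ X, b ≤ S.card ∧ ∀ s ⊆ S, s.card = r → ¬ χ s) := by
  induction r with
  | zero =>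
    intro a b
    refine ⟨max a b, fun α X χ hX => ?_⟩
    by_cases h0 : χ ∅
    · left
      refine ⟨X, subset_rfl, (le_max_left _ _).trans hX, fun s _ hs => ?_⟩
      rw [Finset.card_eq_zero.1 hs]; exact h0
    · right
      refine ⟨X, subset_rfl, (le_max_right _ _).trans hX, fun s _ hs => ?_⟩
      rw [Finset.card_eq_zero.1 hs]; exact h0
  | succ r ih =>
    have key : ∀ t a b : ℕ, a + b = t → ∃ K : ℕ, ∀ (α : Type) (X : Finset α)
        (χ : Finset α → Prop), K ≤ X.card →
        (∃ S ⊆ X, a ≤ S.card ∧ ∀ s ⊆ S, s.card = r + 1 → χ s) ∨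
        (∃ S ⊆ X, b ≤ S.card ∧ ∀ s ⊆ S, s.card = r + 1 → ¬ χ s) := by
      intro t
      induction t with
      | zero =>
        intro a b hab
        refine ⟨0, fun α X χ _ => Or.inl ⟨∅, by simp, by simp; omega, fun s hs hc => ?_⟩⟩
        rw [Finset.subset_empty.1 hs] at hc; simp at hc
      | succ t iht =>
        intro a b hab
        rcases a with _ | a
        · refine ⟨0, fun α X χ _ => Or.inl ⟨∅, by simp, by simp, fun s hs hc => ?_⟩⟩
          rw [Finset.subset_empty.1 hs] at hc; simp at hc
        rcases b with _ | b
        · refine ⟨0, fun α X χ _ => Or.inr ⟨∅, by simp, by simp, fun s hs hc => ?_⟩⟩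
          rw [Finset.subset_empty.1 hs] at hc; simp at hc
        obtain ⟨K1, h1⟩ := iht a (b+1) (by omega)
        obtain ⟨K2, h2⟩ := iht (a+1) b (by omega)
        obtain ⟨K, hK⟩ := ih K1 K2
        refine ⟨K + 1, fun α X χ hX => ?_⟩
        obtain ⟨x, hx⟩ : X.Nonempty := Finset.card_pos.1 (by omega)
        have hXe : K ≤ (X.erase x).card := by
          rw [Finset.card_erase_of_mem hx]; omega
        have ext : ∀ (T : Finset α) (P : Finset α → Prop), x ∉ T →
            (∀ s ⊆ T, s.card = r → P (insert x s)) →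
            (∀ s ⊆ T, s.card = r + 1 → P s) →
            ∀ s ⊆ insert x T, s.card = r + 1 → P s := by
          intro T P hxT hA hB s hs hc
          by_cases hxs : x ∈ s
          · have := hA (s.erase x) (by
              intro y hy
              have h3 := hs (Finset.mem_of_mem_erase hy)
              exact (Finset.mem_insert.1 h3).resolve_left (Finset.ne_of_mem_erase hy))
              (by rw [Finset.card_erase_of_mem hxs]; omega)
            rwa [Finset.insert_erase hxs] at this
          · exact hB s ((Finset.subset_insert_iff_of_notMem hxs).1 hs) hc
        rcases hK α (X.erase x) (fun s => χ (insert x s)) hXe with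
          ⟨S, hS, hSc, hSχ⟩ | ⟨S, hS, hSc, hSχ⟩
        · have hSX : S ⊆ X := hS.trans (Finset.erase_subset _ _)
          rcases h1 α S χ hSc with ⟨T, hT, hTc, hTχ⟩ | ⟨T, hT, hTc, hTχ⟩
          · left
            have hxT : x ∉ T := fun h => Finset.notMem_erase x X (hS (hT h))
            refine ⟨insert x T, Finset.insert_subset hx (hT.trans hSX), ?_, ?_⟩
            · rw [Finset.card_insert_of_notMem hxT]; omega
            · exact ext T χ hxT (fun s hs => hSχ s (hs.trans hT)) hTχ
          · exact Or.inr ⟨T, hT.trans hSX, hTc, hTχ⟩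
        · have hSX : S ⊆ X := hS.trans (Finset.erase_subset _ _)
          rcases h2 α S χ hSc with ⟨T, hT, hTc, hTχ⟩ | ⟨T, hT, hTc, hTχ⟩
          · exact Or.inl ⟨T, hT.trans hSX, hTc, hTχ⟩
          · right
            have hxT : x ∉ T := fun h => Finset.notMem_erase x X (hS (hT h))
            refine ⟨insert x T, Finset.insert_subset hx (hT.trans hSX), ?_, ?_⟩
            · rw [Finset.card_insert_of_notMem hxT]; omega
            · exact ext T (fun s => ¬ χ s) hxT (fun s hs => hSχ s (hs.trans hT)) hTχ
    exact fun a b => key _ a b rfl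

open Classical in
/-- Ramsey's theorem, simultaneously for finitely many two-colourings. -/
theorem ramsey_multi (𝒞 : Finset OGraph) : ∀ L : ℕ, ∃ K : ℕ, ∀ (α : Type) (X : Finset α)
    (χ : OGraph → Finset α → Prop), K ≤ X.card →
    ∃ S ⊆ X, L ≤ S.card ∧ ∀ C ∈ 𝒞,
      (∀ s ⊆ S, s.card = C.1 → χ C s) ∨ (∀ s ⊆ S, s.card = C.1 → ¬ χ C s) := by
  induction 𝒞 using Finset.induction_on with
  | empty =>
    intro L
    exact ⟨L, fun α X χ hX => ⟨X, subset_rfl, hX, by simp⟩⟩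
  | insert C 𝒞 hC ih =>
    intro L
    obtain ⟨K1, h1⟩ := ramsey_two C.1 L L
    obtain ⟨K, hK⟩ := ih K1
    refine ⟨K, fun α X χ hX => ?_⟩
    obtain ⟨S, hS, hSc, hSχ⟩ := hK α X χ hX
    have fin : ∀ T ⊆ S, L ≤ T.card → ((∀ s ⊆ T, s.card = C.1 → χ C s) ∨
        (∀ s ⊆ T, s.card = C.1 → ¬ χ C s)) →
        ∃ S ⊆ X, L ≤ S.card ∧ ∀ D ∈ insert C 𝒞,
      (∀ s ⊆ S, s.card = D.1 → χ D s) ∨ (∀ s ⊆ S, s.card = D.1 → ¬ χ D s) := by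
      intro T hT hTc hTχ
      refine ⟨T, hT.trans hS, hTc, fun D hD => ?_⟩
      rcases Finset.mem_insert.1 hD with rfl | hD
      · exact hTχ
      · exact (hSχ D hD).imp (fun h s hs => h s (hs.trans hT)) (fun h s hs => h s (hs.trans hT))
    rcases h1 α S (χ C) hSc with ⟨T, hT, hTc, hTχ⟩ | ⟨T, hT, hTc, hTχ⟩
    · exact fin T hT hTc (Or.inl hTχ)
    · exact fin T hT hTc (Or.inr hTχ)

/-- The body of the SRSEH property with a given constant. -/
def SRSEHWith (c : ℝ) (𝒜 : Set OGraph) : Prop :=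
    ∀ (n k : ℕ) (G : SimpleGraph (Fin n)) (B : Fin k → Finset (Fin n)),
      IsBlockade B → Respectful B → 1 / c ≤ (k : ℝ) →
      (∀ H ∈ 𝒜, ¬ ORainbow G H.2 B) →
      (∀ v, (gdeg G v : ℝ) < c * blockadeWidth B) →
      HasAnticompletePair G (c * blockadeWidth B)

theorem SRSEHWith.mono {c c' : ℝ} {𝒜 : Set OGraph} (h : SRSEHWith c 𝒜) (h0 : 0 < c')
    (hc : c' ≤ c) : SRSEHWith c' 𝒜 := by
  intro n k G B hB hR hk hH hd
  have hle : c' * (blockadeWidth B : ℝ) ≤ c * blockadeWidth B :=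
    mul_le_mul_of_nonneg_right hc (Nat.cast_nonneg _)
  obtain ⟨A, A', h1, h2, h3, h4⟩ := h n k G B hB hR
    ((one_div_le_one_div_of_le h0 hc).trans hk) hH (fun v => (hd v).trans_le hle)
  exact ⟨A, A', h1, h2, hle.trans h3, hle.trans h4⟩

/-- A common constant for finitely many sets with the SRSEH property. -/
theorem uniform_const (𝒯 : Set (Set OGraph)) (hf : 𝒯.Finite) (h : ∀ T ∈ 𝒯, SRSEH T) :
    ∃ c : ℝ, 0 < c ∧ c < 1 ∧ ∀ T ∈ 𝒯, SRSEHWith c T := by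
  induction 𝒯, hf using Set.Finite.induction_on with
  | empty => exact ⟨1/2, by norm_num, by norm_num, by simp⟩
  | insert _ _ ih =>
    obtain ⟨c, h0, h1, hc⟩ := ih (fun T hT => h T (Set.mem_insert_of_mem _ hT))
    obtain ⟨c', h0', h1', hc'⟩ := h _ (Set.mem_insert _ _)
    refine ⟨min c c', lt_min h0 h0', (min_le_left _ _).trans_lt h1, ?_⟩
    rintro T (rfl | hT)
    · exact SRSEHWith.mono hc' (lt_min h0 h0') (min_le_right _ _)
    · exact (hc T hT).mono (lt_min h0 h0') (min_le_left _ _)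

/-- There is a copy of `C` with vertices in the blocks indexed by `s`. -/
def AliveAt {n K : ℕ} (G : SimpleGraph (Fin n)) (B : Fin K → Finset (Fin n)) (C : OGraph)
    (s : Finset (Fin K)) : Prop :=
  ∃ (f : Fin C.1 → Fin n) (β : Fin C.1 → Fin K), StrictMono β ∧ Set.range β = (s : Set (Fin K)) ∧
    (∀ u v, C.2.Adj u v ↔ G.Adj (f u) (f v)) ∧ ∀ u, f u ∈ B (β u)

theorem AliveAt.mono {n K : ℕ} {G : SimpleGraph (Fin n)} {B B' : Fin K → Finset (Fin n)}
    {C : OGraph} {s : Finset (Fin K)} (h : AliveAt G B' C s) (hB : ∀ i, B' i ⊆ B i) :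
    AliveAt G B C s := by
  obtain ⟨f, β, h1, h2, h3, h4⟩ := h
  exact ⟨f, β, h1, h2, h3, fun u => hB _ (h4 u)⟩

theorem strictMono_of_respectful {n m k : ℕ} {B : Fin k → Finset (Fin n)} (hR : Respectful B)
    {f : Fin m → Fin n} (hf : StrictMono f) {β : Fin m → Fin k} (hβ : Function.Injective β)
    (h : ∀ u, f u ∈ B (β u)) : StrictMono β := by
  intro u v huv
  rcases lt_trichotomy (β u) (β v) with h1 | h1 | h1
  · exact h1
  · exact absurd (hβ h1) huv.ne
  · exact absurd (hR _ _ h1 _ (h v) _ (h u)) (hf huv).asymm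

theorem alive_component {n K m : ℕ} {G : SimpleGraph (Fin n)} {B : Fin K → Finset (Fin n)}
    (H : SimpleGraph (Fin m)) (S : Finset (Fin m)) (γ : Fin m ↪o Fin K) (d : Fin m → Fin n)
    (h : AliveAt G B ⟨S.card, inducedOrdered H S⟩ (S.map γ.toEmbedding)) :
    ∃ g : Fin m → Fin n, (∀ u ∈ S, g u ∈ B (γ u)) ∧
      ∀ u ∈ S, ∀ v ∈ S, (H.Adj u v ↔ G.Adj (g u) (g v)) := by
  classical
  obtain ⟨f, β, h1, h2, h3, h4⟩ := h
  dsimp only at f β h1 h2 h3 h4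
  set e := S.orderIsoOfFin rfl with he
  have hβ : β = fun i => γ (e i : Fin m) := by
    refine (StrictMono.range_inj h1 ?_).1 ?_
    · intro i j hij
      exact γ.strictMono (e.strictMono hij)
    · rw [h2]
      ext x
      simp only [Finset.coe_map, Set.mem_image, Finset.mem_coe, Set.mem_range]
      constructor
      · rintro ⟨u, hu, rfl⟩
        exact ⟨e.symm ⟨u, hu⟩, by simp⟩
      · rintro ⟨i, rfl⟩
        exact ⟨e i, (e i).2, rfl⟩
  subst hβ
  have hg : ∃ g : Fin m → Fin n, ∀ i, g (e i : Fin m) = f i := by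
    refine ⟨fun u => if hu : u ∈ S then f (e.symm ⟨u, hu⟩) else d u, fun i => ?_⟩
    have : (e i : Fin m) ∈ S := (e i).2
    simp [this]
  obtain ⟨g, hg⟩ := hg
  have hsur : ∀ u ∈ S, ∃ i, (e i : Fin m) = u := fun u hu => ⟨e.symm ⟨u, hu⟩, by simp⟩
  refine ⟨g, ?_, ?_⟩
  · intro u hu
    obtain ⟨i, rfl⟩ := hsur u hu
    rw [hg]; exact h4 i
  · intro u hu v hv
    obtain ⟨i, rfl⟩ := hsur u hu
    obtain ⟨j, rfl⟩ := hsur v hv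
    rw [hg, hg]; exact h3 i j

theorem component_finite (H : OGraph) : {C : OGraph | IsComponentOf C H}.Finite := by
  refine (Set.finite_range
    (fun S : Finset (Fin H.1) => (⟨S.card, inducedOrdered H.2 S⟩ : OGraph))).subset ?_
  rintro C ⟨c, S, _, rfl⟩
  exact ⟨S, rfl⟩

/-- Shrink the blocks so that the set of alive pairs becomes stable under further shrinking. -/
theorem exists_stable {n K : ℕ} (G : SimpleGraph (Fin n)) (B : Fin K → Finset (Fin n))
    (𝒞 : Finset OGraph) (W : ℕ) (hW : ∀ i, W ≤ (B i).card) :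
    ∃ j ≤ 𝒞.card * 2 ^ K, ∃ B' : Fin K → Finset (Fin n), (∀ i, B' i ⊆ B i) ∧
      (∀ i, W ≤ 2 ^ j * (B' i).card) ∧
      ∀ B'' : Fin K → Finset (Fin n), (∀ i, B'' i ⊆ B' i) →
        (∀ i, W ≤ 2 ^ (j + 1) * (B'' i).card) →
        ∀ C ∈ 𝒞, ∀ s, AliveAt G B' C s → AliveAt G B'' C s := by
  classical
  let D : (Fin K → Finset (Fin n)) → Finset (OGraph × Finset (Fin K)) := fun B' =>
    (𝒞 ×ˢ Finset.univ).filter (fun p => ¬ AliveAt G B' p.1 p.2)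
  have hD : ∀ B', (D B').card ≤ 𝒞.card * 2 ^ K := by
    intro B'
    refine (Finset.card_filter_le _ _).trans ?_
    simp [Finset.card_product]
  let Q : ℕ → Prop := fun j => ∃ B' : Fin K → Finset (Fin n), (∀ i, B' i ⊆ B i) ∧
      (∀ i, W ≤ 2 ^ j * (B' i).card) ∧ j ≤ (D B').card
  have h0 : Q 0 := ⟨B, fun i => subset_rfl, by simpa using hW, Nat.zero_le _⟩
  have hQ : ∀ j, Q j → j ≤ 𝒞.card * 2 ^ K := fun j ⟨B', _, _, h⟩ => h.trans (hD B')
  obtain ⟨j, hj, hj'⟩ : ∃ j, Q j ∧ ¬ Q (j + 1) := by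
    by_contra hcon
    push Not at hcon
    have : ∀ j, Q j := fun j => Nat.rec h0 (fun j hj => hcon j hj) j
    have := hQ _ (this (𝒞.card * 2 ^ K + 1))
    omega
  refine ⟨j, hQ j hj, ?_⟩
  obtain ⟨B', h1, h2, h3⟩ := hj
  refine ⟨B', h1, h2, fun B'' hB hW'' C hC s hal => ?_⟩
  by_contra hdead
  apply hj'
  refine ⟨B'', fun i => (hB i).trans (h1 i), hW'', ?_⟩
  refine Nat.succ_le_of_lt (h3.trans_lt (Finset.card_lt_card ?_))
  refine (Finset.ssubset_iff_of_subset ?_).2 ⟨(C, s), ?_, ?_⟩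
  · intro p hp
    simp only [D, Finset.mem_filter] at hp ⊢
    exact ⟨hp.1, fun h => hp.2 (h.mono hB)⟩
  · simp [D, hC, hdead]
  · simp [D, hal]

/-- Greedy embedding of all the components. -/
theorem greedy_s16 {n K : ℕ} (G : SimpleGraph (Fin n)) (B : Fin K → Finset (Fin n))
    (H : OGraph) (γ : Fin H.1 ↪o Fin K) (j W M : ℕ) (hM : H.1 ≤ M)
    (hne : ∀ i, (B i).Nonempty) (hW : ∀ i, W ≤ 2 ^ j * (B i).card)
    (hdeg : ∀ v, gdeg G v * (2 ^ (j + 1) * M) ≤ W)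
    (hst : ∀ B'' : Fin K → Finset (Fin n), (∀ i, B'' i ⊆ B i) →
        (∀ i, W ≤ 2 ^ (j + 1) * (B'' i).card) →
        ∀ C, IsComponentOf C H → ∀ s, AliveAt G B C s → AliveAt G B'' C s)
    (hal : ∀ C, IsComponentOf C H → ∀ s : Finset (Fin K), (∀ x ∈ s, x ∈ Set.range γ) →
      s.card = C.1 → AliveAt G B C s) :
    ∃ f : Fin H.1 → Fin n, (∀ u, f u ∈ B (γ u)) ∧ ∀ u v, H.2.Adj u v ↔ G.Adj (f u) (f v) := by
  classical
  have key : ∀ 𝒟 : Finset H.2.ConnectedComponent, ∃ f : Fin H.1 → Fin n,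
      (∀ u, f u ∈ B (γ u)) ∧ ∀ u v, H.2.connectedComponentMk u ∈ 𝒟 →
        H.2.connectedComponentMk v ∈ 𝒟 → (H.2.Adj u v ↔ G.Adj (f u) (f v)) := by
    intro 𝒟
    induction 𝒟 using Finset.induction_on with
    | empty => exact ⟨fun u => (hne (γ u)).choose, fun u => (hne (γ u)).choose_spec, by simp⟩
    | insert c 𝒟 hc ih =>
      obtain ⟨f, hf1, hf2⟩ := ih
      let R : Finset (Fin n) := Finset.univ.biUnion
        (fun u : Fin H.1 => Finset.univ.filter (fun w => G.Adj (f u) w))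
      have hR : R.card * 2 ^ (j + 1) ≤ W := by
        have h1 : ∀ u, (Finset.univ.filter (fun w => G.Adj (f u) w)).card = gdeg G (f u) := by
          intro u
          rw [gdeg, ← Fintype.card_subtype, Nat.card_eq_fintype_card]
          rfl
        have h2 : R.card ≤ ∑ u : Fin H.1, gdeg G (f u) := by
          refine Finset.card_biUnion_le.trans ?_
          simp [h1]
        have h3 : (∑ u : Fin H.1, gdeg G (f u)) * (2 ^ (j+1) * M) ≤ M * W := by
          rw [Finset.sum_mul]
          refine (Finset.sum_le_sum (fun u _ => hdeg (f u))).trans ?_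
          simp only [Finset.sum_const, Finset.card_univ, Fintype.card_fin, smul_eq_mul]
          exact Nat.mul_le_mul_right _ hM
        rcases Nat.eq_zero_or_pos M with hM0 | hM0
        · have : R = ∅ := by
            ext w
            simp only [R, Finset.mem_biUnion, Finset.notMem_empty, iff_false]
            rintro ⟨u, _⟩
            have := u.2
            omega
          simp [this]
        · refine le_of_mul_le_mul_left (a := M) ?_ hM0
          calc M * (R.card * 2 ^ (j+1)) = R.card * (2 ^ (j+1) * M) := by ring
            _ ≤ _ := Nat.mul_le_mul_right _ h2
            _ ≤ _ := h3
      let S : Finset (Fin H.1) := Finset.univ.filter (fun u => H.2.connectedComponentMk u = c)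
      have hcomp : IsComponentOf ⟨S.card, inducedOrdered H.2 S⟩ H := by
        refine ⟨c, S, ?_, rfl⟩
        ext u
        simp [S]
      have hal1 := hst (fun i => B i \ R) (fun i => Finset.sdiff_subset) (fun i => by
          have h1 := hW i
          have h2 : (B i).card ≤ (B i \ R).card + R.card := by
            have := Finset.le_card_sdiff R (B i)
            omega
          have h3 : 2 ^ (j + 1) * (B i).card ≤ 2 ^ (j+1) * (B i \ R).card + 2 ^ (j+1) * R.card := by
            rw [← mul_add]; exact Nat.mul_le_mul_left _ h2
          have h4 : 2 ^ (j + 1) * (B i).card = 2 * (2 ^ j * (B i).card) := by ring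
          rw [mul_comm] at hR
          omega) _ hcomp (S.map γ.toEmbedding)
          (hal _ hcomp _ (by
            intro x hx
            obtain ⟨u, _, rfl⟩ := Finset.mem_map.1 hx
            exact ⟨u, rfl⟩) (Finset.card_map _))
      obtain ⟨g, hg1, hg2⟩ := alive_component H.2 S γ f hal1
      have hS : ∀ u, u ∈ S ↔ H.2.connectedComponentMk u = c := by simp [S]
      have hcross : ∀ u v, u ∈ S → H.2.connectedComponentMk v ∈ 𝒟 →
          ¬ H.2.Adj u v ∧ ¬ G.Adj (g u) (f v) := by
        intro u v hu hv
        constructor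
        · intro hadj
          have := SimpleGraph.ConnectedComponent.connectedComponentMk_eq_of_adj hadj
          rw [(hS u).1 hu] at this
          exact hc (this ▸ hv)
        · intro hadj
          have := hg1 u hu
          simp only [Finset.mem_sdiff, R, Finset.mem_biUnion, Finset.mem_univ, true_and,
            Finset.mem_filter, not_exists] at this
          exact this.2 v hadj.symm
      refine ⟨fun u => if u ∈ S then g u else f u, ?_, ?_⟩
      · intro u
        dsimp only
        split_ifs with hu
        · exact (Finset.mem_sdiff.1 (hg1 u hu)).1
        · exact hf1 u
      · intro u v hu hv
        rw [Finset.mem_insert, ← hS] at hu hv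
        dsimp only
        split_ifs with h1 h2 h2
        · exact hg2 u h1 v h2
        · have := hcross u v h1 (hv.resolve_left h2)
          exact iff_of_false this.1 this.2
        · have := hcross v u h2 (hu.resolve_left h1)
          exact iff_of_false (fun h => this.1 h.symm) (fun h => this.2 h.symm)
        · exact hf2 u v (hu.resolve_left h1) (hv.resolve_left h2)
  obtain ⟨f, hf1, hf2⟩ := key Finset.univ
  exact ⟨f, hf1, fun u v => hf2 u v (Finset.mem_univ _) (Finset.mem_univ _)⟩

/-- If every transversal of a finite set `𝒜` of ordered graphs has the sparse rainbow strong
EH-property, then `𝒜` has the sparse rainbow strong EH-property. -/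
theorem SRSEH_of_transversals (𝒜 : Set OGraph) (hfin : 𝒜.Finite)
    (h : ∀ T : Set OGraph, IsTransversal T 𝒜 → SRSEH T) : SRSEH 𝒜 := by
  classical
  have h𝒞fin : {C : OGraph | ∃ H ∈ 𝒜, IsComponentOf C H}.Finite := by
    refine (hfin.biUnion (fun H _ => component_finite H)).subset ?_
    rintro C ⟨H, hH, hC⟩
    exact Set.mem_biUnion hH hC
  obtain ⟨𝒞, h𝒞⟩ : ∃ 𝒞 : Finset OGraph, ∀ C, C ∈ 𝒞 ↔ ∃ H ∈ 𝒜, IsComponentOf C H :=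
    ⟨h𝒞fin.toFinset, by simp⟩
  obtain ⟨c0, hc0, hc1, hT⟩ := uniform_const {T | IsTransversal T 𝒜} (by
    refine (h𝒞fin.finite_subsets).subset ?_
    rintro T ⟨φ, rfl, hφ⟩
    rintro C ⟨H, hH, rfl⟩
    exact ⟨H, hH, hφ H hH⟩) h
  obtain ⟨M, hM⟩ : ∃ M : ℕ, ∀ H ∈ 𝒜, H.1 ≤ M := by
    obtain ⟨M, hM⟩ := (hfin.image (fun H : OGraph => H.1)).bddAbove
    exact ⟨M, fun H hH => hM ⟨H, hH, rfl⟩⟩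
  obtain ⟨K, hK⟩ := ramsey_multi 𝒞 (max ⌈1 / c0⌉₊ M)
  set N := 𝒞.card * 2 ^ K with hN
  have hP : (1:ℝ) ≤ 2 ^ (N + 1) * (M + 1) * (K + 1) := by
    have h1 : (1:ℝ) ≤ 2 ^ (N + 1) := one_le_pow₀ (by norm_num)
    have h2 : (1:ℝ) ≤ M + 1 := by simp
    have h3 : (1:ℝ) ≤ K + 1 := by simp
    exact one_le_mul_of_one_le_of_one_le (one_le_mul_of_one_le_of_one_le h1 h2) h3
  have hPpos : (0:ℝ) < 2 ^ (N + 1) * (M + 1) * (K + 1) := by positivity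
  set c : ℝ := c0 / (2 ^ (N + 1) * (M + 1) * (K + 1)) with hc
  have hcpos : 0 < c := by positivity
  have hcP : c * (2 ^ (N + 1) * (M + 1) * (K + 1)) = c0 := by
    rw [hc]; field_simp
  have hcle : c ≤ c0 := by
    rw [hc]; exact div_le_self hc0.le hP
  refine ⟨c, hcpos, hcle.trans_lt hc1, ?_⟩
  intro n k G B hB hR hk hH hd
  set W := blockadeWidth B with hWdef
  have hpow1 : (1:ℝ) ≤ 2 ^ (N + 1) := one_le_pow₀ (by norm_num)
  have hM1 : (1:ℝ) ≤ M + 1 := by simp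
  have hK1 : (1:ℝ) ≤ K + 1 := by simp
  have hKk : K ≤ k := by
    have h1 : (K : ℝ) + 1 ≤ 1 / c := by
      rw [le_div_iff₀ hcpos]
      have : c * (K + 1) ≤ c * (2 ^ (N + 1) * (M + 1) * (K + 1)) := by
        apply mul_le_mul_of_nonneg_left _ hcpos.le
        exact le_mul_of_one_le_left (by positivity)
          (one_le_mul_of_one_le_of_one_le hpow1 hM1)
      nlinarith
    have h2 : (K : ℝ) ≤ k := by linarith
    exact_mod_cast h2
  rcases Nat.eq_zero_or_pos W with hW0 | hWpos
  · exact ⟨∅, ∅, by simp, by simp, by simp [hW0], by simp [hW0]⟩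
  have hWle : ∀ i, W ≤ (B i).card := fun i => ciInf_le (OrderBot.bddBelow _) i
  let ι : Fin K → Fin k := Fin.castLE hKk
  have hι : StrictMono ι := Fin.strictMono_castLE hKk
  obtain ⟨j, hj, B', hB'1, hB'2, hB'3⟩ := exists_stable G (fun i => B (ι i)) 𝒞 W
    (fun i => hWle _)
  have hB'R : Respectful B' := fun i i' hii u hu v hv =>
    hR _ _ (hι hii) u (hB'1 i hu) v (hB'1 i' hv)
  have hB'ne : ∀ i, (B' i).Nonempty := by
    intro i
    rw [← Finset.card_pos]
    by_contra h0
    have := hB'2 i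
    have h1 : (B' i).card = 0 := by omega
    rw [h1] at this
    omega
  obtain ⟨S, -, hSc, hSχ⟩ := hK (Fin K) Finset.univ (fun C s => AliveAt G B' C s) (by simp)
  let e : Fin S.card ↪o Fin K := S.orderEmbOfFin rfl
  have heS : ∀ i, e i ∈ S := fun i => S.orderEmbOfFin_mem rfl i
  have hpowj : (2:ℝ) ^ j ≤ 2 ^ (N + 1) := pow_le_pow_right₀ (by norm_num) (by omega)
  -- some member of `𝒜` has all components alive
  by_cases hex : ∃ H ∈ 𝒜, ∀ C, IsComponentOf C H → ∀ s ⊆ S, s.card = C.1 → AliveAt G B' C s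
  · exfalso
    obtain ⟨H, hHA, hHal⟩ := hex
    have hmS : H.1 ≤ S.card := (hM H hHA).trans ((le_max_right _ _).trans hSc)
    let γ : Fin H.1 ↪o Fin K := (Fin.castLEOrderEmb hmS).trans e
    have hγS : ∀ u, γ u ∈ S := fun u => heS _
    obtain ⟨f, hf1, hf2⟩ := greedy_s16 G B' H γ j W M (hM H hHA) hB'ne hB'2 (by
        intro v
        have h1 : (gdeg G v : ℝ) * (2 ^ (j + 1) * M) ≤ W := by
          have h2 : (2:ℝ) ^ (j+1) * M ≤ 2 ^ (N + 1) * (M + 1) * (K + 1) := by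
            have h3 : (2:ℝ) ^ (j+1) * M ≤ 2 ^ (N + 1) * (M + 1) :=
              mul_le_mul (pow_le_pow_right₀ (by norm_num) (by omega)) (by linarith)
                (by positivity) (by positivity)
            exact h3.trans (le_mul_of_one_le_right (by positivity) hK1)
          calc (gdeg G v : ℝ) * (2 ^ (j + 1) * M)
              ≤ (c * W) * (2 ^ (N + 1) * (M + 1) * (K + 1)) :=
                mul_le_mul (hd v).le h2 (by positivity) (by positivity)
            _ = c0 * W := by rw [← hcP]; ring
            _ ≤ W := mul_le_of_le_one_left (by positivity) hc1.le
        exact_mod_cast h1)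
      (fun B'' h1 h2 C hC => hB'3 B'' h1 h2 C ((h𝒞 C).2 ⟨H, hHA, hC⟩))
      (fun C hC s hs hcard => hHal C hC s (fun x hx => by
        obtain ⟨u, rfl⟩ := hs x hx
        exact hγS u) hcard)
    refine hH H hHA ⟨f, ?_, hf2, fun u => ι (γ u), ?_, fun u => hB'1 _ (hf1 u)⟩
    · intro u v huv
      exact hB'R _ _ (γ.strictMono huv) _ (hf1 u) _ (hf1 v)
    · exact hι.injective.comp γ.injective
  · push Not at hex
    have hex2 : ∀ H ∈ 𝒜, ∃ C, IsComponentOf C H ∧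
        ∀ s ⊆ S, s.card = C.1 → ¬ AliveAt G B' C s := by
      intro H hHA
      obtain ⟨C, hC, s, hs, hsc, hdead⟩ := hex H hHA
      refine ⟨C, hC, ?_⟩
      rcases hSχ C ((h𝒞 C).2 ⟨H, hHA, hC⟩) with h1 | h1
      · exact absurd (h1 s hs hsc) hdead
      · exact h1
    choose! φ hφ1 hφ2 using hex2
    let B1 : Fin S.card → Finset (Fin n) := fun i => B' (e i)
    have hB1R : Respectful B1 := fun i i' hii => hB'R _ _ (e.strictMono hii)
    have hB1 : IsBlockade B1 := by
      refine ⟨fun i => hB'ne _, fun i i' hii => ?_⟩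
      have h1 : ι (e i) ≠ ι (e i') := fun h => hii (e.injective (hι.injective h))
      exact Finset.disjoint_of_subset_left (hB'1 _)
        (Finset.disjoint_of_subset_right (hB'1 _) (hB.2 _ _ h1))
    have hlen : 1 / c0 ≤ (S.card : ℝ) := by
      refine (Nat.le_ceil _).trans ?_
      exact_mod_cast (le_max_left _ _).trans hSc
    have hne : Nonempty (Fin S.card) := by
      have h1 : (0:ℝ) < S.card := lt_of_lt_of_le (by positivity) hlen
      exact ⟨⟨0, by exact_mod_cast h1⟩⟩
    have hW1 : W ≤ 2 ^ j * blockadeWidth B1 := by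
      obtain ⟨i, hi⟩ := exists_eq_ciInf_of_finite (f := fun i => (B1 i).card)
      rw [blockadeWidth, ← hi]
      exact hB'2 (e i)
    have hcW : c * W ≤ c0 * blockadeWidth B1 := by
      have h1 : (W:ℝ) ≤ 2 ^ j * blockadeWidth B1 := by exact_mod_cast hW1
      calc c * W ≤ c * (2 ^ j * blockadeWidth B1) := mul_le_mul_of_nonneg_left h1 hcpos.le
        _ = (c * 2 ^ j) * blockadeWidth B1 := by ring
        _ ≤ c0 * blockadeWidth B1 := by
          apply mul_le_mul_of_nonneg_right _ (Nat.cast_nonneg _)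
          rw [← hcP]
          apply mul_le_mul_of_nonneg_left _ hcpos.le
          refine hpowj.trans ?_
          rw [mul_assoc]
          exact le_mul_of_one_le_right (by positivity)
            (one_le_mul_of_one_le_of_one_le hM1 hK1)
    obtain ⟨A, A', h1, h2, h3, h4⟩ := hT (φ '' 𝒜) ⟨φ, rfl, hφ1⟩ n S.card G B1 hB1 hB1R hlen (by
        rintro _ ⟨H, hHA, rfl⟩ ⟨f, hf, hadj, β, hβ, hfβ⟩
        have hβm := strictMono_of_respectful hB1R hf hβ hfβ
        have hinj : Function.Injective (fun u => e (β u)) := e.injective.comp hβ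
        refine hφ2 H hHA (Finset.univ.image (fun u => e (β u))) ?_ ?_
          ⟨f, fun u => e (β u), e.strictMono.comp hβm, by simp, hadj, hfβ⟩
        · intro x hx
          obtain ⟨u, _, rfl⟩ := Finset.mem_image.1 hx
          exact heS _
        · rw [Finset.card_image_of_injective _ hinj]; simp)
      (fun v => (hd v).trans_le hcW)
    exact ⟨A, A', h1, h2, hcW.trans h3, hcW.trans h4⟩
end

section
/- Let 𝒜 be a set of ordered graphs such that every component of some member of 𝒜 is a left-star or a right-star, and every component of some member of 𝒜 is a clique. Then 𝒜 has the sparse rainbow strong EH-property. -/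
/-- Every connected component of the ordered graph `H`, with the induced numbering,
satisfies `P`. -/
def ComponentsAll (H : OGraph) (P : ∀ k : ℕ, SimpleGraph (Fin k) → Prop) : Prop :=
  ∀ (c : H.2.ConnectedComponent) (S : Finset (Fin H.1)),
    (↑S : Set (Fin H.1)) = c.supp → P S.card (inducedOrdered H.2 S)
/-- A left-star: the first vertex is adjacent to every other vertex, and every edge is
incident with the first vertex. -/
def IsLeftStar {n : ℕ} (G : SimpleGraph (Fin n)) : Prop :=
  0 < n ∧ ∀ i j : Fin n, G.Adj i j ↔ (i ≠ j ∧ (i.val = 0 ∨ j.val = 0))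

/-- A right-star: the last vertex is adjacent to every other vertex, and every edge is
incident with the last vertex. -/
def IsRightStar {n : ℕ} (G : SimpleGraph (Fin n)) : Prop :=
  0 < n ∧ ∀ i j : Fin n, G.Adj i j ↔ (i ≠ j ∧ (i.val = n - 1 ∨ j.val = n - 1))
theorem ramseyHyp (s : ℕ) : ∀ N : ℕ, ∃ M : ℕ, ∀ (k : ℕ) (V : Finset (Fin k)), M ≤ V.card →
    ∀ f : Finset (Fin k) → Prop, ∃ T ⊆ V, T.card = N ∧
      ((∀ e ⊆ T, e.card = s → f e) ∨ (∀ e ⊆ T, e.card = s → ¬ f e)) := by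
  classical
  induction s with
  | zero =>
    intro N
    refine ⟨N, fun k V hV f => ?_⟩
    obtain ⟨T, hT, hc⟩ := Finset.exists_subset_card_eq hV
    refine ⟨T, hT, hc, ?_⟩
    by_cases h : f ∅
    · left
      intro e _ he
      rw [Finset.card_eq_zero] at he
      rwa [he]
    · right
      intro e _ he
      rw [Finset.card_eq_zero] at he
      rwa [he]
  | succ s ih =>
    have step : ∀ L : ℕ, ∃ M : ℕ, ∀ (k : ℕ) (V : Finset (Fin k)), M ≤ V.card →
        ∀ f : Finset (Fin k) → Prop, ∃ U ⊆ V, U.card = L ∧ ∃ g : Fin k → Prop,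
          ∀ x ∈ U, ∀ e ⊆ U, e.card = s → (∀ y ∈ e, x < y) → (f (insert x e) ↔ g x) := by
      intro L
      induction L with
      | zero =>
        refine ⟨0, fun k V _ f => ⟨∅, by simp, by simp, fun _ => True, by simp⟩⟩
      | succ L ihL =>
        obtain ⟨M', hM'⟩ := ihL
        obtain ⟨N', hN'⟩ := ih M'
        refine ⟨N' + 1, fun k V hV f => ?_⟩
        have hne : V.Nonempty := by
          rw [← Finset.card_pos]; omega
        set x0 := V.min' hne with hx0
        have hx0V : x0 ∈ V := V.min'_mem hne
        obtain ⟨T, hTV, hTc, hT⟩ := hN' k (V.erase x0)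
          (by rw [Finset.card_erase_of_mem hx0V]; omega) (fun e => f (insert x0 e))
        obtain ⟨U, hUT, hUc, g, hg⟩ := hM' k T hTc.ge f
        have hlt : ∀ y ∈ U, x0 < y := by
          intro y hy
          have h1 := hTV (hUT hy)
          rw [Finset.mem_erase] at h1
          exact lt_of_le_of_ne (V.min'_le y h1.2) (Ne.symm h1.1)
        have hx0U : x0 ∉ U := fun h => lt_irrefl _ (hlt _ h)
        have hsub : ∀ x ∈ insert x0 U, ∀ e ⊆ insert x0 U, (∀ y ∈ e, x < y) → e ⊆ U := by
          intro x hx e he hy z hz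
          have h1 := he hz
          rw [Finset.mem_insert] at h1
          rcases h1 with h1 | h1
          · have h2 := hy z hz
            rw [Finset.mem_insert] at hx
            rcases hx with hx | hx
            · rw [hx, h1] at h2
              exact absurd h2 (lt_irrefl _)
            · have h3 := hlt x hx
              rw [h1] at h2
              exact absurd (h2.trans h3) (lt_irrefl _)
          · exact h1
        obtain ⟨p, hp⟩ : ∃ p : Prop, ∀ e ⊆ T, e.card = s → (f (insert x0 e) ↔ p) := by
          rcases hT with hT | hT
          · exact ⟨True, fun e h1 h2 => iff_true_intro (hT e h1 h2)⟩
          · exact ⟨False, fun e h1 h2 => iff_false_intro (hT e h1 h2)⟩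
        refine ⟨insert x0 U, ?_, ?_, fun x => if x = x0 then p else g x, ?_⟩
        · intro z hz
          rw [Finset.mem_insert] at hz
          rcases hz with hz | hz
          · rw [hz]; exact hx0V
          · exact Finset.mem_of_mem_erase (hTV (hUT hz))
        · rw [Finset.card_insert_of_notMem hx0U, hUc]
        · intro x hx e he hec hxe
          have heU := hsub x hx e he hxe
          rw [Finset.mem_insert] at hx
          by_cases hxx : x = x0
          · simp only [hxx, if_true]
            exact hp e (heU.trans hUT) hec
          · simp only [hxx, if_false]
            exact hg x (hx.resolve_left hxx) e heU hec hxe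
    intro N
    obtain ⟨M, hM⟩ := step (2 * N)
    refine ⟨M, fun k V hV f => ?_⟩
    obtain ⟨U, hUV, hUc, g, hg⟩ := hM k V hV f
    have key : ∀ e ⊆ U, e.card = s + 1 → ∃ x ∈ e, (f e ↔ g x) := by
      intro e he hec
      have hne : e.Nonempty := by
        rw [← Finset.card_pos]; omega
      have hm := e.min'_mem hne
      refine ⟨e.min' hne, hm, ?_⟩
      have h := hg (e.min' hne) (he hm) (e.erase (e.min' hne))
        ((Finset.erase_subset _ _).trans he)
        (by rw [Finset.card_erase_of_mem hm]; omega)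
        (fun y hy => Finset.min'_lt_of_mem_erase_min' e hne hy)
      rwa [Finset.insert_erase hm] at h
    have hsum := Finset.card_filter_add_card_filter_not (s := U) g
    by_cases hle : N ≤ (U.filter g).card
    · obtain ⟨T, hT, hTc⟩ := Finset.exists_subset_card_eq hle
      refine ⟨T, (hT.trans (Finset.filter_subset _ _)).trans hUV, hTc, Or.inl ?_⟩
      intro e he hec
      obtain ⟨x, hx, h⟩ := key e ((he.trans hT).trans (Finset.filter_subset _ _)) hec
      exact h.2 (Finset.mem_filter.1 (hT (he hx))).2
    · have hle2 : N ≤ (U.filter (fun a => ¬ g a)).card := by omega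
      obtain ⟨T, hT, hTc⟩ := Finset.exists_subset_card_eq hle2
      refine ⟨T, (hT.trans (Finset.filter_subset _ _)).trans hUV, hTc, Or.inr ?_⟩
      intro e he hec
      obtain ⟨x, hx, h⟩ := key e ((he.trans hT).trans (Finset.filter_subset _ _)) hec
      exact fun hf => (Finset.mem_filter.1 (hT (he hx))).2 (h.1 hf)

/-- A pattern is rich on `J` if it survives deleting any set of size at most `d`. -/
def Rich {n k : ℕ} (B : Fin k → Finset (Fin n)) (d : ℝ)
    (P : Finset (Fin k) → (Fin k → Fin n) → Prop) (J : Finset (Fin k)) : Prop :=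
  ∀ X : Finset (Fin n), (X.card : ℝ) ≤ d →
    ∃ x : Fin k → Fin n, (∀ j ∈ J, x j ∈ B j ∧ x j ∉ X) ∧ P J x

def CliqueP {n k : ℕ} (G : SimpleGraph (Fin n)) (J : Finset (Fin k)) (x : Fin k → Fin n) : Prop :=
  ∀ i ∈ J, ∀ j ∈ J, i ≠ j → G.Adj (x i) (x j)

def LeftP {n k : ℕ} (G : SimpleGraph (Fin n)) (J : Finset (Fin k)) (x : Fin k → Fin n) : Prop :=
  ∀ i ∈ J, ∀ j ∈ J, i ≠ j → (G.Adj (x i) (x j) ↔ ((∀ l ∈ J, i ≤ l) ∨ (∀ l ∈ J, j ≤ l)))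

def RightP {n k : ℕ} (G : SimpleGraph (Fin n)) (J : Finset (Fin k)) (x : Fin k → Fin n) : Prop :=
  ∀ i ∈ J, ∀ j ∈ J, i ≠ j → (G.Adj (x i) (x j) ↔ ((∀ l ∈ J, l ≤ i) ∨ (∀ l ∈ J, l ≤ j)))

theorem exists_center {n k : ℕ} (G : SimpleGraph (Fin n)) (B : Fin k → Finset (Fin n))
    (hB : ∀ i j : Fin k, i ≠ j → Disjoint (B i) (B j)) (t : ℝ)
    (hno : ¬ HasAnticompletePair G t) (T : Finset (Fin k)) (t0 : Fin k) (ht0 : t0 ∉ T)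
    (Y : Finset (Fin n)) (h0 : (T.card : ℝ) * t < ((B t0 \ Y).card : ℝ))
    (hT : ∀ i ∈ T, t ≤ ((B i \ Y).card : ℝ)) :
    ∃ v ∈ B t0 \ Y, ∀ j ∈ T, ∃ w ∈ B j \ Y, G.Adj v w := by
  classical
  by_contra hcon
  push Not at hcon
  have hsub : B t0 \ Y ⊆ T.biUnion
      (fun j => (B t0 \ Y).filter (fun v => ∀ w ∈ B j \ Y, ¬ G.Adj v w)) := by
    intro v hv
    obtain ⟨j, hj, h⟩ := hcon v hv
    exact Finset.mem_biUnion.2 ⟨j, hj, Finset.mem_filter.2 ⟨hv, h⟩⟩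
  have h1 : ((B t0 \ Y).card : ℝ) ≤ ∑ j ∈ T,
      (((B t0 \ Y).filter (fun v => ∀ w ∈ B j \ Y, ¬ G.Adj v w)).card : ℝ) := by
    exact_mod_cast (Finset.card_le_card hsub).trans Finset.card_biUnion_le
  have h2 : ∑ j ∈ T,
      (((B t0 \ Y).filter (fun v => ∀ w ∈ B j \ Y, ¬ G.Adj v w)).card : ℝ) ≤ ∑ j ∈ T, t := by
    apply Finset.sum_le_sum
    intro j hj
    by_contra hlt
    push Not at hlt
    apply hno
    refine ⟨_, B j \ Y, ?_, ?_, hlt.le, hT j hj⟩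
    · have hne : t0 ≠ j := fun h => ht0 (h ▸ hj)
      exact (hB t0 j hne).mono ((Finset.filter_subset _ _).trans Finset.sdiff_subset)
        Finset.sdiff_subset
    · intro a ha b hb
      exact (Finset.mem_filter.1 ha).2 b hb
  rw [Finset.sum_const, nsmul_eq_mul] at h2
  linarith

/-- Greedy assembling of components. -/
theorem assemble {n k m : ℕ} (G : SimpleGraph (Fin n)) (B : Fin k → Finset (Fin n))
    (hresp : Respectful B) (H : SimpleGraph (Fin m)) (d D : ℝ) (hn : m = 0 ∨ 0 < n)
    (hD0 : 0 ≤ D) (hdeg : ∀ v, (gdeg G v : ℝ) ≤ D) (hdD : m * D ≤ d)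
    (τ : Fin m → Fin k) (hτ : StrictMono τ)
    (hC : ∀ C : H.ConnectedComponent, ∀ X : Finset (Fin n), (X.card : ℝ) ≤ d →
      ∃ x : Fin m → Fin n, (∀ u, H.connectedComponentMk u = C → x u ∈ B (τ u) ∧ x u ∉ X) ∧
        ∀ u v, H.connectedComponentMk u = C → H.connectedComponentMk v = C →
          (H.Adj u v ↔ G.Adj (x u) (x v))) :
    ORainbow G H B := by
  classical
  have key : ∀ 𝒞 : Finset H.ConnectedComponent, ∃ x : Fin m → Fin n,
      (∀ u, H.connectedComponentMk u ∈ 𝒞 → x u ∈ B (τ u)) ∧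
      ∀ u v, H.connectedComponentMk u ∈ 𝒞 → H.connectedComponentMk v ∈ 𝒞 →
        (H.Adj u v ↔ G.Adj (x u) (x v)) := by
    intro 𝒞
    induction 𝒞 using Finset.induction_on with
    | empty =>
      refine ⟨fun u => ⟨0, ?_⟩, by simp, by simp⟩
      rcases hn with h | h
      · exact absurd u.2 (by omega)
      · exact h
    | insert C 𝒞 hCn ih =>
      obtain ⟨x, hx1, hx2⟩ := ih
      obtain ⟨y, hy1, hy2⟩ := hC C
        ((Finset.univ : Finset (Fin m)).biUnion
          (fun u => (Finset.univ : Finset (Fin n)).filter (fun w => G.Adj (x u) w))) (by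
        refine le_trans ?_ hdD
        have h1 : (((Finset.univ : Finset (Fin m)).biUnion
          (fun u => (Finset.univ : Finset (Fin n)).filter (fun w => G.Adj (x u) w))).card : ℝ)
            ≤ ∑ u : Fin m, (((Finset.univ : Finset (Fin n)).filter
              (fun w => G.Adj (x u) w)).card : ℝ) := by
          exact_mod_cast Finset.card_biUnion_le
        refine h1.trans ?_
        have h2 : ∑ u : Fin m, (((Finset.univ : Finset (Fin n)).filter
              (fun w => G.Adj (x u) w)).card : ℝ) ≤ ∑ u : Fin m, D := by
          apply Finset.sum_le_sum
          intro u _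
          refine le_trans (le_of_eq ?_) (hdeg (x u))
          unfold gdeg
          rw [Nat.card_eq_fintype_card]
          simp [Fintype.card_subtype]
        refine h2.trans (le_of_eq ?_)
        simp)
      have hav : ∀ u v, H.connectedComponentMk v = C → ¬ G.Adj (x u) (y v) := by
        intro u v hv hadj
        apply (hy1 v hv).2
        exact Finset.mem_biUnion.2 ⟨u, Finset.mem_univ _,
          Finset.mem_filter.2 ⟨Finset.mem_univ _, hadj⟩⟩
      refine ⟨fun u => if H.connectedComponentMk u = C then y u else x u, ?_, ?_⟩
      · intro u hu
        by_cases h : H.connectedComponentMk u = C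
        · simp only [h, if_true]
          exact (hy1 u h).1
        · simp only [h, if_false]
          exact hx1 u ((Finset.mem_insert.1 hu).resolve_left h)
      · intro u v hu hv
        by_cases h : H.connectedComponentMk u = C <;> by_cases h' : H.connectedComponentMk v = C
        · simp only [h, h', if_true]
          exact hy2 u v h h'
        · simp only [h, h', if_true, if_false]
          refine iff_of_false ?_ ?_
          · intro hadj
            exact h' ((SimpleGraph.ConnectedComponent.sound hadj.reachable).symm.trans h)
          · exact fun hadj => hav v u h hadj.symm
        · simp only [h, h', if_true, if_false]
          refine iff_of_false ?_ ?_
          · intro hadj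
            exact h ((SimpleGraph.ConnectedComponent.sound hadj.reachable).trans h')
          · exact fun hadj => hav u v h' hadj
        · simp only [h, h', if_false]
          exact hx2 u v ((Finset.mem_insert.1 hu).resolve_left h)
            ((Finset.mem_insert.1 hv).resolve_left h')
  obtain ⟨x, hx1, hx2⟩ := key Finset.univ
  refine ⟨x, ?_, fun u v => hx2 u v (Finset.mem_univ _) (Finset.mem_univ _), τ, hτ.injective,
    fun u => hx1 u (Finset.mem_univ _)⟩
  intro u v huv
  exact hresp (τ u) (τ v) (hτ huv) _ (hx1 u (Finset.mem_univ _)) _ (hx1 v (Finset.mem_univ _))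

theorem star_or_clique {n k : ℕ} (G : SimpleGraph (Fin n)) (B : Fin k → Finset (Fin n))
    (hB : ∀ i j : Fin k, i ≠ j → Disjoint (B i) (B j)) (t : ℝ)
    (hno : ¬ HasAnticompletePair G t) (s R : ℕ)
    (hR : ∀ (V : Finset (Fin k)), R ≤ V.card →
      ∀ f : Finset (Fin k) → Prop, ∃ T ⊆ V, T.card = s + 1 ∧
      ((∀ e ⊆ T, e.card = 2 → f e) ∨ (∀ e ⊆ T, e.card = 2 → ¬ f e)))
    (T : Finset (Fin k)) (t0 : Fin k) (ht0 : t0 ∈ T) (hTR : R + 1 ≤ T.card)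
    (Y : Finset (Fin n)) (ht : 0 ≤ t) (h0 : (T.card : ℝ) * t < ((B t0 \ Y).card : ℝ))
    (hT : ∀ i ∈ T, t ≤ ((B i \ Y).card : ℝ)) :
    ∃ x : Fin k → Fin n, (∀ j ∈ T, x j ∈ B j ∧ x j ∉ Y) ∧ ∃ J ⊆ T, J.card = s + 1 ∧
      (CliqueP G J x ∨ (t0 ∈ J ∧ ∀ i ∈ J, ∀ j ∈ J, i ≠ j →
        (G.Adj (x i) (x j) ↔ i = t0 ∨ j = t0))) := by
  classical
  have hcard : (T.erase t0).card = T.card - 1 := Finset.card_erase_of_mem ht0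
  obtain ⟨v, hv, hw⟩ := exists_center G B hB t hno (T.erase t0) t0 (Finset.notMem_erase _ _) Y
    (by
      refine lt_of_le_of_lt ?_ h0
      apply mul_le_mul_of_nonneg_right _ ht
      exact_mod_cast Finset.card_le_card (Finset.erase_subset _ _))
    (fun i hi => hT i (Finset.mem_of_mem_erase hi))
  haveI : Nonempty (Fin n) := ⟨v⟩
  choose! w hw1 hw2 using hw
  have hx : ∃ x : Fin k → Fin n, x t0 = v ∧ ∀ j ∈ T.erase t0, x j = w j := by
    refine ⟨fun j => if j = t0 then v else w j, by simp, ?_⟩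
    intro j hj
    simp [Finset.ne_of_mem_erase hj]
  obtain ⟨x, hx0, hxw⟩ := hx
  refine ⟨x, ?_, ?_⟩
  · intro j hj
    by_cases h : j = t0
    · rw [h, hx0]
      exact Finset.mem_sdiff.1 hv
    · have hj' := Finset.mem_erase.2 ⟨h, hj⟩
      rw [hxw j hj']
      exact Finset.mem_sdiff.1 (hw1 j hj')
  obtain ⟨Q, hQT, hQc, hQ⟩ := hR (T.erase t0) (by omega)
    (fun e => ∀ i ∈ e, ∀ j ∈ e, i ≠ j → G.Adj (x i) (x j))
  rcases hQ with hQ | hQ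
  · refine ⟨Q, hQT.trans (Finset.erase_subset _ _), hQc, Or.inl ?_⟩
    intro i hi j hj hij
    exact hQ {i, j} (by simp [Finset.insert_subset_iff, hi, hj]) (Finset.card_pair hij) i
      (by simp) j (by simp) hij
  · have hQn : ∀ i ∈ Q, ∀ j ∈ Q, ¬ G.Adj (x i) (x j) := by
      intro i hi j hj hadj
      have hij : i ≠ j := by
        rintro rfl
        exact G.loopless.irrefl _ hadj
      apply hQ {i, j} (by simp [Finset.insert_subset_iff, hi, hj]) (Finset.card_pair hij)
      intro a ha b hb hab
      simp only [Finset.mem_insert, Finset.mem_singleton] at ha hb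
      rcases ha with rfl | rfl <;> rcases hb with rfl | rfl
      · exact absurd rfl hab
      · exact hadj
      · exact hadj.symm
      · exact absurd rfl hab
    obtain ⟨Q', hQ', hQ'c⟩ := Finset.exists_subset_card_eq (show s ≤ Q.card by omega)
    have hQ'T := hQ'.trans hQT
    have ht0Q : t0 ∉ Q' := fun h => Finset.notMem_erase _ _ (hQ'T h)
    have hcen : ∀ j ∈ Q', G.Adj (x t0) (x j) := by
      intro j hj
      rw [hx0, hxw j (hQ'T hj)]
      exact hw2 j (hQ'T hj)
    refine ⟨insert t0 Q', ?_, ?_, Or.inr ⟨Finset.mem_insert_self _ _, ?_⟩⟩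
    · exact Finset.insert_subset ht0 (hQ'T.trans (Finset.erase_subset _ _))
    · rw [Finset.card_insert_of_notMem ht0Q, hQ'c]
    · intro i hi j hj hij
      rw [Finset.mem_insert] at hi hj
      rcases hi with rfl | hi
      · have := hj.resolve_left (Ne.symm hij)
        simp [hcen j this]
      · rcases hj with rfl | hj
        · simp [(hcen i hi).symm]
        · have h1 : i ≠ t0 := fun h => ht0Q (h ▸ hi)
          have h2 : j ≠ t0 := fun h => ht0Q (h ▸ hj)
          simp [h1, h2, hQn i (hQ' hi) j (hQ' hj)]

theorem rich_contra {n k : ℕ} (G : SimpleGraph (Fin n)) (B : Fin k → Finset (Fin n))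
    (hB : ∀ i j : Fin k, i ≠ j → Disjoint (B i) (B j)) (t W d : ℝ) (hW : 0 < W)
    (hBW : ∀ i, W ≤ ((B i).card : ℝ))
    (hno : ¬ HasAnticompletePair G t) (s R : ℕ)
    (hR : ∀ (V : Finset (Fin k)), R ≤ V.card →
      ∀ f : Finset (Fin k) → Prop, ∃ T ⊆ V, T.card = s + 1 ∧
      ((∀ e ⊆ T, e.card = 2 → f e) ∨ (∀ e ⊆ T, e.card = 2 → ¬ f e)))
    (T : Finset (Fin k)) (t0 : Fin k) (ht0 : t0 ∈ T) (hTR : R + 1 ≤ T.card)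
    (ht : 0 ≤ t) (h1 : T.card * t ≤ W / 4) (h2 : 2 * 2 ^ T.card * d ≤ W / 4)
    (P : Finset (Fin k) → (Fin k → Fin n) → Prop)
    (hP : ∀ J ⊆ T, ∀ x : Fin k → Fin n, t0 ∈ J → (∀ i ∈ J, ∀ j ∈ J, i ≠ j →
        (G.Adj (x i) (x j) ↔ i = t0 ∨ j = t0)) → P J x)
    (hc : ∀ J ⊆ T, J.card = s + 1 → ¬ Rich B d (CliqueP G) J)
    (hs : ∀ J ⊆ T, J.card = s + 1 → ¬ Rich B d P J) : False := by
  classical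
  have hX : ∀ (P : Finset (Fin k) → (Fin k → Fin n) → Prop),
      (∀ J ⊆ T, J.card = s + 1 → ¬ Rich B d P J) →
      ∃ Y : Finset (Fin n), (Y.card : ℝ) ≤ 2 ^ T.card * d ∧ ∀ J ⊆ T, J.card = s + 1 →
        ∀ x : Fin k → Fin n, (∀ j ∈ J, x j ∈ B j ∧ x j ∉ Y) → ¬ P J x := by
    intro P hs
    have hex : ∀ J : Finset (Fin k), ∃ X : Finset (Fin n), J ∈ T.powersetCard (s + 1) →
        ((X.card : ℝ) ≤ d ∧
          ∀ x : Fin k → Fin n, (∀ j ∈ J, x j ∈ B j ∧ x j ∉ X) → ¬ P J x) := by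
      intro J
      by_cases hJ : J ∈ T.powersetCard (s + 1)
      · have h := hs J (Finset.mem_powersetCard.1 hJ).1 (Finset.mem_powersetCard.1 hJ).2
        unfold Rich at h
        push Not at h
        obtain ⟨X, hX1, hX2⟩ := h
        exact ⟨X, fun _ => ⟨hX1, hX2⟩⟩
      · exact ⟨∅, fun h => absurd h hJ⟩
    choose X hX using hex
    refine ⟨(T.powersetCard (s + 1)).biUnion X, ?_, ?_⟩
    · have h3 : (((T.powersetCard (s + 1)).biUnion X).card : ℝ) ≤
          ∑ J ∈ T.powersetCard (s + 1), ((X J).card : ℝ) := by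
        exact_mod_cast Finset.card_biUnion_le
      have h4 : ∑ J ∈ T.powersetCard (s + 1), ((X J).card : ℝ) ≤
          ∑ J ∈ T.powersetCard (s + 1), d := Finset.sum_le_sum (fun J hJ => (hX J hJ).1)
      rw [Finset.sum_const, nsmul_eq_mul] at h4
      by_cases hemp : (T.powersetCard (s + 1)).Nonempty
      · obtain ⟨J, hJ⟩ := hemp
        have hd : 0 ≤ d := le_trans (Nat.cast_nonneg _) (hX J hJ).1
        have h5 : ((T.powersetCard (s + 1)).card : ℝ) ≤ 2 ^ T.card := by
          have : (T.powersetCard (s + 1)).card ≤ 2 ^ T.card := by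
            rw [← Finset.card_powerset]
            exact Finset.card_le_card (fun J hJ =>
              Finset.mem_powerset.2 (Finset.mem_powersetCard.1 hJ).1)
          exact_mod_cast this
        exact (h3.trans h4).trans (mul_le_mul_of_nonneg_right h5 hd)
      · exfalso
        have hRT : s + 1 ≤ T.card := by
          obtain ⟨Q, hQ, hQc, _⟩ := hR T (by omega) (fun _ => True)
          rw [← hQc]
          exact Finset.card_le_card hQ
        exact hemp (Finset.powersetCard_nonempty.2 hRT)
    · intro J hJT hJc x hx
      have hJ : J ∈ T.powersetCard (s + 1) := Finset.mem_powersetCard.2 ⟨hJT, hJc⟩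
      apply (hX J hJ).2 x
      intro j hj
      exact ⟨(hx j hj).1, fun h => (hx j hj).2 (Finset.mem_biUnion.2 ⟨J, hJ, h⟩)⟩
  obtain ⟨Y1, hY1, hY1'⟩ := hX _ hc
  obtain ⟨Y2, hY2, hY2'⟩ := hX _ hs
  have hYc : ((Y1 ∪ Y2).card : ℝ) ≤ W / 4 := by
    have : ((Y1 ∪ Y2).card : ℝ) ≤ Y1.card + Y2.card := by
      exact_mod_cast Finset.card_union_le _ _
    linarith
  have hbig : ∀ i, W / 2 ≤ ((B i \ (Y1 ∪ Y2)).card : ℝ) := by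
    intro i
    have h3 : (B i).card ≤ (B i \ (Y1 ∪ Y2)).card + (Y1 ∪ Y2).card := by
      have := Finset.le_card_sdiff (Y1 ∪ Y2) (B i)
      omega
    have h4 : ((B i).card : ℝ) ≤ (B i \ (Y1 ∪ Y2)).card + (Y1 ∪ Y2).card := by
      exact_mod_cast h3
    have := hBW i
    linarith
  have ht4 : t ≤ W / 4 := by
    have : (1 : ℝ) ≤ T.card := by
      exact_mod_cast (show 1 ≤ T.card by omega)
    nlinarith
  obtain ⟨x, hx, J, hJT, hJc, hJ⟩ := star_or_clique G B hB t hno s R hR T t0 ht0 hTR (Y1 ∪ Y2) ht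
    (by have := hbig t0; linarith) (fun i _ => by have := hbig i; linarith)
  rcases hJ with hJ | ⟨hJ0, hJ⟩
  · refine hY1' J hJT hJc x (fun j hj => ⟨(hx j (hJT hj)).1, fun h => ?_⟩) hJ
    exact (hx j (hJT hj)).2 (Finset.mem_union_left _ h)
  · refine hY2' J hJT hJc x (fun j hj => ⟨(hx j (hJT hj)).1, fun h => ?_⟩) (hP J hJT x hJ0 hJ)
    exact (hx j (hJT hj)).2 (Finset.mem_union_right _ h)

/-- Middle part of the homogeneous set. -/
theorem exists_middle {k s m : ℕ} (T : Finset (Fin k)) (hm : m ≤ s) (hT : 3 * s ≤ T.card) :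
    ∃ (τ : Fin m → Fin k) (L U : Finset (Fin k)), StrictMono τ ∧ (∀ u, τ u ∈ T) ∧ L ⊆ T ∧ U ⊆ T ∧
      s ≤ L.card ∧ s ≤ U.card ∧ (∀ u, ∀ l ∈ L, l < τ u) ∧ (∀ u, ∀ l ∈ U, τ u < l) := by
  classical
  set e := T.orderEmbOfFin (rfl : T.card = T.card) with he
  have hmem : ∀ i, e i ∈ T := fun i => Finset.orderEmbOfFin_mem T rfl i
  refine ⟨fun u => e ⟨s + u.1, by omega⟩,
    (Finset.univ : Finset (Fin s)).image (fun u => e ⟨u.1, by omega⟩),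
    (Finset.univ : Finset (Fin s)).image (fun u => e ⟨2 * s + u.1, by omega⟩), ?_, ?_, ?_, ?_, ?_,
    ?_, ?_, ?_⟩
  · intro u v huv
    apply e.strictMono
    simp only [Fin.mk_lt_mk]
    have : u.1 < v.1 := huv
    omega
  · intro u
    exact hmem _
  · intro z hz
    obtain ⟨u, _, rfl⟩ := Finset.mem_image.1 hz
    exact hmem _
  · intro z hz
    obtain ⟨u, _, rfl⟩ := Finset.mem_image.1 hz
    exact hmem _
  · rw [Finset.card_image_of_injective]
    · simp
    · intro u v huv
      have := e.injective huv
      simp only [Fin.mk.injEq] at this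
      exact Fin.ext this
  · rw [Finset.card_image_of_injective]
    · simp
    · intro u v huv
      have := e.injective huv
      simp only [Fin.mk.injEq] at this
      exact Fin.ext (by omega)
  · intro u l hl
    obtain ⟨v, _, rfl⟩ := Finset.mem_image.1 hl
    apply e.strictMono
    simp only [Fin.mk_lt_mk]
    omega
  · intro u l hl
    obtain ⟨v, _, rfl⟩ := Finset.mem_image.1 hl
    apply e.strictMono
    simp only [Fin.mk_lt_mk]
    omega

theorem comp_clique {m : ℕ} (H : SimpleGraph (Fin m))
    (S : Finset (Fin m)) (h : inducedOrdered H S = ⊤) :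
    ∀ u ∈ S, ∀ v ∈ S, (H.Adj u v ↔ u ≠ v) := by
  intro u hu v hv
  obtain ⟨i, hi⟩ := (S.orderIsoOfFin rfl).surjective ⟨u, hu⟩
  obtain ⟨j, hj⟩ := (S.orderIsoOfFin rfl).surjective ⟨v, hv⟩
  have h1 : (inducedOrdered H S).Adj i j ↔ H.Adj u v := by
    unfold inducedOrdered
    rw [SimpleGraph.comap_adj, hi, hj]
  rw [← h1, h, SimpleGraph.top_adj, not_iff_not]
  constructor
  · rintro rfl
    rw [hi] at hj
    exact congrArg Subtype.val hj
  · rintro rfl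
    exact (S.orderIsoOfFin rfl).injective (hi.trans hj.symm)

theorem comp_left {m : ℕ} (H : SimpleGraph (Fin m))
    (S : Finset (Fin m)) (h : IsLeftStar (inducedOrdered H S)) :
    ∀ u ∈ S, ∀ v ∈ S, u ≠ v → (H.Adj u v ↔ ((∀ l ∈ S, u ≤ l) ∨ (∀ l ∈ S, v ≤ l))) := by
  have key : ∀ i, (i.1 = 0) ↔ ∀ l ∈ S, ((S.orderIsoOfFin rfl i : S) : Fin m) ≤ l := by
    intro i
    constructor
    · intro hi l hl
      obtain ⟨j, hj⟩ := (S.orderIsoOfFin rfl).surjective ⟨l, hl⟩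
      have : S.orderIsoOfFin rfl i ≤ S.orderIsoOfFin rfl j := by
        rw [OrderIso.le_iff_le, Fin.le_def]; omega
      rw [hj] at this
      exact this
    · intro hi
      have h0 := hi _ (S.orderIsoOfFin rfl ⟨0, h.1⟩).2
      have : S.orderIsoOfFin rfl i ≤ S.orderIsoOfFin rfl ⟨0, h.1⟩ := h0
      rw [OrderIso.le_iff_le, Fin.le_def] at this
      simpa using this
  intro u hu v hv huv
  obtain ⟨i, hi⟩ := (S.orderIsoOfFin rfl).surjective ⟨u, hu⟩
  obtain ⟨j, hj⟩ := (S.orderIsoOfFin rfl).surjective ⟨v, hv⟩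
  have h1 : (inducedOrdered H S).Adj i j ↔ H.Adj u v := by
    unfold inducedOrdered
    rw [SimpleGraph.comap_adj, hi, hj]
  have hij : i ≠ j := by
    rintro rfl
    rw [hi] at hj
    exact huv (congrArg Subtype.val hj)
  rw [← h1, h.2, key, key, hi, hj]
  simp [hij]

theorem comp_right {m : ℕ} (H : SimpleGraph (Fin m))
    (S : Finset (Fin m)) (h : IsRightStar (inducedOrdered H S)) :
    ∀ u ∈ S, ∀ v ∈ S, u ≠ v → (H.Adj u v ↔ ((∀ l ∈ S, l ≤ u) ∨ (∀ l ∈ S, l ≤ v))) := by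
  have key : ∀ i, (i.1 = S.card - 1) ↔ ∀ l ∈ S, l ≤ ((S.orderIsoOfFin rfl i : S) : Fin m) := by
    intro i
    constructor
    · intro hi l hl
      obtain ⟨j, hj⟩ := (S.orderIsoOfFin rfl).surjective ⟨l, hl⟩
      have : S.orderIsoOfFin rfl j ≤ S.orderIsoOfFin rfl i := by
        rw [OrderIso.le_iff_le, Fin.le_def]; omega
      rw [hj] at this
      exact this
    · intro hi
      have hlt : S.card - 1 < S.card := by have := h.1; omega
      have h0 := hi _ (S.orderIsoOfFin rfl ⟨S.card - 1, hlt⟩).2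
      have : S.orderIsoOfFin rfl ⟨S.card - 1, hlt⟩ ≤ S.orderIsoOfFin rfl i := h0
      rw [OrderIso.le_iff_le, Fin.le_def] at this
      simp only at this
      omega
  intro u hu v hv huv
  obtain ⟨i, hi⟩ := (S.orderIsoOfFin rfl).surjective ⟨u, hu⟩
  obtain ⟨j, hj⟩ := (S.orderIsoOfFin rfl).surjective ⟨v, hv⟩
  have h1 : (inducedOrdered H S).Adj i j ↔ H.Adj u v := by
    unfold inducedOrdered
    rw [SimpleGraph.comap_adj, hi, hj]
  have hij : i ≠ j := by
    rintro rfl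
    rw [hi] at hj
    exact huv (congrArg Subtype.val hj)
  rw [← h1, h.2, key, key, hi, hj]
  simp [hij]

/-- From richness of an `s`-set extending the image of a component, build the component. -/
theorem comp_build {n k m s : ℕ} (G : SimpleGraph (Fin n)) (B : Fin k → Finset (Fin n))
    (H : SimpleGraph (Fin m)) (d : ℝ) (P : Finset (Fin k) → (Fin k → Fin n) → Prop)
    (T E : Finset (Fin k)) (hrich : ∀ J ⊆ T, J.card = s → Rich B d P J)
    (τ : Fin m → Fin k) (hτ : StrictMono τ) (hτT : ∀ u, τ u ∈ T) (hE : E ⊆ T) (hEs : s ≤ E.card)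
    (hm : m ≤ s) (S : Finset (Fin m))
    (hP : ∀ J, S.image τ ⊆ J → J ⊆ S.image τ ∪ E → ∀ x : Fin k → Fin n, P J x →
      ∀ u ∈ S, ∀ v ∈ S, u ≠ v → (H.Adj u v ↔ G.Adj (x (τ u)) (x (τ v))))
    (X : Finset (Fin n)) (hX : (X.card : ℝ) ≤ d) :
    ∃ x : Fin m → Fin n, (∀ u ∈ S, x u ∈ B (τ u) ∧ x u ∉ X) ∧
        ∀ u ∈ S, ∀ v ∈ S, (H.Adj u v ↔ G.Adj (x u) (x v)) := by
  classical
  obtain ⟨J, hJ1, hJ2, hJc⟩ := Finset.exists_subsuperset_card_eq (n := s)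
    (Finset.subset_union_left : S.image τ ⊆ S.image τ ∪ E)
    (by
      refine Finset.card_image_le.trans (le_trans ?_ hm)
      simpa using Finset.card_le_univ S)
    (hEs.trans (Finset.card_le_card Finset.subset_union_right))
  have hJT : J ⊆ T := by
    refine hJ2.trans (Finset.union_subset ?_ hE)
    intro z hz
    obtain ⟨u, _, rfl⟩ := Finset.mem_image.1 hz
    exact hτT u
  obtain ⟨x, hx1, hx2⟩ := hrich J hJT hJc X hX
  refine ⟨fun u => x (τ u), fun u hu => hx1 _ (hJ1 (Finset.mem_image_of_mem _ hu)), ?_⟩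
  intro u hu v hv
  by_cases huv : u = v
  · subst huv
    simp
  · exact hP J hJ1 hJ2 x hx2 u hu v hv huv

/-- If some member of `𝒜` has all its components left-stars or right-stars, and some member
of `𝒜` has all its components cliques, then `𝒜` has the sparse rainbow strong
EH-property. -/
theorem SRSEH_stars_cliques (𝒜 : Set OGraph)
    (h1 : ∃ H ∈ 𝒜, ComponentsAll H (fun _ C => IsLeftStar C ∨ IsRightStar C))
    (h2 : ∃ H ∈ 𝒜, ComponentsAll H (fun _ C => C = ⊤)) :
    SRSEH 𝒜 := by
  classical
  obtain ⟨⟨m1, H1⟩, hH1, hstar⟩ := h1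
  obtain ⟨⟨m2, H2⟩, hH2, hcl⟩ := h2
  set s := m1 + m2 with hs
  obtain ⟨R, hR⟩ := ramseyHyp 2 (s + 1)
  set N := 3 * (s + 1) + R + 1 with hN
  obtain ⟨K1, hK1⟩ := ramseyHyp (s + 1) N
  obtain ⟨K2, hK2⟩ := ramseyHyp (s + 1) K1
  obtain ⟨K3, hK3⟩ := ramseyHyp (s + 1) K2
  set q : ℝ := K3 + 8 * (s + 1) * 2 ^ N + 4 * N + 4 with hq
  have hp1 : (0 : ℝ) ≤ 8 * (s + 1) * 2 ^ N := by positivity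
  have hp2 : (0 : ℝ) ≤ K3 := by positivity
  have hp3 : (0 : ℝ) ≤ 4 * N := by positivity
  have hq4 : 4 ≤ q := by rw [hq]; linarith
  have hq0 : 0 < q := by linarith
  refine ⟨1 / q, by positivity, by rw [div_lt_one hq0]; linarith, ?_⟩
  intro n k G B hBl hresp hk hfree hdeg
  by_contra hno
  set w := blockadeWidth B with hw
  have hwpos : 0 < w := by
    rcases Nat.eq_zero_or_pos w with h | h
    · exfalso
      apply hno
      refine ⟨∅, ∅, by simp, by simp, ?_, ?_⟩ <;> simp [h]
    · exact h
  have hW : (0 : ℝ) < w := by exact_mod_cast hwpos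
  have hBW : ∀ i, (w : ℝ) ≤ ((B i).card : ℝ) := by
    intro i
    have : w ≤ (B i).card := by
      rw [hw]; unfold blockadeWidth
      exact ciInf_le' _ i
    exact_mod_cast this
  have hkK : K3 ≤ (Finset.univ : Finset (Fin k)).card := by
    rw [Finset.card_univ, Fintype.card_fin]
    rw [one_div_one_div] at hk
    have : (K3 : ℝ) ≤ k := by linarith
    exact_mod_cast this
  have hnpos : 0 < n := by
    have hk0 : (0 : ℝ) < k := by
      rw [one_div_one_div] at hk
      linarith
    have hk0' : 0 < k := by exact_mod_cast hk0
    obtain ⟨v, _⟩ := hBl.1 ⟨0, hk0'⟩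
    exact lt_of_le_of_lt (Nat.zero_le _) v.2
  set t : ℝ := 1 / q * w with ht
  have ht0 : 0 ≤ t := by positivity
  have htq : q * t = w := by rw [ht]; field_simp
  set d : ℝ := w / (8 * 2 ^ N) with hd
  have hd1 : 2 * 2 ^ N * d ≤ (w : ℝ) / 4 := by
    rw [hd]; apply le_of_eq; field_simp; norm_num
  have hd2 : (s + 1 : ℝ) * t ≤ d := by
    rw [hd, le_div_iff₀ (by positivity)]
    have : (8 * (s + 1) * 2 ^ N) * t ≤ q * t := by
      apply mul_le_mul_of_nonneg_right _ ht0
      rw [hq]; linarith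
    nlinarith
  have hd3 : (N : ℝ) * t ≤ w / 4 := by
    have : (4 * N) * t ≤ q * t := by
      apply mul_le_mul_of_nonneg_right _ ht0
      rw [hq]; linarith
    linarith
  obtain ⟨T3, hT3, hT3c, hC⟩ := hK3 k Finset.univ hkK (Rich B d (CliqueP G))
  obtain ⟨T2, hT2, hT2c, hL⟩ := hK2 k T3 hT3c.ge (Rich B d (LeftP G))
  obtain ⟨T, hT, hTc, hRt⟩ := hK1 k T2 hT2c.ge (Rich B d (RightP G))
  have hTne : T.Nonempty := by
    rw [← Finset.card_pos]; omega
  have hdeg' : ∀ v, (gdeg G v : ℝ) ≤ t := fun v => (hdeg v).le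
  have hms : ∀ m : ℕ, m ≤ s → (m : ℝ) * t ≤ d := by
    intro m hm
    refine le_trans (mul_le_mul_of_nonneg_right ?_ ht0) hd2
    have : (m : ℝ) ≤ s := by exact_mod_cast hm
    linarith
  have hsupp : ∀ (m : ℕ) (H : SimpleGraph (Fin m)) (C : H.ConnectedComponent),
      ∃ S : Finset (Fin m), (↑S : Set (Fin m)) = C.supp ∧
        ∀ u, H.connectedComponentMk u = C ↔ u ∈ S := by
    intro m H C
    refine ⟨Finset.univ.filter (fun u => H.connectedComponentMk u = C), ?_, ?_⟩
    · ext u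
      simp
    · simp
  rcases hC with hC | hC
  · -- all clique-rich
    apply hfree _ hH2
    obtain ⟨τ, L, U, hτ, hτT, hLT, hUT, hLs, hUs, hL1, hU1⟩ :=
      exists_middle (m := m2) (s := s + 1) T (by omega) (by omega)
    refine assemble G B hresp H2 d t (Or.inr hnpos) ht0 hdeg' (hms _ (by omega)) τ hτ ?_
    intro C X hX
    obtain ⟨S, hS, hSm⟩ := hsupp m2 H2 C
    have hcc := comp_clique H2 S (hcl C S hS)
    obtain ⟨x, hx1, hx2⟩ := comp_build (s := s + 1) G B H2 d (CliqueP G) T L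
      (fun J hJ => hC J ((hJ.trans hT).trans hT2)) τ hτ hτT hLT hLs (by omega) S (by
        intro J hJ1 hJ2 x hx u hu v hv huv
        refine iff_of_true ((hcc u hu v hv).2 huv) ?_
        exact hx _ (hJ1 (Finset.mem_image_of_mem _ hu)) _ (hJ1 (Finset.mem_image_of_mem _ hv))
          (fun h => huv (hτ.injective h))) X hX
    exact ⟨x, fun u hu => hx1 u ((hSm u).1 hu),
      fun u v hu hv => hx2 u ((hSm u).1 hu) v ((hSm v).1 hv)⟩
  · have hCT : ∀ J ⊆ T, J.card = s + 1 → ¬ Rich B d (CliqueP G) J :=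
      fun J hJ => hC J ((hJ.trans hT).trans hT2)
    have hLr : ∀ J ⊆ T, J.card = s + 1 → Rich B d (LeftP G) J := by
      rcases hL with hL | hL
      · exact fun J hJ => hL J (hJ.trans hT)
      · exfalso
        have hm := T.min'_mem hTne
        refine rich_contra G B hBl.2 t w d hW hBW hno s R (hR k) T (T.min' hTne) hm (by omega)
          ht0 (by rw [hTc]; exact hd3) (by rw [hTc]; exact hd1) (LeftP G) ?_ hCT
          (fun J hJ => hL J (hJ.trans hT))
        intro J hJ x hJ0 hx i hi j hj hij
        have key : ∀ i ∈ J, (i = T.min' hTne ↔ ∀ l ∈ J, i ≤ l) := by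
          intro i hi
          constructor
          · rintro rfl l hl
            exact T.min'_le l (hJ hl)
          · intro h
            exact le_antisymm (h _ hJ0) (T.min'_le i (hJ hi))
        rw [hx i hi j hj hij, key i hi, key j hj]
    have hRr : ∀ J ⊆ T, J.card = s + 1 → Rich B d (RightP G) J := by
      rcases hRt with hRt | hRt
      · exact hRt
      · exfalso
        have hm := T.max'_mem hTne
        refine rich_contra G B hBl.2 t w d hW hBW hno s R (hR k) T (T.max' hTne) hm (by omega)
          ht0 (by rw [hTc]; exact hd3) (by rw [hTc]; exact hd1) (RightP G) ?_ hCT hRt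
        intro J hJ x hJ0 hx i hi j hj hij
        have key : ∀ i ∈ J, (i = T.max' hTne ↔ ∀ l ∈ J, l ≤ i) := by
          intro i hi
          constructor
          · rintro rfl l hl
            exact T.le_max' l (hJ hl)
          · intro h
            exact le_antisymm (T.le_max' i (hJ hi)) (h _ hJ0)
        rw [hx i hi j hj hij, key i hi, key j hj]
    apply hfree _ hH1
    obtain ⟨τ, L, U, hτ, hτT, hLT, hUT, hLs, hUs, hL1, hU1⟩ :=
      exists_middle (m := m1) (s := s + 1) T (by omega) (by omega)
    refine assemble G B hresp H1 d t (Or.inr hnpos) ht0 hdeg' (hms _ (by omega)) τ hτ ?_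
    intro C X hX
    obtain ⟨S, hS, hSm⟩ := hsupp m1 H1 C
    have hfin : ∃ x : Fin m1 → Fin n, (∀ u ∈ S, x u ∈ B (τ u) ∧ x u ∉ X) ∧
        ∀ u ∈ S, ∀ v ∈ S, (H1.Adj u v ↔ G.Adj (x u) (x v)) := by
      rcases hstar C S hS with hst | hst
      · have hcc := comp_left H1 S hst
        refine comp_build (s := s + 1) G B H1 d (LeftP G) T U hLr τ hτ hτT hUT hUs (by omega) S
          ?_ X hX
        intro J hJ1 hJ2 x hx u hu v hv huv
        have key : ∀ u ∈ S, ((∀ l ∈ S, u ≤ l) ↔ ∀ l ∈ J, τ u ≤ l) := by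
          intro u hu
          constructor
          · intro h l hl
            rcases Finset.mem_union.1 (hJ2 hl) with hl | hl
            · obtain ⟨z, hz, rfl⟩ := Finset.mem_image.1 hl
              exact hτ.monotone (h z hz)
            · exact (hU1 u l hl).le
          · intro h l hl
            exact hτ.le_iff_le.1 (h _ (hJ1 (Finset.mem_image_of_mem _ hl)))
        rw [hcc u hu v hv huv, key u hu, key v hv]
        exact (hx _ (hJ1 (Finset.mem_image_of_mem _ hu)) _ (hJ1 (Finset.mem_image_of_mem _ hv))
          (fun h => huv (hτ.injective h))).symm
      · have hcc := comp_right H1 S hst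
        refine comp_build (s := s + 1) G B H1 d (RightP G) T L hRr τ hτ hτT hLT hLs (by omega) S
          ?_ X hX
        intro J hJ1 hJ2 x hx u hu v hv huv
        have key : ∀ u ∈ S, ((∀ l ∈ S, l ≤ u) ↔ ∀ l ∈ J, l ≤ τ u) := by
          intro u hu
          constructor
          · intro h l hl
            rcases Finset.mem_union.1 (hJ2 hl) with hl | hl
            · obtain ⟨z, hz, rfl⟩ := Finset.mem_image.1 hl
              exact hτ.monotone (h z hz)
            · exact (hL1 u l hl).le
          · intro h l hl
            exact hτ.le_iff_le.1 (h _ (hJ1 (Finset.mem_image_of_mem _ hl)))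
        rw [hcc u hu v hv huv, key u hu, key v hv]
        exact (hx _ (hJ1 (Finset.mem_image_of_mem _ hu)) _ (hJ1 (Finset.mem_image_of_mem _ hv))
          (fun h => huv (hτ.injective h))).symm
    obtain ⟨x, hx1, hx2⟩ := hfin
    exact ⟨x, fun u hu => hx1 u ((hSm u).1 hu),
      fun u v hu hv => hx2 u ((hSm u).1 hu) v ((hSm v).1 hv)⟩
end
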